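/- Let X be a Lévy process whose characteristic function satisfies E[e^{iθX_t}] = e^{−tΨ(θ)} for all θ ∈ ℝ and t ≥ 0, where Ψ is the β-class characteristic exponent with parameters a ∈ ℝ, σ ∈ ℝ, c₁, c₂, α₁, α₂, β₁, β₂ > 0, λ₁, λ₂ ∈ (0,3)\{1,2}. Fix q > 0 and let (ζₙ⁻)_{n≥0} be the negative-imaginary-axis roots: q + Ψ(iζₙ⁻) = 0 with ζ₀⁻ ∈ (−β₁α₁, 0) and ζₙ⁻ ∈ (−β₁(α₁+n), −β₁(α₁+n−1)) for n ≥ 1. Define c₀⁻ = Π_{n≥1} (1 + ζ₀⁻/(β₁(n−1+α₁)))/(1 − ζ₀⁻/ζₙ⁻) and, for k ≥ 1, c_k⁻ = [(1 + ζ_k⁻/(β₁(k−1+α₁)))/(1 − ζ_k⁻/ζ₀⁻)] · Π_{n≥1, n≠k} (1 + ζ_k⁻/(β₁(n−1+α₁)))/(1 − ζ_k⁻/ζₙ⁻); these infinite products converge. Let e be an exponential random variable with rate q independent of X. Then for every Borel set A ⊆ (0,∞), ℙ( sup_{0≤s≤e} X_s ∈ A ) = ∫_A ( − Σ_{k≥0}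 c_k⁻ ζ_k⁻ e^{ζ_k⁻ x} ) dx. -/

import Mathlib

open MeasureTheory ProbabilityTheory Set

noncomputable section

/-- A real-valued Lévy process on a probability space `(Ω, ℱ, P)`. -/
structure IsLevyProcess {Ω : Type*} [MeasurableSpace Ω] (P : Measure Ω)
    (X : ℝ → Ω → ℝ) : Prop where
  measurable : ∀ t : ℝ, Measurable (X t)
  init : ∀ᵐ ω ∂P, X 0 ω = 0
  cadlag : ∀ᵐ ω ∂P, (∀ t : ℝ, 0 ≤ t →
      ContinuousWithinAt (fun s => X s ω) (Ici t) t) ∧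
      (∀ t : ℝ, 0 < t → ∃ l : ℝ,
        Filter.Tendsto (fun s => X s ω) (nhdsWithin t (Ico 0 t)) (nhds l))
  stationary : ∀ s t : ℝ, 0 ≤ s → 0 ≤ t →
      Measure.map (fun ω => X (t + s) ω - X t ω) P = Measure.map (X s) P
  indep_past : ∀ t : ℝ, 0 ≤ t →
      IndepFun (fun ω => (fun u : Icc (0 : ℝ) t => X u ω))
        (fun ω => (fun s : {s : ℝ // 0 ≤ s} => X (t + s) ω - X t ω)) P

/-- The Beta function `B(x,y) = Γ(x)Γ(y)/Γ(x+y)` built from the complex Gamma function. -/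
def cBeta (x y : ℂ) : ℂ := Complex.Gamma x * Complex.Gamma y / Complex.Gamma (x + y)

/-- The characteristic exponent of the β-class of Lévy processes. -/
def betaClassExponent (a σ c₁ c₂ α₁ α₂ β₁ β₂ lam₁ lam₂ : ℝ) (z : ℂ) : ℂ :=
  Complex.I * a * z + (σ : ℂ) ^ 2 * z ^ 2 / 2
    + (c₁ / β₁ : ℂ) * (cBeta α₁ (1 - lam₁)
        - cBeta ((α₁ : ℂ) - Complex.I * z / β₁) (1 - lam₁))
    + (c₂ / β₂ : ℂ) * (cBeta α₂ (1 - lam₂)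
        - cBeta ((α₂ : ℂ) + Complex.I * z / β₂) (1 - lam₂))

/-- A continuous function that is holomorphic off the imaginary axis is entire. -/
theorem differentiable_of_continuous_of_differentiableOn_halfPlanes {f : ℂ → ℂ}
    (hf : Continuous f) (hl : DifferentiableOn ℂ f {z | z.re < 0})
    (hr : DifferentiableOn ℂ f {z | 0 < z.re}) : Differentiable ℂ f := by
  have hside : ∀ x c d : ℝ, (∫ t : ℝ in x..0, f (t + c * Complex.I)) -
      (∫ t : ℝ in x..0, f (t + d * Complex.I)) +
      Complex.I • (∫ y : ℝ in c..d, f (((0 : ℝ) : ℂ) + y * Complex.I)) -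
      Complex.I • (∫ y : ℝ in c..d, f (x + y * Complex.I)) = 0 := by
    intro x c d
    have := Complex.integral_boundary_rect_eq_zero_of_continuousOn_of_differentiableOn f
      ⟨x, c⟩ ⟨0, d⟩ hf.continuousOn ?_
    · simpa using this
    · rcases le_total x 0 with hx | hx
      · refine hl.mono fun z hz => ?_
        have := hz.1
        simp only [hx, min_eq_left, max_eq_right, mem_preimage, mem_Ioo] at this
        exact this.2
      · refine hr.mono fun z hz => ?_
        have := hz.1
        simp only [hx, min_eq_right, max_eq_left, mem_preimage, mem_Ioo] at this
        exact this.1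
  have hcons : Complex.IsConservativeOn f univ := by
    intro z w _
    rw [← add_eq_zero_iff_eq_neg, Complex.wedgeIntegral_add_wedgeIntegral_eq]
    have h_int : ∀ (c a b : ℝ), IntervalIntegrable (fun t : ℝ => f (t + c * Complex.I)) volume
        a b :=
      fun c a b =>
        (by fun_prop : Continuous fun t : ℝ => f (t + c * Complex.I)).intervalIntegrable a b
    have e : ∀ c : ℝ, (∫ t : ℝ in z.re..w.re, f (t + c * Complex.I)) =
        (∫ t : ℝ in z.re..0, f (t + c * Complex.I)) -
          ∫ t : ℝ in w.re..0, f (t + c * Complex.I) := by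
      intro c
      rw [← intervalIntegral.integral_add_adjacent_intervals (h_int c z.re 0) (h_int c 0 w.re),
        intervalIntegral.integral_symm w.re 0]
      ring
    have h1 := hside z.re z.im w.im
    have h2 := hside w.re z.im w.im
    rw [e, e]
    linear_combination h1 - h2
  intro z
  have hE := Complex.IsConservativeOn.isExactOn_ball (c := z) (r := 1) hf.continuousOn
    (hcons.mono (subset_univ _))
  exact (hE.differentiableOn Metric.isOpen_ball).differentiableAt
    (Metric.isOpen_ball.mem_nhds (Metric.mem_ball_self one_pos))

/-- An entire function of polynomial growth that is bounded on the positive half-line is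
constant. -/
theorem eq_const_of_growth_of_bounded_on_pos (n : ℕ) : ∀ {f : ℂ → ℂ}, Differentiable ℂ f →
    ∀ C D : ℝ, (∀ z, ‖f z‖ ≤ C * (1 + ‖z‖) ^ n) → (∀ x : ℝ, 0 < x → ‖f x‖ ≤ D) →
    ∀ z, f z = f 0 := by
  induction n with
  | zero =>
    intro f hf C D hC _ z
    refine hf.apply_eq_apply_of_bounded ?_ z 0
    rw [isBounded_iff_forall_norm_le]
    exact ⟨C, by rintro _ ⟨z, rfl⟩; simpa using hC z⟩
  | succ n ih =>
    intro f hf C D hC hD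
    have hg : Differentiable ℂ (dslope f 0) := by
      have := (Complex.differentiableOn_dslope (c := (0 : ℂ)) (s := univ) (f := f)
        Filter.univ_mem).2
        hf.differentiableOn
      exact differentiableOn_univ.1 this
    have hform : ∀ z, f z = f 0 + z * dslope f 0 z := by
      intro z
      have := sub_smul_dslope f 0 z
      simp only [sub_zero, smul_eq_mul] at this
      rw [this]; ring
    obtain ⟨K, hK⟩ := (isCompact_closedBall (0 : ℂ) 1).exists_bound_of_continuousOn
      hg.continuous.continuousOn
    have hC0 : 0 ≤ C := by simpa using (norm_nonneg _).trans (hC 0)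
    have hK0 : 0 ≤ K := (norm_nonneg _).trans (hK 0 (by simp))
    have hdiv : ∀ z : ℂ, 1 ≤ ‖z‖ → ‖dslope f 0 z‖ ≤ 2 * (‖f z‖ + ‖f 0‖) / (1 + ‖z‖) := by
      intro z hz
      rw [le_div_iff₀ (by positivity)]
      have h1 : ‖z‖ * ‖dslope f 0 z‖ ≤ ‖f z‖ + ‖f 0‖ := by
        rw [← norm_mul]
        calc _ = ‖f z - f 0‖ := by rw [hform z]; ring_nf
          _ ≤ _ := norm_sub_le _ _
      nlinarith [norm_nonneg (dslope f 0 z)]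
    have hconst := ih hg (K + 4 * C) (K + D + ‖f 0‖) ?_ ?_
    · have hlin : ∀ z, f z = f 0 + z * dslope f 0 0 := fun z => by rw [← hconst z]; exact hform z
      have h0 : dslope f 0 0 = 0 := by
        by_contra hne
        have hpos : 0 < ‖dslope f 0 0‖ := norm_pos_iff.2 hne
        have hD0 : 0 ≤ D := (norm_nonneg _).trans (hD 1 one_pos)
        set x : ℝ := (D + ‖f 0‖ + 1) / ‖dslope f 0 0‖ with hx
        have hxpos : 0 < x := by positivity
        have h1 := hD x hxpos
        have h2 : ‖(x : ℂ) * dslope f 0 0‖ ≤ ‖f x‖ + ‖f 0‖ := by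
          calc _ = ‖f x - f 0‖ := by rw [hlin x]; ring_nf
            _ ≤ _ := norm_sub_le _ _
        rw [norm_mul, Complex.norm_real, Real.norm_of_nonneg hxpos.le, hx,
          div_mul_cancel₀ _ hpos.ne'] at h2
        linarith
      intro z
      rw [hlin z, h0]; simp
    · intro z
      have hone : 1 ≤ (1 + ‖z‖) ^ n := one_le_pow₀ (by linarith [norm_nonneg z])
      rcases le_total ‖z‖ 1 with hz | hz
      · calc _ ≤ K := hK z (by simpa using hz)
          _ ≤ K * (1 + ‖z‖) ^ n := le_mul_of_one_le_right hK0 hone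
          _ ≤ _ := by gcongr; linarith
      · refine (hdiv z hz).trans ?_
        rw [div_le_iff₀ (by positivity)]
        have h1 := hC z
        have h2 : ‖f 0‖ ≤ C := by simpa using hC 0
        have h3 : C ≤ C * (1 + ‖z‖) ^ (n + 1) :=
          le_mul_of_one_le_right hC0 (one_le_pow₀ (by linarith [norm_nonneg z]))
        calc 2 * (‖f z‖ + ‖f 0‖) ≤ 4 * C * (1 + ‖z‖) ^ (n + 1) := by linarith
          _ = 4 * C * (1 + ‖z‖) ^ n * (1 + ‖z‖) := by ring
          _ ≤ _ := by gcongr; linarith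
    · intro x hx
      have hD0 := (norm_nonneg _).trans (hD 1 one_pos)
      rcases le_total x 1 with hx1 | hx1
      · refine (hK x (by simpa [abs_of_pos hx] using hx1)).trans ?_
        linarith [norm_nonneg (f 0)]
      · have hn : ‖(x : ℂ)‖ = x := by simp [abs_of_pos hx]
        refine (hdiv x (by rw [hn]; exact hx1)).trans ?_
        rw [hn, div_le_iff₀ (by positivity)]
        have := hD x hx
        nlinarith [norm_nonneg (f 0), norm_nonneg (f x)]

/-- Phragmén–Lindelöf type statement: a polynomial bound with a pole of finite order along the real
axis implies a polynomial bound. -/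
theorem growth_of_growth_div_im {f : ℂ → ℂ} (hf : Differentiable ℂ f) (C : ℝ) (n L : ℕ)
    (hC : ∀ z, ‖f z‖ * |z.im| ^ L ≤ C * (1 + ‖z‖) ^ n) :
    ∃ C' : ℝ, ∀ z, ‖f z‖ ≤ C' * (1 + ‖z‖) ^ n := by
  have hC0 : 0 ≤ C := by
    have := (mul_nonneg (norm_nonneg (f 0)) (by positivity)).trans (hC 0); simpa using this
  refine ⟨C * 3 ^ n * 2 ^ L, fun z => ?_⟩
  -- the circle of radius `R = 2 (1 + ‖z‖)`
  set R : ℝ := 2 * (1 + ‖z‖) with hR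
  have hRpos : 0 < R := by positivity
  have hR2 : 2 ≤ R := by rw [hR]; linarith [norm_nonneg z]
  have hmax : ‖f z * (z ^ 2 - (R : ℂ) ^ 2) ^ L‖ ≤ C * (1 + R) ^ n * (2 * R) ^ L := by
    refine Complex.norm_le_of_forall_mem_frontier_norm_le (U := Metric.ball 0 R)
      (f := fun z => f z * (z ^ 2 - (R : ℂ) ^ 2) ^ L) Metric.isBounded_ball ?_ ?_ ?_
    · exact (by fun_prop : Differentiable ℂ _).diffContOnCl
    · intro w hw
      rw [frontier_ball _ hRpos.ne'] at hw
      have hw' : ‖w‖ = R := by simpa using hw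
      have hnorm : ‖w ^ 2 - (R : ℂ) ^ 2‖ = 2 * R * |w.im| := by
        have hsq : w.re ^ 2 + w.im ^ 2 = R ^ 2 := by
          rw [← hw', ← Complex.normSq_eq_norm_sq, Complex.normSq_apply]; ring
        have h1 : (w ^ 2 - (R : ℂ) ^ 2).re = w.re ^ 2 - w.im ^ 2 - R ^ 2 := by
          rw [← Complex.ofReal_pow]; simp [pow_two]
        have h2 : (w ^ 2 - (R : ℂ) ^ 2).im = 2 * w.re * w.im := by
          rw [← Complex.ofReal_pow]; simp [pow_two]; ring
        have h3 : ‖w ^ 2 - (R : ℂ) ^ 2‖ ^ 2 = (2 * R * |w.im|) ^ 2 := by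
          have h4 : (2 * R * |w.im|) ^ 2 = 4 * R ^ 2 * w.im ^ 2 := by
            rw [← sq_abs w.im]; ring
          rw [← Complex.normSq_eq_norm_sq, Complex.normSq_apply, h1, h2, h4, ← hsq]
          ring
        exact (pow_left_inj₀ (norm_nonneg _) (by positivity) two_ne_zero).1 h3
      calc ‖f w * (w ^ 2 - (R : ℂ) ^ 2) ^ L‖ = (‖f w‖ * |w.im| ^ L) * (2 * R) ^ L := by
            rw [norm_mul, norm_pow, hnorm, mul_pow]; ring
        _ ≤ C * (1 + ‖w‖) ^ n * (2 * R) ^ L :=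
            mul_le_mul_of_nonneg_right (hC w) (by positivity)
        _ = _ := by rw [hw']
    · apply subset_closure
      simp only [Metric.mem_ball, dist_zero_right, hR]; linarith [norm_nonneg z]
  have hlow : R ^ 2 / 2 ≤ ‖z ^ 2 - (R : ℂ) ^ 2‖ := by
    have h1 : ‖(R : ℂ) ^ 2‖ - ‖z ^ 2‖ ≤ ‖z ^ 2 - (R : ℂ) ^ 2‖ := by
      rw [norm_sub_rev]; exact norm_sub_norm_le _ _
    rw [norm_pow, norm_pow, Complex.norm_real, Real.norm_of_nonneg hRpos.le] at h1
    have : ‖z‖ ≤ R / 2 := by rw [hR]; linarith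
    nlinarith [norm_nonneg z]
  rw [norm_mul, norm_pow] at hmax
  have h3 : ‖f z‖ * (R ^ 2 / 2) ^ L ≤ C * (1 + R) ^ n * (2 * R) ^ L :=
    le_trans (by gcongr) hmax
  have h4 : (2 * R) ^ L * R ^ L  = (R ^ 2 / 2) ^ L * 4 ^ L := by
    rw [← mul_pow, ← mul_pow]; ring
  have h5 : ‖f z‖ * R ^ L ≤ C * (1 + R) ^ n * 4 ^ L := by
    have hp : 0 < (R ^ 2 / 2) ^ L := by positivity
    refine le_of_mul_le_mul_right ?_ hp
    calc ‖f z‖ * R ^ L * (R ^ 2 / 2) ^ L = ‖f z‖ * (R ^ 2 / 2) ^ L * R ^ L := by ring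
      _ ≤ C * (1 + R) ^ n * (2 * R) ^ L * R ^ L := by gcongr
      _ = _ := by rw [mul_assoc, h4]; ring
  have h6 : ‖f z‖ * 2 ^ L ≤ C * (1 + R) ^ n * 4 ^ L := le_trans (by gcongr) h5
  have h7 : ‖f z‖ ≤ C * (1 + R) ^ n * 2 ^ L := by
    have : (4 : ℝ) ^ L = 2 ^ L * 2 ^ L := by rw [← mul_pow]; norm_num
    rw [this, ← mul_assoc] at h6
    exact le_of_mul_le_mul_right h6 (by positivity)
  calc ‖f z‖ ≤ C * (1 + R) ^ n * 2 ^ L := h7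
    _ ≤ C * (3 * (1 + ‖z‖)) ^ n * 2 ^ L := by
      gcongr; rw [hR]; linarith [norm_nonneg z]
    _ = _ := by rw [mul_pow]; ring

/-- The removable singularity theorem along a set of isolated points. -/
theorem exists_differentiableOn_of_bounded_near {U S : Set ℂ} (hU : IsOpen U) {f : ℂ → ℂ}
    (hS : ∀ z ∈ U, ∀ᶠ w in nhdsWithin z {z}ᶜ, w ∉ S)
    (hf : ∀ z ∈ U, z ∉ S → DifferentiableAt ℂ f z)
    (hb : ∀ z ∈ U, z ∈ S → ∃ C : ℝ, ∀ᶠ w in nhdsWithin z {z}ᶜ, ‖f w‖ ≤ C) :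
    ∃ g : ℂ → ℂ, DifferentiableOn ℂ g U ∧ ∀ z, z ∉ S → g z = f z := by
  classical
  refine ⟨fun z => if z ∈ S then Filter.limUnder (nhdsWithin z {z}ᶜ) f else f z, ?_,
    fun z hz => if_neg hz⟩
  set g : ℂ → ℂ := fun z => if z ∈ S then Filter.limUnder (nhdsWithin z {z}ᶜ) f else f z with hg
  intro z hz
  apply DifferentiableAt.differentiableWithinAt
  have h1 : ∀ᶠ w in nhdsWithin z {z}ᶜ, w ∉ S ∧ w ∈ U :=
    (hS z hz).and (mem_nhdsWithin_of_mem_nhds (hU.mem_nhds hz))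
  by_cases hzS : z ∈ S
  · obtain ⟨C, hC⟩ := hb z hz hzS
    have h2 := h1.and hC
    rw [eventually_nhdsWithin_iff, Metric.eventually_nhds_iff_ball] at h2
    obtain ⟨r, hr, hball⟩ := h2
    have hd : DifferentiableOn ℂ f (Metric.ball z r \ {z}) := fun w hw =>
      (hf w (hball w hw.1 hw.2).1.2 (hball w hw.1 hw.2).1.1).differentiableWithinAt
    have hbd : BddAbove (norm ∘ f '' (Metric.ball z r \ {z})) := by
      refine ⟨C, ?_⟩
      rintro _ ⟨w, hw, rfl⟩
      exact (hball w hw.1 hw.2).2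
    have := Complex.differentiableOn_update_limUnder_of_bddAbove
      (Metric.ball_mem_nhds z hr) hd hbd
    refine (this.congr fun w hw => ?_).differentiableAt (Metric.ball_mem_nhds z hr)
    by_cases hwz : w = z
    · subst hwz; simp [hg, hzS]
    · simp [hg, hwz, (hball w hw hwz).1.1]
  · have h2 : ∀ᶠ w in nhds z, g w = f w := by
      rw [eventually_nhdsWithin_iff] at h1
      filter_upwards [h1] with w hw
      by_cases hwz : w = z
      · subst hwz; exact if_neg hzS
      · exact if_neg (hw hwz).1
    exact (hf z hz hzS).congr_of_eventuallyEq h2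

theorem differentiableAt_cBeta {x s : ℂ} (hx : ∀ m : ℕ, x ≠ -m) :
    DifferentiableAt ℂ (fun x => cBeta x s) x := by
  unfold cBeta
  simp only [div_eq_mul_inv]
  have h1 : DifferentiableAt ℂ (fun x => (Complex.Gamma (x + s))⁻¹) x :=
    (Complex.differentiable_one_div_Gamma.comp (by fun_prop : Differentiable ℂ fun x => x + s)) x
  exact ((Complex.differentiableAt_Gamma x hx).mul_const _).mul h1

theorem cBeta_eq_succ_left {x s : ℂ} (hx : x ≠ 0) (hxs : x + s ≠ 0) :
    cBeta x s = cBeta (x + 1) s * (x + s) / x := by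
  unfold cBeta
  rw [add_right_comm, Complex.Gamma_add_one x hx, Complex.Gamma_add_one _ hxs]
  by_cases hG : Complex.Gamma (x + s) = 0
  · simp [hG]
  · field_simp

theorem cBeta_eq_succ_right {x s : ℂ} (hs : s ≠ 0) (hxs : x + s ≠ 0) :
    cBeta x s = cBeta x (s + 1) * (x + s) / s := by
  unfold cBeta
  rw [← add_assoc, Complex.Gamma_add_one s hs, Complex.Gamma_add_one _ hxs]
  by_cases hG : Complex.Gamma (x + s) = 0
  · simp [hG]
  · field_simp

/-- The reflection formula for the Beta function. -/
theorem cBeta_eq_reflect {x s : ℂ} (hx : Complex.sin (Real.pi * x) ≠ 0)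
    (hxs : Complex.sin (Real.pi * (x + s)) ≠ 0) :
    cBeta x s = Complex.sin (Real.pi * (x + s)) / Complex.sin (Real.pi * x) *
      cBeta (1 - x - s) s := by
  have hpi : (Real.pi : ℂ) ≠ 0 := by exact_mod_cast Real.pi_ne_zero
  have h1 := Complex.Gamma_mul_Gamma_one_sub x
  have h2 := Complex.Gamma_mul_Gamma_one_sub (x + s)
  have e : 1 - x - s = 1 - (x + s) := by ring
  have e' : 1 - (x + s) + s = 1 - x := by ring
  unfold cBeta
  rw [e, e']
  have n1 : Complex.Gamma (1 - x) ≠ 0 := by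
    intro h; rw [h, mul_zero] at h1
    exact div_ne_zero hpi hx h1.symm
  have n2 : Complex.Gamma (x + s) ≠ 0 := by
    intro h; rw [h, zero_mul] at h2
    exact div_ne_zero hpi hxs h2.symm
  rw [eq_div_iff hx] at h1
  rw [eq_div_iff hxs] at h2
  rw [div_mul_div_comm, div_eq_div_iff n2 (mul_ne_zero hx n1)]
  linear_combination (Complex.Gamma s) * h1 - (Complex.Gamma s) * h2

theorem norm_cBeta_le_of_pos {δ s : ℝ} (hδ : 0 < δ) (hs : 0 < s) :
    ∃ C : ℝ, ∀ x : ℂ, δ ≤ x.re → ‖cBeta x s‖ ≤ C := by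
  refine ⟨∫ t in (0 : ℝ)..1, ‖(t : ℂ) ^ ((δ : ℂ) - 1) * (1 - (t : ℂ)) ^ ((s : ℂ) - 1)‖,
    fun x hx => ?_⟩
  have hx0 : 0 < x.re := hδ.trans_le hx
  have h1 : cBeta x s = Complex.betaIntegral x s := by
    unfold cBeta
    rw [Complex.Gamma_mul_Gamma_eq_betaIntegral hx0 (by simpa using hs)]
    rw [mul_div_cancel_left₀]
    exact Complex.Gamma_ne_zero_of_re_pos (by simp; linarith)
  rw [h1, Complex.betaIntegral]
  refine intervalIntegral.norm_integral_le_of_norm_le zero_le_one ?_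
    (Complex.betaIntegral_convergent (u := δ) (v := s) (by simpa) (by simpa)).norm
  filter_upwards with t ht
  rw [norm_mul, norm_mul, Complex.norm_cpow_eq_rpow_re_of_pos ht.1,
    Complex.norm_cpow_eq_rpow_re_of_pos ht.1]
  gcongr ?_ * _
  refine Real.rpow_le_rpow_of_exponent_ge ht.1 ht.2 ?_
  simpa using hx

theorem norm_cBeta_le {δ s : ℝ} (hδ : 0 < δ) (hs : -2 < s) (hs0 : s ≠ 0) (hs1 : s ≠ -1) :
    ∃ C : ℝ, 0 ≤ C ∧ ∀ x : ℂ, δ ≤ x.re → ‖cBeta x s‖ ≤ C * (1 + ‖x‖) ^ 2 := by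
  have key : ∀ (s : ℝ) (n : ℕ), s ≠ 0 →
      (∃ C : ℝ, 0 ≤ C ∧ ∀ x : ℂ, δ ≤ x.re → ‖cBeta x (s + 1 : ℝ)‖ ≤ C * (1 + ‖x‖) ^ n) →
      ∃ C : ℝ, 0 ≤ C ∧ ∀ x : ℂ, δ ≤ x.re → ‖cBeta x s‖ ≤ C * (1 + ‖x‖) ^ (n + 1) := by
    rintro s n hs ⟨C, hC0, hC⟩
    refine ⟨C * ((1 + |s|) / |s|), by positivity, fun x hx => ?_⟩
    have habs : 0 < |s| := abs_pos.2 hs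
    by_cases hxs : x + (s : ℂ) = 0
    · have : cBeta x s = 0 := by simp [cBeta, hxs]
      rw [this, norm_zero]; positivity
    · have h1 := hC x hx
      rw [cBeta_eq_succ_right (by exact_mod_cast hs) hxs, norm_div, norm_mul, Complex.norm_real,
        Real.norm_eq_abs]
      push_cast at h1
      have h2 : ‖x + (s : ℂ)‖ ≤ (1 + |s|) * (1 + ‖x‖) := by
        refine (norm_add_le _ _).trans ?_
        rw [Complex.norm_real, Real.norm_eq_abs]
        nlinarith [norm_nonneg x]
      calc _ ≤ C * (1 + ‖x‖) ^ n * ((1 + |s|) * (1 + ‖x‖)) / |s| := by gcongr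
        _ = _ := by ring
  have base : ∀ s : ℝ, 0 < s →
      ∃ C : ℝ, 0 ≤ C ∧ ∀ x : ℂ, δ ≤ x.re → ‖cBeta x s‖ ≤ C * (1 + ‖x‖) ^ 0 := by
    intro s hs
    obtain ⟨C, hC⟩ := norm_cBeta_le_of_pos hδ hs
    exact ⟨|C|, abs_nonneg _, fun x hx => by simpa using (hC x hx).trans (le_abs_self C)⟩
  have lift : ∀ (s : ℝ) (n : ℕ), n ≤ 2 →
      (∃ C : ℝ, 0 ≤ C ∧ ∀ x : ℂ, δ ≤ x.re → ‖cBeta x s‖ ≤ C * (1 + ‖x‖) ^ n) →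
      ∃ C : ℝ, 0 ≤ C ∧ ∀ x : ℂ, δ ≤ x.re → ‖cBeta x s‖ ≤ C * (1 + ‖x‖) ^ 2 := by
    rintro s n hn ⟨C, hC0, hC⟩
    refine ⟨C, hC0, fun x hx => (hC x hx).trans ?_⟩
    gcongr
    linarith [norm_nonneg x]
  rcases lt_trichotomy s 0 with h | h | h
  · rcases lt_trichotomy s (-1) with h' | h' | h'
    · exact key s 1 hs0 (key (s + 1) 0 (by intro h; apply hs1; linarith) (base _ (by linarith)))
    · exact absurd h' hs1
    · exact lift s 1 (by norm_num) (key s 0 hs0 (base _ (by linarith)))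
  · exact absurd h hs0
  · exact lift s 0 (by norm_num) (base s h)

theorem abs_im_le_norm_sin (w : ℂ) : |w.im| ≤ ‖Complex.sin w‖ := by
  have h1 : |Real.sinh w.im| ≤ ‖Complex.sin w‖ := by
    have h2 : |‖Complex.exp (-w * Complex.I)‖ - ‖Complex.exp (w * Complex.I)‖| ≤
        ‖Complex.exp (-w * Complex.I) - Complex.exp (w * Complex.I)‖ := abs_norm_sub_norm_le _ _
    rw [Complex.norm_exp, Complex.norm_exp] at h2
    rw [Complex.sin, norm_div, norm_mul, Complex.norm_I, mul_one, Real.sinh_eq, abs_div]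
    simp only [neg_mul, Complex.neg_re, Complex.mul_re, Complex.I_re, mul_zero, Complex.I_im,
      mul_one, zero_sub, neg_neg] at h2
    simp only [neg_mul, Nat.abs_ofNat, Complex.norm_ofNat]
    linarith
  refine le_trans ?_ h1
  rw [Real.abs_sinh]
  exact Real.self_le_sinh_iff.2 (abs_nonneg _)

theorem norm_cos_le_norm_sin_add_one (w : ℂ) : ‖Complex.cos w‖ ≤ ‖Complex.sin w‖ + 1 := by
  rcases le_total 0 w.im with h | h
  · have e : Complex.cos w = Complex.exp (w * Complex.I) - Complex.sin w * Complex.I := by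
      rw [Complex.exp_mul_I]; ring
    have h1 : ‖Complex.exp (w * Complex.I)‖ ≤ 1 := by
      rw [Complex.norm_exp, Real.exp_le_one_iff]; simpa using h
    rw [e]
    refine (norm_sub_le _ _).trans ?_
    rw [norm_mul, Complex.norm_I]; linarith
  · have e : Complex.cos w = Complex.exp (-w * Complex.I) + Complex.sin w * Complex.I := by
      rw [Complex.exp_mul_I, Complex.cos_neg, Complex.sin_neg]; ring
    have h1 : ‖Complex.exp (-w * Complex.I)‖ ≤ 1 := by
      rw [Complex.norm_exp, Real.exp_le_one_iff]; simpa using h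
    rw [e]
    refine (norm_add_le _ _).trans ?_
    rw [norm_mul, Complex.norm_I]; linarith

theorem norm_cBeta_mul_abs_im_le {s : ℝ} (hs : -2 < s) (hs' : s < 1) (hs0 : s ≠ 0)
    (hs1 : s ≠ -1) :
    ∃ C : ℝ, 0 ≤ C ∧ ∀ x : ℂ, ‖cBeta x s‖ * |x.im| ≤ C * (1 + ‖x‖) ^ 3 := by
  obtain ⟨C, hC0, hC⟩ := norm_cBeta_le (δ := (1 - s) / 2) (by linarith) hs hs0 hs1
  refine ⟨C * 32 * 3, by positivity, fun x => ?_⟩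
  have him : |x.im| ≤ ‖x‖ := Complex.abs_im_le_norm x
  have hn := norm_nonneg x
  rcases le_total ((1 - s) / 2) x.re with hx | hx
  · calc _ ≤ C * (1 + ‖x‖) ^ 2 * (1 + ‖x‖) := by
          gcongr
          · exact hC x hx
          · linarith
      _ = C * (1 + ‖x‖) ^ 3 := by ring
      _ ≤ _ := by
        gcongr; linarith
  · by_cases hy : x.im = 0
    · rw [hy]; simp; positivity
    have hypos : 0 < |x.im| := abs_pos.2 hy
    have him1 : ((Real.pi : ℂ) * x).im = Real.pi * x.im := by simp
    have him2 : ((Real.pi : ℂ) * (x + s)).im = Real.pi * x.im := by simp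
    have hpy : |x.im| ≤ |Real.pi * x.im| := by
      rw [abs_mul, abs_of_pos Real.pi_pos]
      nlinarith [Real.pi_gt_three]
    have l1 : |x.im| ≤ ‖Complex.sin (Real.pi * x)‖ :=
      hpy.trans (him1 ▸ abs_im_le_norm_sin (Real.pi * x))
    have l2 : |x.im| ≤ ‖Complex.sin (Real.pi * (x + s))‖ :=
      hpy.trans (him2 ▸ abs_im_le_norm_sin (Real.pi * (x + s)))
    have n1 : Complex.sin (Real.pi * x) ≠ 0 := norm_pos_iff.1 (hypos.trans_le l1)
    have n2 : Complex.sin (Real.pi * (x + s)) ≠ 0 := norm_pos_iff.1 (hypos.trans_le l2)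
    have hsin : ‖Complex.sin (Real.pi * (x + s))‖ ≤ 2 * ‖Complex.sin (Real.pi * x)‖ + 1 := by
      rw [mul_add, Complex.sin_add, ← Complex.ofReal_mul, ← Complex.ofReal_sin,
        ← Complex.ofReal_cos]
      refine (norm_add_le _ _).trans ?_
      rw [norm_mul, norm_mul, Complex.norm_real, Complex.norm_real]
      have a1 : ‖Real.cos (Real.pi * s)‖ ≤ 1 := Real.abs_cos_le_one _
      have a2 : ‖Real.sin (Real.pi * s)‖ ≤ 1 := Real.abs_sin_le_one _
      have a3 := norm_cos_le_norm_sin_add_one (Real.pi * x)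
      have b1 := mul_le_mul_of_nonneg_left a1 (norm_nonneg (Complex.sin (Real.pi * x)))
      have b2 := mul_le_mul_of_nonneg_left a2 (norm_nonneg (Complex.cos (Real.pi * x)))
      linarith
    have hratio : ‖Complex.sin (Real.pi * (x + s)) / Complex.sin (Real.pi * x)‖ * |x.im| ≤
        3 * (1 + ‖x‖) := by
      rw [norm_div, div_mul_eq_mul_div, div_le_iff₀ (norm_pos_iff.2 n1)]
      set S := ‖Complex.sin (Real.pi * x)‖
      have := mul_le_mul_of_nonneg_right hsin hypos.le
      nlinarith [norm_nonneg (Complex.sin (Real.pi * x)), mul_nonneg hypos.le (norm_nonneg x)]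
    have hB := hC (1 - x - s) (by simp; linarith)
    have hlen : 1 + ‖1 - x - (s : ℂ)‖ ≤ 4 * (1 + ‖x‖) := by
      have h1 : ‖1 - x - (s : ℂ)‖ ≤ ‖(1 : ℂ) - s‖ + ‖x‖ := by
        rw [show 1 - x - (s : ℂ) = (1 - s) - x by ring]; exact norm_sub_le _ _
      have h2 : ‖(1 : ℂ) - s‖ ≤ 3 := by
        rw [← Complex.ofReal_one, ← Complex.ofReal_sub, Complex.norm_real, Real.norm_eq_abs,
          abs_le]
        constructor <;> linarith
      linarith
    rw [cBeta_eq_reflect n1 n2, norm_mul]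
    calc _ = (‖Complex.sin (Real.pi * (x + s)) / Complex.sin (Real.pi * x)‖ * |x.im|) *
          ‖cBeta (1 - x - s) s‖ := by ring
      _ ≤ (3 * (1 + ‖x‖)) * (C * (1 + ‖1 - x - (s : ℂ)‖) ^ 2) := by gcongr
      _ ≤ (3 * (1 + ‖x‖)) * (C * (4 * (1 + ‖x‖)) ^ 2) := by gcongr
      _ ≤ _ := by
        have : (3 * (1 + ‖x‖)) * (C * (4 * (1 + ‖x‖)) ^ 2) = C * 16 * 3 * (1 + ‖x‖) ^ 3 := by ring
        rw [this]
        gcongr; norm_num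

/-- The residue of the Beta function at `-m` is positive. -/
theorem exists_tendsto_add_mul_cBeta {s : ℝ} (hs' : s < 1) (hsn : ∀ m : ℕ, s ≠ -m) (m : ℕ) :
    ∃ r : ℝ, 0 < r ∧ Filter.Tendsto (fun x : ℂ => (x + m) * cBeta x s)
      (nhdsWithin (-(m : ℂ)) {-(m : ℂ)}ᶜ) (nhds (r : ℂ)) := by
  have hs0 : s ≠ 0 := by simpa using hsn 0
  induction m with
  | zero =>
    refine ⟨1, one_pos, ?_⟩
    have hcont : ContinuousAt (fun x : ℂ => cBeta (x + 1) s * (x + s)) 0 := by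
      refine ContinuousAt.mul ?_ (by fun_prop)
      have h1 : DifferentiableAt ℂ (fun x => cBeta x s) ((0 : ℂ) + 1) :=
        differentiableAt_cBeta fun m h => by
          have := congrArg Complex.re h
          simp at this; linarith [(Nat.cast_nonneg m : (0 : ℝ) ≤ m)]
      exact ContinuousAt.comp (f := fun x : ℂ => x + 1) (g := fun x => cBeta x s)
        h1.continuousAt (by fun_prop)
    have hv : cBeta (0 + 1) s * (0 + s) = ((1 : ℝ) : ℂ) := by
      have hs0' : (s : ℂ) ≠ 0 := by exact_mod_cast hs0
      have hG : Complex.Gamma s ≠ 0 := Complex.Gamma_ne_zero fun m h => hsn m (by exact_mod_cast h)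
      simp only [cBeta, zero_add, Complex.Gamma_one, add_comm (1 : ℂ),
        Complex.Gamma_add_one _ hs0', Complex.ofReal_one]
      field_simp
    have hlim := hcont.tendsto.mono_left (nhdsWithin_le_nhds (s := {(0 : ℂ)}ᶜ))
    rw [hv] at hlim
    simp only [CharP.cast_eq_zero, neg_zero, add_zero]
    refine hlim.congr' ?_
    have hne : ∀ᶠ x : ℂ in nhdsWithin 0 {0}ᶜ, x + s ≠ 0 := by
      refine mem_nhdsWithin_of_mem_nhds ?_
      have : ContinuousAt (fun x : ℂ => x + s) 0 := by fun_prop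
      exact this.eventually_ne (by simpa using hs0)
    filter_upwards [hne, self_mem_nhdsWithin] with x hx hx0
    rw [cBeta_eq_succ_left hx0 hx]
    have : x ≠ 0 := hx0
    field_simp
  | succ m ih =>
    obtain ⟨r, hr, hlim⟩ := ih
    refine ⟨r * ((m + 1 - s) / (m + 1)), by
      have : (0 : ℝ) ≤ m := Nat.cast_nonneg m
      have : 0 < m + 1 - s := by linarith
      positivity, ?_⟩
    have hshift : Filter.Tendsto (fun x : ℂ => x + 1)
        (nhdsWithin (-((m + 1 : ℕ) : ℂ)) {-((m + 1 : ℕ) : ℂ)}ᶜ)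
        (nhdsWithin (-(m : ℂ)) {-(m : ℂ)}ᶜ) := by
      refine tendsto_nhdsWithin_iff.2 ⟨?_, ?_⟩
      · have : Filter.Tendsto (fun x : ℂ => x + 1) (nhds (-((m + 1 : ℕ) : ℂ)))
            (nhds (-((m + 1 : ℕ) : ℂ) + 1)) := by
          exact (by fun_prop : Continuous fun x : ℂ => x + 1).tendsto _
        rw [show -((m + 1 : ℕ) : ℂ) + 1 = -(m : ℂ) by push_cast; ring] at this
        exact this.mono_left nhdsWithin_le_nhds
      · filter_upwards [self_mem_nhdsWithin] with x hx
        simp only [mem_compl_iff, mem_singleton_iff] at hx ⊢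
        intro h; apply hx
        push_cast
        linear_combination h
    have hm1 : (-((m + 1 : ℕ) : ℂ)) ≠ 0 := by
      rw [neg_ne_zero]; exact_mod_cast Nat.succ_ne_zero m
    have hfac : Filter.Tendsto (fun x : ℂ => (x + s) / x)
        (nhdsWithin (-((m + 1 : ℕ) : ℂ)) {-((m + 1 : ℕ) : ℂ)}ᶜ)
        (nhds ((-((m + 1 : ℕ) : ℂ) + s) / (-((m + 1 : ℕ) : ℂ)))) := by
      have : ContinuousAt (fun x : ℂ => (x + s) / x) (-((m + 1 : ℕ) : ℂ)) :=
        ContinuousAt.div (by fun_prop) (by fun_prop) hm1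
      exact this.tendsto.mono_left nhdsWithin_le_nhds
    have hprod := (hlim.comp hshift).mul hfac
    have hval : (r : ℂ) * ((-((m + 1 : ℕ) : ℂ) + s) / (-((m + 1 : ℕ) : ℂ))) =
        ((r * ((m + 1 - s) / (m + 1)) : ℝ) : ℂ) := by
      push_cast
      rw [← neg_div_neg_eq]
      ring_nf
    rw [hval] at hprod
    refine hprod.congr' ?_
    have hne : ∀ᶠ x : ℂ in nhdsWithin (-((m + 1 : ℕ) : ℂ)) {-((m + 1 : ℕ) : ℂ)}ᶜ, x + s ≠ 0 := by
      refine mem_nhdsWithin_of_mem_nhds ?_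
      have : ContinuousAt (fun x : ℂ => x + s) (-((m + 1 : ℕ) : ℂ)) := by fun_prop
      refine this.eventually_ne ?_
      intro h
      have h' := congrArg Complex.re h
      simp at h'
      have : (0 : ℝ) ≤ m := Nat.cast_nonneg m
      linarith
    have hne0 : ∀ᶠ x : ℂ in nhdsWithin (-((m + 1 : ℕ) : ℂ)) {-((m + 1 : ℕ) : ℂ)}ᶜ, x ≠ 0 :=
      mem_nhdsWithin_of_mem_nhds (continuousAt_id.eventually_ne hm1)
    filter_upwards [hne, hne0] with x hx hx0
    rw [cBeta_eq_succ_left hx0 hx]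
    simp only [Function.comp]
    push_cast
    ring

section KilledExponent

variable (q a σ c₁ c₂ α₁ α₂ β₁ β₂ lam₁ lam₂ : ℝ)

/-- The function `z ↦ q + Ψ(iz)`. -/
def killedExponent (z : ℂ) : ℂ :=
  q + betaClassExponent a σ c₁ c₂ α₁ α₂ β₁ β₂ lam₁ lam₂ (Complex.I * z)

/-- The part of `q + Ψ(iz)` that is holomorphic on the left half-plane. -/
def killedExponentRegular (z : ℂ) : ℂ :=
  q - a * z - (σ : ℂ) ^ 2 * z ^ 2 / 2 + (c₁ / β₁ : ℂ) * cBeta α₁ (1 - lam₁ : ℝ)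
    + (c₂ / β₂ : ℂ) * (cBeta α₂ (1 - lam₂ : ℝ) - cBeta ((α₂ : ℂ) - z / β₂) (1 - lam₂ : ℝ))

theorem killedExponent_eq (z : ℂ) :
    killedExponent q a σ c₁ c₂ α₁ α₂ β₁ β₂ lam₁ lam₂ z =
      killedExponentRegular q a σ c₁ c₂ α₁ α₂ β₁ β₂ lam₁ lam₂ z
        - (c₁ / β₁ : ℂ) * cBeta ((α₁ : ℂ) + z / β₁) (1 - lam₁ : ℝ) := by
  unfold killedExponent killedExponentRegular betaClassExponent
  have h1 : (α₁ : ℂ) - Complex.I * (Complex.I * z) / β₁ = α₁ + z / β₁ := by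
    rw [← mul_assoc, Complex.I_mul_I]; ring
  have h2 : (α₂ : ℂ) + Complex.I * (Complex.I * z) / β₂ = α₂ - z / β₂ := by
    rw [← mul_assoc, Complex.I_mul_I]; ring
  have h3 : Complex.I * a * (Complex.I * z) = - (a * z) := by
    linear_combination (a * z) * Complex.I_mul_I
  have h4 : (Complex.I * z) ^ 2 = - z ^ 2 := by rw [mul_pow, Complex.I_sq]; ring
  rw [h1, h2, h3, h4]
  push_cast
  ring

variable {q a σ c₁ c₂ α₁ α₂ β₁ β₂ lam₁ lam₂}

theorem differentiableAt_killedExponentRegular (hβ₂ : 0 < β₂) {z : ℂ} (hz : z.re < β₂ * α₂) :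
    DifferentiableAt ℂ (killedExponentRegular q a σ c₁ c₂ α₁ α₂ β₁ β₂ lam₁ lam₂) z := by
  have hre : 0 < ((α₂ : ℂ) - z / β₂).re := by
    rw [Complex.sub_re, Complex.div_ofReal_re, Complex.ofReal_re, sub_pos, div_lt_iff₀ hβ₂]
    linarith
  have h1 : DifferentiableAt ℂ (fun x => cBeta x (1 - lam₂ : ℝ)) ((α₂ : ℂ) - z / β₂) :=
    differentiableAt_cBeta fun m h => by
      have h' := congrArg Complex.re h
      rw [Complex.neg_re, Complex.natCast_re] at h'
      linarith [(Nat.cast_nonneg m : (0 : ℝ) ≤ m)]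
  have h2 : DifferentiableAt ℂ (fun z : ℂ => cBeta ((α₂ : ℂ) - z / β₂) (1 - lam₂ : ℝ)) z :=
    DifferentiableAt.comp z (g := fun x => cBeta x (1 - lam₂ : ℝ))
      (f := fun z : ℂ => (α₂ : ℂ) - z / β₂) h1 (by fun_prop)
  unfold killedExponentRegular
  fun_prop

theorem differentiableAt_killedExponent (hβ₁ : 0 < β₁) (hβ₂ : 0 < β₂) {z : ℂ}
    (hz : z.re < β₂ * α₂) (hz' : ∀ m : ℕ, z ≠ ((-(β₁ * (m + α₁)) : ℝ) : ℂ)) :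
    DifferentiableAt ℂ (killedExponent q a σ c₁ c₂ α₁ α₂ β₁ β₂ lam₁ lam₂) z := by
  have hβ : (β₁ : ℂ) ≠ 0 := by exact_mod_cast hβ₁.ne'
  have h1 : DifferentiableAt ℂ (fun x => cBeta x (1 - lam₁ : ℝ)) ((α₁ : ℂ) + z / β₁) :=
    differentiableAt_cBeta fun m h => hz' m (by
      field_simp at h
      push_cast
      linear_combination h)
  have h2 : DifferentiableAt ℂ (fun z : ℂ => cBeta ((α₁ : ℂ) + z / β₁) (1 - lam₁ : ℝ)) z :=
    DifferentiableAt.comp z (g := fun x => cBeta x (1 - lam₁ : ℝ))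
      (f := fun z : ℂ => (α₁ : ℂ) + z / β₁) h1 (by fun_prop)
  have h3 := differentiableAt_killedExponentRegular (q := q) (a := a) (σ := σ) (c₁ := c₁)
    (c₂ := c₂) (α₁ := α₁) (β₁ := β₁) (lam₁ := lam₁) (lam₂ := lam₂) hβ₂ hz
  rw [funext (killedExponent_eq q a σ c₁ c₂ α₁ α₂ β₁ β₂ lam₁ lam₂)]
  exact h3.sub (h2.const_mul _)

/-- The poles of `q + Ψ(iz)` on the negative half-line are simple with negative residue. -/
theorem exists_tendsto_mul_killedExponent (hc₁ : 0 < c₁) (hα₁ : 0 < α₁) (hα₂ : 0 < α₂)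
    (hβ₁ : 0 < β₁) (hβ₂ : 0 < β₂)
    (hlam₁ : lam₁ ∈ Ioo (0 : ℝ) 3 ∧ lam₁ ≠ 1 ∧ lam₁ ≠ 2) (m : ℕ) :
    ∃ r : ℝ, r < 0 ∧ Filter.Tendsto
      (fun z : ℂ => (z - ((-(β₁ * (m + α₁)) : ℝ) : ℂ)) *
        killedExponent q a σ c₁ c₂ α₁ α₂ β₁ β₂ lam₁ lam₂ z)
      (nhdsWithin ((-(β₁ * (m + α₁)) : ℝ) : ℂ) {((-(β₁ * (m + α₁)) : ℝ) : ℂ)}ᶜ) (nhds (r : ℂ)) := by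
  have hβ : (β₁ : ℂ) ≠ 0 := by exact_mod_cast hβ₁.ne'
  obtain ⟨r, hr, hlim⟩ := exists_tendsto_add_mul_cBeta (s := 1 - lam₁) (by linarith [hlam₁.1.1])
    (by
      intro m h
      have h2 : lam₁ = ((m + 1 : ℕ) : ℝ) := by push_cast; linarith
      have h3 := hlam₁.1.2
      rw [h2] at h3
      have h4 : m + 1 < 3 := by exact_mod_cast h3
      rcases (by omega : m = 0 ∨ m = 1) with rfl | rfl
      · exact hlam₁.2.1 (by rw [h2]; norm_num)
      · exact hlam₁.2.2 (by rw [h2]; norm_num)) m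
  set p : ℂ := ((-(β₁ * (m + α₁)) : ℝ) : ℂ) with hp
  have hpval : (α₁ : ℂ) + p / β₁ = -(m : ℂ) := by
    rw [hp]; push_cast; field_simp; ring
  have hshift : Filter.Tendsto (fun z : ℂ => (α₁ : ℂ) + z / β₁) (nhdsWithin p {p}ᶜ)
      (nhdsWithin (-(m : ℂ)) {-(m : ℂ)}ᶜ) := by
    refine tendsto_nhdsWithin_iff.2 ⟨?_, ?_⟩
    · have : Filter.Tendsto (fun z : ℂ => (α₁ : ℂ) + z / β₁) (nhds p) (nhds (α₁ + p / β₁)) :=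
        (by fun_prop : Continuous fun z : ℂ => (α₁ : ℂ) + z / β₁).tendsto _
      rw [hpval] at this
      exact this.mono_left nhdsWithin_le_nhds
    · filter_upwards [self_mem_nhdsWithin] with z hz h
      apply hz
      have : (α₁ : ℂ) + z / β₁ = α₁ + p / β₁ := h.trans hpval.symm
      field_simp at this
      simpa using this
  have hreg : Filter.Tendsto (fun z : ℂ => (z - p) *
      killedExponentRegular q a σ c₁ c₂ α₁ α₂ β₁ β₂ lam₁ lam₂ z) (nhdsWithin p {p}ᶜ) (nhds 0) := by
    have hc := (differentiableAt_killedExponentRegular (q := q) (a := a) (σ := σ) (c₁ := c₁)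
      (c₂ := c₂) (α₁ := α₁) (α₂ := α₂) (β₁ := β₁) (lam₁ := lam₁) (lam₂ := lam₂) hβ₂ (z := p) (by
        rw [hp, Complex.ofReal_re]
        have : 0 < β₁ * (m + α₁) := by positivity
        have : 0 < β₂ * α₂ := by positivity
        linarith)).continuousAt
    have h1 : ContinuousAt (fun z : ℂ => (z - p) *
      killedExponentRegular q a σ c₁ c₂ α₁ α₂ β₁ β₂ lam₁ lam₂ z) p :=
      ContinuousAt.mul (by fun_prop) hc
    have h2 := h1.tendsto
    simp only [sub_self, zero_mul] at h2
    exact h2.mono_left nhdsWithin_le_nhds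
  have hpole := (hlim.comp hshift).const_mul (c₁ : ℂ)
  refine ⟨0 - c₁ * r, by have := mul_pos hc₁ hr; linarith, ?_⟩
  have hfin := hreg.sub hpole
  push_cast
  refine hfin.congr fun z => ?_
  rw [killedExponent_eq]
  have : (α₁ : ℂ) + z / β₁ + m = (z - p) / β₁ := by
    rw [hp]; push_cast; field_simp; ring
  simp only [Function.comp, this]
  ring

theorem killedExponent_re_neg_right_of_pole (hc₁ : 0 < c₁) (hα₁ : 0 < α₁) (hα₂ : 0 < α₂)
    (hβ₁ : 0 < β₁) (hβ₂ : 0 < β₂)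
    (hlam₁ : lam₁ ∈ Ioo (0 : ℝ) 3 ∧ lam₁ ≠ 1 ∧ lam₁ ≠ 2) (m : ℕ) :
    ∀ᶠ x : ℝ in nhdsWithin (-(β₁ * (m + α₁))) (Ioi (-(β₁ * (m + α₁)))),
      (killedExponent q a σ c₁ c₂ α₁ α₂ β₁ β₂ lam₁ lam₂ x).re < 0 := by
  obtain ⟨r, hr, hlim⟩ := exists_tendsto_mul_killedExponent (q := q) (a := a) (σ := σ)
    (c₂ := c₂) (lam₂ := lam₂) hc₁ hα₁ hα₂ hβ₁ hβ₂ hlam₁ m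
  have hof : Filter.Tendsto (fun x : ℝ => (x : ℂ))
      (nhdsWithin (-(β₁ * (m + α₁))) (Ioi (-(β₁ * (m + α₁)))))
      (nhdsWithin ((-(β₁ * (m + α₁)) : ℝ) : ℂ) {((-(β₁ * (m + α₁)) : ℝ) : ℂ)}ᶜ) := by
    refine tendsto_nhdsWithin_iff.2 ⟨?_, ?_⟩
    · exact (Complex.continuous_ofReal.tendsto _).mono_left nhdsWithin_le_nhds
    · filter_upwards [self_mem_nhdsWithin] with x hx h
      exact (ne_of_gt hx) (Complex.ofReal_injective h)
  have hre := (Complex.continuous_re.tendsto _).comp (hlim.comp hof)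
  have hneg := hre.eventually_lt_const (u := 0) (by simpa using hr)
  filter_upwards [hneg, self_mem_nhdsWithin] with x hx hx0
  simp only [Function.comp, ← Complex.ofReal_sub, Complex.re_ofReal_mul] at hx
  have : 0 < x - -(β₁ * (m + α₁)) := sub_pos.2 hx0
  by_contra hcon
  exact absurd hx (not_lt.2 (mul_nonneg this.le (not_lt.1 hcon)))

theorem norm_killedExponent_mul_abs_im_le (hα₂ : 0 < α₂)
    (hβ₁ : 0 < β₁) (hβ₂ : 0 < β₂)
    (hlam₁ : lam₁ ∈ Ioo (0 : ℝ) 3 ∧ lam₁ ≠ 1 ∧ lam₁ ≠ 2)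
    (hlam₂ : lam₂ ∈ Ioo (0 : ℝ) 3 ∧ lam₂ ≠ 1 ∧ lam₂ ≠ 2) :
    ∃ C : ℝ, 0 ≤ C ∧ ∀ z : ℂ, z.re ≤ 0 →
      ‖killedExponent q a σ c₁ c₂ α₁ α₂ β₁ β₂ lam₁ lam₂ z‖ * |z.im| ≤ C * (1 + ‖z‖) ^ 3 := by
  obtain ⟨C₁, hC₁, h1⟩ := norm_cBeta_mul_abs_im_le (s := 1 - lam₁) (by linarith [hlam₁.1.2])
    (by linarith [hlam₁.1.1]) (fun h => hlam₁.2.1 (by linarith)) (fun h => hlam₁.2.2 (by linarith))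
  obtain ⟨C₂, hC₂, h2⟩ := norm_cBeta_le (δ := α₂) (s := 1 - lam₂) hα₂ (by linarith [hlam₂.1.2])
    (fun h => hlam₂.2.1 (by linarith)) (fun h => hlam₂.2.2 (by linarith))
  -- affine changes of variable change `1 + ‖z‖` by a bounded factor
  have haff : ∀ (u v : ℝ) (z : ℂ), 1 + ‖(u : ℂ) + v * z‖ ≤ (1 + |u| + |v|) * (1 + ‖z‖) := by
    intro u v z
    have : ‖(u : ℂ) + v * z‖ ≤ |u| + |v| * ‖z‖ := by
      refine (norm_add_le _ _).trans ?_
      rw [norm_mul, Complex.norm_real, Complex.norm_real, Real.norm_eq_abs, Real.norm_eq_abs]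
    nlinarith [norm_nonneg z, mul_nonneg (abs_nonneg u) (norm_nonneg z), abs_nonneg v]
  set A₁ := 1 + |α₁| + |β₁⁻¹|
  set A₂ := 1 + |α₂| + |-β₂⁻¹|
  set K₁ := ‖(c₁ / β₁ : ℂ) * cBeta α₁ (1 - lam₁ : ℝ)‖ + ‖(c₂ / β₂ : ℂ) * cBeta α₂ (1 - lam₂ : ℝ)‖
  refine ⟨|q| + |a| + ‖(σ : ℂ) ^ 2 / 2‖ + K₁ + ‖(c₂ / β₂ : ℂ)‖ * (C₂ * A₂ ^ 2) +
    ‖(c₁ / β₁ : ℂ)‖ * (β₁ * (C₁ * A₁ ^ 3)), by positivity, fun z hz => ?_⟩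
  set Z := 1 + ‖z‖ with hZ
  have hZ1 : 1 ≤ Z := by rw [hZ]; linarith [norm_nonneg z]
  have hzZ : ‖z‖ ≤ Z := by rw [hZ]; linarith
  have hy : |z.im| ≤ Z := (Complex.abs_im_le_norm z).trans hzZ
  have hB1 : ‖cBeta ((α₁ : ℂ) + z / β₁) (1 - lam₁ : ℝ)‖ * |z.im| ≤ β₁ * (C₁ * A₁ ^ 3) * Z ^ 3 := by
    have e := h1 ((α₁ : ℂ) + z / β₁)
    have him : |((α₁ : ℂ) + z / β₁).im| = |z.im| / β₁ := by
      rw [Complex.add_im, Complex.ofReal_im, zero_add, Complex.div_ofReal_im, abs_div,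
        abs_of_pos hβ₁]
    have haf := haff α₁ β₁⁻¹ z
    rw [show (α₁ : ℂ) + (β₁⁻¹ : ℝ) * z = α₁ + z / β₁ by push_cast; ring] at haf
    rw [him] at e
    calc _ = β₁ * (‖cBeta ((α₁ : ℂ) + z / β₁) (1 - lam₁ : ℝ)‖ * (|z.im| / β₁)) := by
          field_simp
      _ ≤ β₁ * (C₁ * (1 + ‖(α₁ : ℂ) + z / β₁‖) ^ 3) := by gcongr
      _ ≤ β₁ * (C₁ * (A₁ * Z) ^ 3) := by gcongr
      _ = _ := by ring
  have hB2 : ‖cBeta ((α₂ : ℂ) - z / β₂) (1 - lam₂ : ℝ)‖ ≤ C₂ * A₂ ^ 2 * Z ^ 2 := by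
    have hre : α₂ ≤ ((α₂ : ℂ) - z / β₂).re := by
      rw [Complex.sub_re, Complex.div_ofReal_re, Complex.ofReal_re]
      have := div_nonpos_of_nonpos_of_nonneg hz hβ₂.le
      linarith
    have haf := haff α₂ (-β₂⁻¹) z
    rw [show (α₂ : ℂ) + (-β₂⁻¹ : ℝ) * z = α₂ - z / β₂ by push_cast; ring] at haf
    calc _ ≤ C₂ * (1 + ‖(α₂ : ℂ) - z / β₂‖) ^ 2 := h2 _ hre
      _ ≤ C₂ * (A₂ * Z) ^ 2 := by gcongr
      _ = _ := by ring
  have hreg : ‖killedExponentRegular q a σ c₁ c₂ α₁ α₂ β₁ β₂ lam₁ lam₂ z‖ ≤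
      (|q| + |a| + ‖(σ : ℂ) ^ 2 / 2‖ + K₁ + ‖(c₂ / β₂ : ℂ)‖ * (C₂ * A₂ ^ 2)) * Z ^ 2 := by
    have e : killedExponentRegular q a σ c₁ c₂ α₁ α₂ β₁ β₂ lam₁ lam₂ z =
        q + (-(a * z)) + (-((σ : ℂ) ^ 2 / 2 * z ^ 2)) + (c₁ / β₁ : ℂ) * cBeta α₁ (1 - lam₁ : ℝ)
          + (c₂ / β₂ : ℂ) * cBeta α₂ (1 - lam₂ : ℝ)
          + (-((c₂ / β₂ : ℂ) * cBeta ((α₂ : ℂ) - z / β₂) (1 - lam₂ : ℝ))) := by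
      unfold killedExponentRegular; ring
    have n1 : ‖(q : ℂ)‖ ≤ |q| * Z ^ 2 := by
      rw [Complex.norm_real, Real.norm_eq_abs]
      exact le_mul_of_one_le_right (abs_nonneg _) (one_le_pow₀ hZ1)
    have n2 : ‖-((a : ℂ) * z)‖ ≤ |a| * Z ^ 2 := by
      rw [norm_neg, norm_mul, Complex.norm_real, Real.norm_eq_abs]
      gcongr
      nlinarith
    have n3 : ‖-((σ : ℂ) ^ 2 / 2 * z ^ 2)‖ ≤ ‖(σ : ℂ) ^ 2 / 2‖ * Z ^ 2 := by
      rw [norm_neg, norm_mul, norm_pow z]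
      gcongr
    have n4 : ‖(c₁ / β₁ : ℂ) * cBeta α₁ (1 - lam₁ : ℝ)‖ +
        ‖(c₂ / β₂ : ℂ) * cBeta α₂ (1 - lam₂ : ℝ)‖ ≤ K₁ * Z ^ 2 :=
      le_mul_of_one_le_right (by positivity) (one_le_pow₀ hZ1)
    have n5 : ‖-((c₂ / β₂ : ℂ) * cBeta ((α₂ : ℂ) - z / β₂) (1 - lam₂ : ℝ))‖ ≤
        ‖(c₂ / β₂ : ℂ)‖ * (C₂ * A₂ ^ 2 * Z ^ 2) := by
      rw [norm_neg, norm_mul]; gcongr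
    rw [e]
    refine (norm_add_le _ _).trans ((add_le_add (norm_add_le _ _) le_rfl).trans ?_)
    have m1 := (norm_add_le ((q : ℂ) + (-(a * z)) + (-((σ : ℂ) ^ 2 / 2 * z ^ 2)))
      ((c₁ / β₁ : ℂ) * cBeta α₁ (1 - lam₁ : ℝ)))
    have m2 := norm_add_le ((q : ℂ) + (-(a * z))) (-((σ : ℂ) ^ 2 / 2 * z ^ 2))
    have m3 := norm_add_le (q : ℂ) (-(a * z))
    nlinarith
  rw [killedExponent_eq]
  calc _ ≤ (‖killedExponentRegular q a σ c₁ c₂ α₁ α₂ β₁ β₂ lam₁ lam₂ z‖ +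
        ‖(c₁ / β₁ : ℂ)‖ * ‖cBeta ((α₁ : ℂ) + z / β₁) (1 - lam₁ : ℝ)‖) * |z.im| := by
        gcongr
        exact (norm_sub_le _ _).trans_eq (by rw [norm_mul])
    _ = ‖killedExponentRegular q a σ c₁ c₂ α₁ α₂ β₁ β₂ lam₁ lam₂ z‖ * |z.im| +
        ‖(c₁ / β₁ : ℂ)‖ * (‖cBeta ((α₁ : ℂ) + z / β₁) (1 - lam₁ : ℝ)‖ * |z.im|) := by ring
    _ ≤ (|q| + |a| + ‖(σ : ℂ) ^ 2 / 2‖ + K₁ + ‖(c₂ / β₂ : ℂ)‖ * (C₂ * A₂ ^ 2)) * Z ^ 2 * Z +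
        ‖(c₁ / β₁ : ℂ)‖ * (β₁ * (C₁ * A₁ ^ 3) * Z ^ 3) := by gcongr
    _ = _ := by ring

end KilledExponent

/-- The negatives `-ζ n` of the roots and the poles `p n` interlace. -/
structure Interlaced (p ζ : ℕ → ℝ) : Prop where
  zero_left : -p 0 < ζ 0
  zero_right : ζ 0 < 0
  left : ∀ n, -p (n + 1) < ζ (n + 1)
  right : ∀ n, ζ (n + 1) < -p n
  tendsto : Filter.Tendsto p Filter.atTop Filter.atTop

namespace Interlaced

variable {p ζ : ℕ → ℝ}

theorem neg_pole_lt (h : Interlaced p ζ) (n : ℕ) : -p n < ζ n := by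
  cases n with
  | zero => exact h.zero_left
  | succ n => exact h.left n

theorem pole_strictMono (h : Interlaced p ζ) : StrictMono p :=
  strictMono_nat_of_lt_succ fun n => by linarith [h.left n, h.right n]

theorem pole_pos (h : Interlaced p ζ) (n : ℕ) : 0 < p n :=
  lt_of_lt_of_le (by linarith [h.zero_left, h.zero_right]) (h.pole_strictMono.monotone n.zero_le)

theorem root_neg (h : Interlaced p ζ) (n : ℕ) : ζ n < 0 := by
  cases n with
  | zero => exact h.zero_right
  | succ n => linarith [h.right n, h.pole_pos n]

theorem root_strictAnti (h : Interlaced p ζ) : StrictAnti ζ :=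
  strictAnti_nat_of_succ_lt fun n => (h.right n).trans (h.neg_pole_lt n)

theorem root_lt_neg_pole (h : Interlaced p ζ) {m n : ℕ} (hmn : m < n) : ζ n < -p m := by
  obtain ⟨k, rfl⟩ : ∃ k, n = k + 1 := ⟨n - 1, by omega⟩
  exact (h.right k).trans_le (neg_le_neg (h.pole_strictMono.monotone (by omega)))

theorem neg_pole_lt_root (h : Interlaced p ζ) {m n : ℕ} (hmn : n ≤ m) : -p m < ζ n :=
  (neg_le_neg (h.pole_strictMono.monotone hmn)).trans_lt (h.neg_pole_lt n)

theorem one_add_div_pole_pos (h : Interlaced p ζ) {x : ℝ} {m : ℕ} (hx : -p m < x) :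
    0 < 1 + x / p m := by
  have hp := h.pole_pos m
  have : -1 < x / p m := by rw [lt_div_iff₀ hp]; linarith
  linarith

theorem one_add_div_pole_neg (h : Interlaced p ζ) {x : ℝ} {m : ℕ} (hx : x < -p m) :
    1 + x / p m < 0 := by
  have hp := h.pole_pos m
  have : x / p m < -1 := by rw [div_lt_iff₀ hp]; linarith
  linarith

theorem one_sub_div_root_pos (h : Interlaced p ζ) {x : ℝ} {m : ℕ} (hx : ζ m < x) :
    0 < 1 - x / ζ m := by
  have : x / ζ m < 1 := by rw [div_lt_one_of_neg (h.root_neg m)]; exact hx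
  linarith

theorem one_sub_div_root_neg (h : Interlaced p ζ) {x : ℝ} {m : ℕ} (hx : x < ζ m) :
    1 - x / ζ m < 0 := by
  have : 1 < x / ζ m := by rw [one_lt_div_of_neg (h.root_neg m)]; exact hx
  linarith

theorem tendsto_root (h : Interlaced p ζ) : Filter.Tendsto ζ Filter.atTop Filter.atBot := by
  rw [← Filter.tendsto_add_atTop_iff_nat 1]
  exact Filter.tendsto_atBot_mono (fun n => (h.right n).le)
    (Filter.tendsto_neg_atTop_atBot.comp h.tendsto)

end Interlaced

/-- Factors of the coefficients in the partial fraction expansion. -/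
def coeffFactor (p ζ : ℕ → ℝ) (k m : ℕ) : ℝ :=
  if m < k then (1 + ζ k / p m) / (1 - ζ k / ζ m)
  else if m = k then 1
  else (1 + ζ k / p (m - 1)) / (1 - ζ k / ζ m)

/-- Coefficients of the partial fraction expansion of `rationalApprox`. -/
def partialCoeff (p ζ : ℕ → ℝ) (N k : ℕ) : ℝ :=
  ∏ m ∈ Finset.range (N + 1), coeffFactor p ζ k m

/-- The rational function with zeros `-p m`, `m < N`, and poles `ζ m`, `m ≤ N`. -/
def rationalApprox (p ζ : ℕ → ℝ) (N : ℕ) (z : ℂ) : ℂ :=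
  (∏ m ∈ Finset.range N, (1 + z / p m)) / ∏ m ∈ Finset.range (N + 1), (1 - z / ζ m)

namespace Interlaced

variable {p ζ : ℕ → ℝ}

theorem coeffFactor_pos (h : Interlaced p ζ) (k m : ℕ) : 0 < coeffFactor p ζ k m := by
  unfold coeffFactor
  split_ifs with h1 h2
  · exact div_pos_of_neg_of_neg (h.one_add_div_pole_neg (h.root_lt_neg_pole h1))
      (h.one_sub_div_root_neg (h.root_strictAnti h1))
  · exact one_pos
  · exact div_pos (h.one_add_div_pole_pos (h.neg_pole_lt_root (by omega)))
      (h.one_sub_div_root_pos (h.root_strictAnti (by omega)))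

theorem partialCoeff_pos (h : Interlaced p ζ) (N k : ℕ) : 0 < partialCoeff p ζ N k :=
  Finset.prod_pos fun m _ => h.coeffFactor_pos k m

theorem partialCoeff_self (p ζ : ℕ → ℝ) (N : ℕ) :
    ((partialCoeff p ζ (N + 1) (N + 1) : ℝ) : ℂ) =
      (1 + ζ (N + 1) / p N) * rationalApprox p ζ N (ζ (N + 1)) := by
  have h1 : partialCoeff p ζ (N + 1) (N + 1) = ∏ m ∈ Finset.range (N + 1),
      (1 + ζ (N + 1) / p m) / (1 - ζ (N + 1) / ζ m) := by
    unfold partialCoeff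
    rw [Finset.prod_range_succ]
    have : coeffFactor p ζ (N + 1) (N + 1) = 1 := by simp [coeffFactor]
    rw [this, mul_one]
    refine Finset.prod_congr rfl fun m hm => ?_
    rw [Finset.mem_range] at hm
    simp [coeffFactor, hm]
  rw [h1, Finset.prod_div_distrib, rationalApprox,
    Finset.prod_range_succ (fun m => 1 + ζ (N + 1) / p m)]
  push_cast
  ring

theorem rationalApprox_eq_sum (h : Interlaced p ζ) (N : ℕ) : ∀ z : ℂ, (∀ k ≤ N, z ≠ ζ k) →
    rationalApprox p ζ N z =
      ∑ k ∈ Finset.range (N + 1), (partialCoeff p ζ N k : ℂ) / (1 - z / ζ k) := by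
  induction N with
  | zero =>
    intro z hz
    simp [rationalApprox, partialCoeff, coeffFactor]
  | succ N ih =>
    intro z hz
    have hζ : ∀ k, (ζ k : ℂ) ≠ 0 := fun k => by exact_mod_cast (h.root_neg k).ne
    have hstep : rationalApprox p ζ (N + 1) z =
        rationalApprox p ζ N z * ((1 + z / p N) / (1 - z / ζ (N + 1))) := by
      unfold rationalApprox
      rw [Finset.prod_range_succ _ N, Finset.prod_range_succ _ (N + 1), mul_div_mul_comm]
    have hroot : ∀ k ≤ N, (ζ (N + 1) : ℂ) ≠ ζ k := fun k hk => by
      exact_mod_cast (h.root_strictAnti (Nat.lt_succ_of_le hk)).ne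
    rw [hstep, ih z fun k hk => hz k (by omega), Finset.sum_range_succ _ (N + 1),
      partialCoeff_self, ih _ hroot, Finset.sum_mul, Finset.mul_sum, Finset.sum_div,
      ← Finset.sum_add_distrib]
    refine Finset.sum_congr rfl fun k hk => ?_
    rw [Finset.mem_range] at hk
    have hC : partialCoeff p ζ (N + 1) k =
        partialCoeff p ζ N k * ((1 + ζ k / p N) / (1 - ζ k / ζ (N + 1))) := by
      unfold partialCoeff
      rw [Finset.prod_range_succ _ (N + 1)]
      congr 1
      simp [coeffFactor, hk.not_gt, hk.ne']
    rw [hC]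
    push_cast
    have hp : (p N : ℂ) ≠ 0 := by exact_mod_cast (h.pole_pos N).ne'
    have e1 := hζ k
    have e2 := hζ (N + 1)
    have e3 : (ζ k : ℂ) - z ≠ 0 := sub_ne_zero.2 (hz k (by omega)).symm
    have e4 : (ζ (N + 1) : ℂ) - z ≠ 0 := sub_ne_zero.2 (hz _ le_rfl).symm
    have e5 : (ζ (N + 1) : ℂ) - ζ k ≠ 0 := sub_ne_zero.2 (hroot k (by omega))
    have e6 : (ζ k : ℂ) - ζ (N + 1) ≠ 0 := sub_ne_zero.2 (hroot k (by omega)).symm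
    have f1 : 1 - z / ζ k = (ζ k - z) / ζ k := by field_simp
    have f2 : 1 - z / ζ (N + 1) = (ζ (N + 1) - z) / ζ (N + 1) := by field_simp
    have f3 : 1 - (ζ (N + 1) : ℂ) / ζ k = -(ζ (N + 1) - ζ k) / ζ k := by field_simp; ring
    have f4 : 1 - (ζ k : ℂ) / ζ (N + 1) = (ζ (N + 1) - ζ k) / ζ (N + 1) := by field_simp
    rw [f1, f2, f3, f4]
    field_simp
    ring

theorem sum_partialCoeff (h : Interlaced p ζ) (N : ℕ) :
    ∑ k ∈ Finset.range (N + 1), partialCoeff p ζ N k = 1 := by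
  have h1 := h.rationalApprox_eq_sum N 0 fun k _ => by
    exact_mod_cast (h.root_neg k).ne'
  simp only [rationalApprox, zero_div, add_zero, sub_zero, Finset.prod_const_one, div_one] at h1
  exact_mod_cast h1.symm

theorem summable_ratio_sub_one (h : Interlaced p ζ) (k : ℕ) : Summable fun m : ℕ =>
    (1 + ζ k / p m) / (1 - ζ k / ζ (m + 1)) - 1 := by
  have htel : Summable fun m => 1 / p m - 1 / p (m + 1) := by
    refine summable_of_sum_range_le (c := 1 / p 0) (fun m => ?_) fun n => ?_
    · exact sub_nonneg.2 (one_div_le_one_div_of_le (h.pole_pos m)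
        (h.pole_strictMono.monotone m.le_succ))
    · rw [Finset.sum_range_sub' (fun m => 1 / p m)]
      linarith [one_div_pos.2 (h.pole_pos n)]
  have hd : 0 < 1 - ζ k / ζ (k + 1) := h.one_sub_div_root_pos (h.root_strictAnti k.lt_succ_self)
  refine Summable.of_norm_bounded_eventually_nat
    (htel.mul_left (-ζ k / (1 - ζ k / ζ (k + 1)))) ?_
  filter_upwards [Filter.eventually_ge_atTop k] with m hm
  have hp := h.pole_pos m
  have hp' := h.pole_pos (m + 1)
  have hr := h.root_neg (m + 1)
  have hk := h.root_neg k
  have hle : ζ (m + 1) ≤ ζ (k + 1) := h.root_strictAnti.antitone (by omega)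
  have hd' : 1 - ζ k / ζ (k + 1) ≤ 1 - ζ k / ζ (m + 1) := by
    have : ζ k / ζ (m + 1) ≤ ζ k / ζ (k + 1) := by
      have := one_div_le_one_div_of_neg_of_le (h.root_neg (k + 1)) hle
      rw [div_eq_mul_one_div (ζ k), div_eq_mul_one_div (ζ k)]
      exact mul_le_mul_of_nonpos_left this hk.le
    linarith
  have hd'' : 0 < 1 - ζ k / ζ (m + 1) := hd.trans_le hd'
  have he : (1 + ζ k / p m) / (1 - ζ k / ζ (m + 1)) - 1 =
      -((-ζ k) * (1 / p m - 1 / (-ζ (m + 1)))) / (1 - ζ k / ζ (m + 1)) := by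
    rw [div_sub_one hd''.ne']
    congr 1
    have := hr.ne
    field_simp
    ring
  have hA : 0 ≤ 1 / p m - 1 / (-ζ (m + 1)) :=
    sub_nonneg.2 (one_div_le_one_div_of_le hp (by linarith [h.right m]))
  have hB : 1 / p m - 1 / (-ζ (m + 1)) ≤ 1 / p m - 1 / p (m + 1) := by
    have := one_div_le_one_div_of_le (a := -ζ (m+1)) (b := p (m+1)) (by linarith)
      (by linarith [h.left m])
    linarith
  rw [he, norm_div, norm_neg, norm_mul, Real.norm_of_nonneg hA, Real.norm_of_nonneg hd''.le,
    Real.norm_of_nonneg (by linarith : (0 : ℝ) ≤ -ζ k), div_mul_eq_mul_div]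
  exact div_le_div₀ (mul_nonneg (by linarith) (hA.trans hB)) 
    (mul_le_mul_of_nonneg_left hB (by linarith)) hd hd'

theorem multipliable_ratio (h : Interlaced p ζ) (k : ℕ) : Multipliable fun m : ℕ =>
    (1 + ζ k / p m) / (1 - ζ k / ζ (m + 1)) := by
  simpa using multipliable_one_add_of_summable (h.summable_ratio_sub_one k).norm

theorem multipliable_ratio_subtype (h : Interlaced p ζ) (k : ℕ) :
    Multipliable fun m : {m : ℕ // 1 ≤ m ∧ m ≠ k} =>
    (1 + ζ k / p (m - 1)) / (1 - ζ k / ζ m) := by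
  have hinj : Function.Injective fun m : {m : ℕ // 1 ≤ m ∧ m ≠ k} => (m : ℕ) - 1 := by
    rintro ⟨m, hm⟩ ⟨n, hn⟩ hmn
    simp only at hmn
    exact Subtype.ext (by simp only; omega)
  have h1 := (h.summable_ratio_sub_one k).comp_injective hinj
  have h2 := multipliable_one_add_of_summable h1.norm
  refine h2.congr fun m => ?_
  have hm : (m : ℕ) - 1 + 1 = m := Nat.sub_add_cancel m.2.1
  simp [hm]

theorem tendsto_partialCoeff_zero (h : Interlaced p ζ) :
    Filter.Tendsto (fun N => partialCoeff p ζ N 0) Filter.atTop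
    (nhds (∏' m : ℕ, (1 + ζ 0 / p m) / (1 - ζ 0 / ζ (m + 1)))) := by
  refine (h.multipliable_ratio 0).hasProd.tendsto_prod_nat.congr fun N => ?_
  rw [partialCoeff, Finset.prod_range_succ']
  simp [coeffFactor]

theorem tendsto_partialCoeff (h : Interlaced p ζ) {k : ℕ} (hk : 1 ≤ k) :
    Filter.Tendsto (fun N => partialCoeff p ζ N k) Filter.atTop
    (nhds ((1 + ζ k / p (k - 1)) / (1 - ζ k / ζ 0) * ∏' m : {m : ℕ // 1 ≤ m ∧ m ≠ k},
      (1 + ζ k / p (m - 1)) / (1 - ζ k / ζ m))) := by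
  have h1 := (h.multipliable_ratio_subtype k).hasProd
  have h2 := (hasProd_subtype_iff_mulIndicator (s := {m : ℕ | 1 ≤ m ∧ m ≠ k})
    (f := fun m => (1 + ζ k / p (m - 1)) / (1 - ζ k / ζ m))).1 h1
  have h3 := ((Filter.tendsto_add_atTop_iff_nat 1).2 h2.tendsto_prod_nat).const_mul
    ((1 + ζ k / p (k - 1)) / (1 - ζ k / ζ 0))
  refine h3.congr' ?_
  filter_upwards [Filter.eventually_ge_atTop k] with N hN
  induction N, hN using Nat.le_induction with
  | base =>
    unfold partialCoeff
    rw [Finset.prod_range_succ, Finset.prod_range_succ]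
    simp only [mulIndicator, mem_ofPred_eq, ne_eq, not_true_eq_false, and_false, if_false, mul_one,
      coeffFactor, lt_irrefl, if_true]
    obtain ⟨j, rfl⟩ : ∃ j, k = j + 1 := ⟨k - 1, by omega⟩
    have e1 : ∏ m ∈ Finset.range (j + 1), (if m < j + 1 then
        (1 + ζ (j + 1) / p m) / (1 - ζ (j + 1) / ζ m) else if m = j + 1 then 1 else
        (1 + ζ (j + 1) / p (m - 1)) / (1 - ζ (j + 1) / ζ m)) =
        ∏ m ∈ Finset.range (j + 1), (1 + ζ (j + 1) / p m) / (1 - ζ (j + 1) / ζ m) :=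
      Finset.prod_congr rfl fun m hm => if_pos (Finset.mem_range.1 hm)
    rw [e1, Finset.prod_div_distrib, Finset.prod_range_succ (fun m => 1 + ζ (j + 1) / p m),
      Finset.prod_range_succ' (fun m => 1 - ζ (j + 1) / ζ m), Finset.prod_range_succ']
    have e2 : ∏ m ∈ Finset.range j, (if 1 ≤ m + 1 ∧ m + 1 ≠ j + 1 then
        (1 + ζ (j + 1) / p (m + 1 - 1)) / (1 - ζ (j + 1) / ζ (m + 1)) else 1) =
        ∏ m ∈ Finset.range j, (1 + ζ (j + 1) / p m) / (1 - ζ (j + 1) / ζ (m + 1)) :=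
      Finset.prod_congr rfl fun m hm => by
        have := Finset.mem_range.1 hm
        rw [if_pos ⟨by omega, by omega⟩]
        rfl
    simp only [ne_eq] at e2
    rw [e2, Finset.prod_div_distrib]
    simp only [nonpos_iff_eq_zero, one_ne_zero, false_and, if_false, mul_one, Nat.add_sub_cancel]
    rw [div_mul_div_comm, mul_comm (1 + ζ (j + 1) / p j), mul_comm (1 - ζ (j + 1) / ζ 0)]
  | succ N hN ih =>
    unfold partialCoeff at ih ⊢
    rw [Finset.prod_range_succ _ (N + 1), Finset.prod_range_succ _ (N + 1), ← mul_assoc, ih]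
    congr 1
    have e1 : ¬ N + 1 < k := by omega
    have e2 : N + 1 ≠ k := by omega
    simp [mulIndicator, coeffFactor, e1, e2]

end Interlaced

theorem tendsto_sum_mul_of_tendsto_zero {C : ℕ → ℕ → ℝ} {c : ℕ → ℝ} {x : ℕ → ℂ}
    (hC : ∀ N k, 0 ≤ C N k) (hC1 : ∀ N, ∑ k ∈ Finset.range (N + 1), C N k = 1)
    (hc : ∀ k, 0 ≤ c k) (hsum : ∀ K, ∑ k ∈ Finset.range K, c k ≤ 1)
    (hlim : ∀ k, Filter.Tendsto (fun N => C N k) Filter.atTop (nhds (c k)))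
    (hx : Filter.Tendsto x Filter.atTop (nhds 0)) :
    Filter.Tendsto (fun N => ∑ k ∈ Finset.range (N + 1), (C N k : ℂ) * x k) Filter.atTop
      (nhds (∑' k, (c k : ℂ) * x k)) := by
  have hcs : Summable c := summable_of_sum_range_le hc hsum
  have hcs1 : ∑' k, c k ≤ 1 := Real.tsum_le_of_sum_range_le hc hsum
  obtain ⟨B, hB⟩ : ∃ B, ∀ k, ‖x k‖ ≤ B := by
    obtain ⟨B, hB⟩ := (Metric.isBounded_range_of_tendsto x hx).exists_norm_le
    exact ⟨B, fun k => hB _ ⟨k, rfl⟩⟩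
  have hsx : Summable fun k => (c k : ℂ) * x k :=
    Summable.of_norm_bounded (hcs.mul_right B) fun k => by
      rw [norm_mul, Complex.norm_real, Real.norm_of_nonneg (hc k)]
      exact mul_le_mul_of_nonneg_left (hB k) (hc k)
  rw [Metric.tendsto_atTop]
  intro ε hε
  obtain ⟨K, hK⟩ := Metric.tendsto_atTop.1 hx (ε / 4) (by positivity)
  have hfin : Filter.Tendsto (fun N => ∑ k ∈ Finset.range K, (C N k : ℂ) * x k) Filter.atTop
      (nhds (∑ k ∈ Finset.range K, (c k : ℂ) * x k)) :=
    tendsto_finsetSum _ fun k _ =>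
      ((Complex.continuous_ofReal.tendsto _).comp (hlim k)).mul_const _
  obtain ⟨N₀, hN₀⟩ := Metric.tendsto_atTop.1 hfin (ε / 4) (by positivity)
  refine ⟨max N₀ K, fun N hN => ?_⟩
  have hNK : K ≤ N + 1 := by have := le_of_max_le_right hN; omega
  have h1 := hN₀ N (le_of_max_le_left hN)
  have hsmall : ∀ k, K ≤ k → ‖x k‖ ≤ ε / 4 := fun k hk => by
    have := (hK k hk).le
    rwa [dist_zero_right] at this
  rw [← Finset.sum_range_add_sum_Ico _ hNK, ← hsx.sum_add_tsum_nat_add K]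
  have h2 : ‖∑ k ∈ Finset.Ico K (N + 1), (C N k : ℂ) * x k‖ ≤ ε / 4 := by
    calc _ ≤ ∑ k ∈ Finset.Ico K (N + 1), C N k * (ε / 4) := by
          refine norm_sum_le_of_le _ fun k hk => ?_
          rw [norm_mul, Complex.norm_real, Real.norm_of_nonneg (hC N k)]
          exact mul_le_mul_of_nonneg_left (hsmall k (Finset.mem_Ico.1 hk).1) (hC N k)
      _ ≤ 1 * (ε / 4) := by
          rw [← Finset.sum_mul]
          refine mul_le_mul_of_nonneg_right ?_ (by positivity)
          rw [← hC1 N]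
          exact Finset.sum_le_sum_of_subset_of_nonneg (fun k hk => by
            rw [Finset.mem_range]; exact (Finset.mem_Ico.1 hk).2) fun k _ _ => hC N k
      _ = ε / 4 := one_mul _
  have h3 : ‖∑' k, (c (k + K) : ℂ) * x (k + K)‖ ≤ ε / 4 := by
    have hs' : Summable fun k => c (k + K) * (ε / 4) :=
      ((summable_nat_add_iff K).2 hcs).mul_right _
    calc _ ≤ ∑' k, c (k + K) * (ε / 4) := by
          refine tsum_of_norm_bounded hs'.hasSum fun k => ?_
          rw [norm_mul, Complex.norm_real, Real.norm_of_nonneg (hc _)]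
          exact mul_le_mul_of_nonneg_left (hsmall _ (by omega)) (hc _)
      _ ≤ 1 * (ε / 4) := by
          rw [tsum_mul_right]
          refine mul_le_mul_of_nonneg_right (le_trans ?_ hcs1) (by positivity)
          rw [← hcs.sum_add_tsum_nat_add K]
          linarith [Finset.sum_nonneg fun k (_ : k ∈ Finset.range K) => hc k]
      _ = ε / 4 := one_mul _
  rw [dist_eq_norm] at h1 ⊢
  rw [add_sub_add_comm]
  calc _ ≤ _ := norm_add_le _ _
    _ ≤ ε / 4 + (ε / 4 + ε / 4) := add_le_add h1.le ((norm_sub_le _ _).trans (add_le_add h2 h3))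
    _ < ε := by linarith

/-- Sub-probability mixture coefficients. -/
structure IsMixture (ζ c : ℕ → ℝ) : Prop where
  root_neg : ∀ k, ζ k < 0
  nonneg : ∀ k, 0 ≤ c k
  summable : Summable c
  tsum_le : ∑' k, c k ≤ 1
  tendsto_root : Filter.Tendsto ζ Filter.atTop Filter.atBot

/-- The Laplace transform `1 - ∑ c k z / (z - ζ k)` of a mixture of an atom at zero and of
exponential laws with rates `-ζ k`. -/
def mixtureTransform (ζ c : ℕ → ℝ) (z : ℂ) : ℂ := 1 - ∑' k, (c k : ℂ) * (z / (z - ζ k))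

theorem Interlaced.isMixture {p ζ c : ℕ → ℝ} (h : Interlaced p ζ)
    (hc : ∀ k, Filter.Tendsto (fun N => partialCoeff p ζ N k) Filter.atTop (nhds (c k))) :
    IsMixture ζ c := by
  have h0 : ∀ k, 0 ≤ c k := fun k =>
    ge_of_tendsto' (hc k) fun N => (h.partialCoeff_pos N k).le
  have h1 : ∀ K, ∑ k ∈ Finset.range K, c k ≤ 1 := fun K => by
    refine le_of_tendsto (tendsto_finsetSum _ fun k _ => hc k) ?_
    filter_upwards [Filter.eventually_ge_atTop K] with N hN
    rw [← h.sum_partialCoeff N]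
    exact Finset.sum_le_sum_of_subset_of_nonneg (Finset.range_mono (by omega))
      fun k _ _ => (h.partialCoeff_pos N k).le
  exact ⟨h.root_neg, h0, summable_of_sum_range_le h0 h1, Real.tsum_le_of_sum_range_le h0 h1,
    h.tendsto_root⟩

theorem Interlaced.tendsto_rationalApprox {p ζ c : ℕ → ℝ} (h : Interlaced p ζ)
    (hc : ∀ k, Filter.Tendsto (fun N => partialCoeff p ζ N k) Filter.atTop (nhds (c k)))
    {z : ℂ} (hz : ∀ k, z ≠ ζ k) :
    Filter.Tendsto (fun N => rationalApprox p ζ N z) Filter.atTop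
      (nhds (mixtureTransform ζ c z)) := by
  have hm := h.isMixture hc
  have hx : Filter.Tendsto (fun k => z / (z - ζ k)) Filter.atTop (nhds 0) := by
    rw [tendsto_zero_iff_norm_tendsto_zero]
    simp only [norm_div]
    refine Filter.Tendsto.div_atTop tendsto_const_nhds ?_
    have h1 : Filter.Tendsto (fun k => -ζ k - ‖z‖) Filter.atTop Filter.atTop :=
      Filter.tendsto_atTop_add_const_right _ _ (Filter.tendsto_neg_atBot_atTop.comp h.tendsto_root)
    refine Filter.tendsto_atTop_mono (fun k => ?_) h1
    have := norm_sub_norm_le (ζ k : ℂ) z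
    rw [Complex.norm_real, Real.norm_of_nonpos (h.root_neg k).le, norm_sub_rev] at this
    exact this
  have h2 := tendsto_sum_mul_of_tendsto_zero (fun N k => (h.partialCoeff_pos N k).le)
    h.sum_partialCoeff hm.nonneg (fun K => (hm.summable.sum_le_tsum _ fun k _ => hm.nonneg k).trans
      hm.tsum_le) hc hx
  refine (h2.const_sub 1).congr fun N => ?_
  rw [h.rationalApprox_eq_sum N z fun k _ => hz k]
  have h1 : (1 : ℂ) = ∑ k ∈ Finset.range (N + 1), (partialCoeff p ζ N k : ℂ) := by
    exact_mod_cast (h.sum_partialCoeff N).symm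
  nth_rewrite 1 [h1]
  rw [← Finset.sum_sub_distrib]
  refine Finset.sum_congr rfl fun k _ => ?_
  have e1 : (ζ k : ℂ) ≠ 0 := by exact_mod_cast (h.root_neg k).ne
  have e2 : z - ζ k ≠ 0 := sub_ne_zero.2 (hz k)
  have e3 : (ζ k : ℂ) - z ≠ 0 := sub_ne_zero.2 (hz k).symm
  rw [one_sub_div e1]
  field_simp
  ring

theorem Interlaced.mixtureTransform_neg_pole {p ζ c : ℕ → ℝ} (h : Interlaced p ζ)
    (hc : ∀ k, Filter.Tendsto (fun N => partialCoeff p ζ N k) Filter.atTop (nhds (c k))) (m : ℕ) :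
    mixtureTransform ζ c ((-p m : ℝ) : ℂ) = 0 := by
  have hz : ∀ k, ((-p m : ℝ) : ℂ) ≠ ζ k := fun k => by
    rcases lt_or_ge m k with hk | hk
    · exact_mod_cast (h.root_lt_neg_pole hk).ne'
    · exact_mod_cast (h.neg_pole_lt_root hk).ne
  refine tendsto_nhds_unique (h.tendsto_rationalApprox hc hz)
    (tendsto_const_nhds.congr' ?_)
  filter_upwards [Filter.eventually_gt_atTop m] with N hN
  rw [rationalApprox, Finset.prod_eq_zero (Finset.mem_range.2 hN), zero_div]
  have : (p m : ℂ) ≠ 0 := by exact_mod_cast (h.pole_pos m).ne'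
  push_cast
  field_simp
  ring

theorem Interlaced.mixtureTransform_re_nonpos {p ζ c : ℕ → ℝ} (h : Interlaced p ζ)
    (hc : ∀ k, Filter.Tendsto (fun N => partialCoeff p ζ N k) Filter.atTop (nhds (c k))) {n : ℕ}
    {x : ℝ} (hx : -p n < x) (hx' : x < ζ n) : (mixtureTransform ζ c x).re ≤ 0 := by
  have hz : ∀ k, (x : ℂ) ≠ ζ k := fun k => by
    rcases lt_or_ge n k with hk | hk
    · exact_mod_cast ((h.root_lt_neg_pole hk).trans hx).ne'
    · exact_mod_cast (hx'.trans_le (h.root_strictAnti.antitone hk)).ne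
  refine le_of_tendsto ((Complex.continuous_re.tendsto _).comp
    (h.tendsto_rationalApprox hc hz)) (Filter.Eventually.of_forall fun N => ?_)
  have he : rationalApprox p ζ N x = (((∏ m ∈ Finset.range N,
      (1 + x / p m) / (1 - x / ζ (m + 1))) / (1 - x / ζ 0) : ℝ) : ℂ) := by
    rw [rationalApprox, Finset.prod_range_succ', Finset.prod_div_distrib, div_div]
    push_cast
    rfl
  rw [Function.comp_apply, he, Complex.ofReal_re]
  refine div_nonpos_of_nonneg_of_nonpos (Finset.prod_nonneg fun m _ => ?_)
    (h.one_sub_div_root_neg (hx'.trans_le (h.root_strictAnti.antitone n.zero_le))).le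
  rcases lt_or_ge m n with hm | hm
  · exact div_nonneg_of_nonpos (h.one_add_div_pole_neg (hx'.trans (h.root_lt_neg_pole hm))).le
      (h.one_sub_div_root_neg (hx'.trans_le (h.root_strictAnti.antitone hm))).le
  · exact div_nonneg (h.one_add_div_pole_pos
      ((neg_le_neg (h.pole_strictMono.monotone hm)).trans_lt hx)).le
      (h.one_sub_div_root_pos ((h.root_lt_neg_pole (by omega)).trans hx)).le

theorem exists_separation_of_tendsto_atBot {ζ : ℕ → ℝ}
    (h : Filter.Tendsto ζ Filter.atTop Filter.atBot) (z : ℂ) :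
    ∃ δ > 0, ∀ k, z ≠ ζ k → 2 * δ ≤ ‖z - ζ k‖ := by
  obtain ⟨K, hK⟩ := Filter.eventually_atTop.1
    (h.eventually (Filter.eventually_le_atBot (-(‖z‖ + 1))))
  have hfin : ∀ K : ℕ, ∃ δ > 0, ∀ k < K, z ≠ ζ k → δ ≤ ‖z - ζ k‖ := by
    intro K
    induction K with
    | zero => exact ⟨1, one_pos, fun k hk => absurd hk (Nat.not_lt_zero k)⟩
    | succ K ih =>
      obtain ⟨δ, hδ, hδ'⟩ := ih
      by_cases hzK : z = ζ K
      · refine ⟨δ, hδ, fun k hk hz => ?_⟩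
        rcases Nat.lt_succ_iff_lt_or_eq.1 hk with hk | rfl
        · exact hδ' k hk hz
        · exact absurd hzK hz
      · refine ⟨min δ ‖z - ζ K‖, lt_min hδ (norm_pos_iff.2 (sub_ne_zero.2 hzK)), fun k hk hz => ?_⟩
        rcases Nat.lt_succ_iff_lt_or_eq.1 hk with hk | rfl
        · exact (min_le_left _ _).trans (hδ' k hk hz)
        · exact min_le_right _ _
  obtain ⟨δ, hδ, hδ'⟩ := hfin K
  refine ⟨min δ 1 / 2, by positivity, fun k hz => ?_⟩
  rw [mul_div_cancel₀ _ two_ne_zero]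
  rcases lt_or_ge k K with hk | hk
  · exact (min_le_left _ _).trans (hδ' k hk hz)
  · refine (min_le_right _ _).trans ?_
    have h1 := norm_sub_norm_le (ζ k : ℂ) z
    rw [Complex.norm_real, Real.norm_eq_abs, norm_sub_rev] at h1
    linarith [hK k hk, neg_le_abs (ζ k)]

namespace IsMixture

variable {ζ c : ℕ → ℝ}

theorem summable_of_norm_le (h : IsMixture ζ c) {x : ℕ → ℂ} {B : ℝ} (hB : ∀ k, ‖x k‖ ≤ B) :
    Summable fun k => (c k : ℂ) * x k :=
  Summable.of_norm_bounded (h.summable.mul_right B) fun k => by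
    rw [norm_mul, Complex.norm_real, Real.norm_of_nonneg (h.nonneg k)]
    exact mul_le_mul_of_nonneg_left (hB k) (h.nonneg k)

theorem norm_tsum_le (h : IsMixture ζ c) {x : ℕ → ℂ} {B : ℝ} (hB : ∀ k, ‖x k‖ ≤ B) :
    ‖∑' k, (c k : ℂ) * x k‖ ≤ (∑' k, c k) * B := by
  rw [← tsum_mul_right]
  refine tsum_of_norm_bounded (h.summable.mul_right B).hasSum fun k => ?_
  rw [norm_mul, Complex.norm_real, Real.norm_of_nonneg (h.nonneg k)]
  exact mul_le_mul_of_nonneg_left (hB k) (h.nonneg k)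

theorem differentiableAt_mixtureTransform (h : IsMixture ζ c) {z : ℂ} (hz : ∀ k, z ≠ ζ k) :
    DifferentiableAt ℂ (mixtureTransform ζ c) z := by
  obtain ⟨δ, hδ, hsep⟩ := exists_separation_of_tendsto_atBot h.tendsto_root z
  have hfar : ∀ w ∈ Metric.ball z δ, ∀ k, δ ≤ ‖w - ζ k‖ := fun w hw k => by
    have h1 := hsep k (hz k)
    have h2 := norm_sub_le_norm_sub_add_norm_sub z w (ζ k : ℂ)
    rw [Metric.mem_ball, dist_eq_norm, norm_sub_rev] at hw
    linarith
  have hd : DifferentiableOn ℂ (fun w => ∑' k, (c k : ℂ) * (w / (w - ζ k))) (Metric.ball z δ) := by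
    refine Complex.differentiableOn_tsum_of_summable_norm
      (h.summable.mul_right ((‖z‖ + δ) / δ)) (fun k w hw => ?_) Metric.isOpen_ball fun k w hw => ?_
    · have : w - ζ k ≠ 0 := norm_pos_iff.1 (hδ.trans_le (hfar w hw k))
      have hd : DifferentiableAt ℂ (fun w => (c k : ℂ) * (w / (w - ζ k))) w := by
        fun_prop (disch := exact this)
      exact hd.differentiableWithinAt
    · rw [norm_mul, Complex.norm_real, Real.norm_of_nonneg (h.nonneg k), norm_div]
      refine mul_le_mul_of_nonneg_left (div_le_div₀ (by positivity) ?_ hδ (hfar w hw k))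
        (h.nonneg k)
      rw [Metric.mem_ball, dist_eq_norm] at hw
      linarith [norm_le_norm_add_norm_sub' w z]
  exact (hd.differentiableAt (Metric.ball_mem_nhds z hδ)).const_sub 1

theorem exists_norm_sub_root_mul_le (h : IsMixture ζ c) (n : ℕ) :
    ∃ C, ∀ᶠ w : ℂ in nhdsWithin (ζ n : ℂ) {(ζ n : ℂ)}ᶜ,
      ‖w - ζ n‖ * ‖mixtureTransform ζ c w‖ ≤ C := by
  obtain ⟨δ, hδ, hsep⟩ := exists_separation_of_tendsto_atBot h.tendsto_root (ζ n)
  refine ⟨δ + (‖(ζ n : ℂ)‖ + δ), ?_⟩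
  filter_upwards [nhdsWithin_le_nhds (Metric.ball_mem_nhds (ζ n : ℂ) hδ), self_mem_nhdsWithin]
    with w hw hwn
  rw [Metric.mem_ball, dist_eq_norm] at hw
  have hwn' : 0 < ‖w - ζ n‖ := norm_pos_iff.2 (sub_ne_zero.2 hwn)
  have hw' : ‖w‖ ≤ ‖(ζ n : ℂ)‖ + δ := by linarith [norm_le_norm_add_norm_sub' w (ζ n : ℂ)]
  have hle : ∀ k, ‖w - ζ n‖ ≤ ‖w - ζ k‖ := fun k => by
    by_cases hk : (ζ n : ℂ) = ζ k
    · rw [hk]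
    · have h1 := hsep k hk
      have h2 := norm_sub_le_norm_sub_add_norm_sub (ζ n : ℂ) w (ζ k : ℂ)
      rw [norm_sub_rev] at hw
      rw [norm_sub_rev]
      linarith
  have hb := h.norm_tsum_le (x := fun k => w / (w - ζ k)) (B := ‖w‖ / ‖w - ζ n‖) fun k => by
    rw [norm_div]
    exact div_le_div_of_nonneg_left (norm_nonneg _) hwn' (hle k)
  have hb' : ‖mixtureTransform ζ c w‖ ≤ 1 + ‖w‖ / ‖w - ζ n‖ := by
    refine (norm_sub_le _ _).trans ?_
    rw [norm_one]
    refine add_le_add le_rfl (hb.trans ?_)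
    exact mul_le_of_le_one_left (by positivity) h.tsum_le
  calc _ ≤ ‖w - ζ n‖ * (1 + ‖w‖ / ‖w - ζ n‖) := mul_le_mul_of_nonneg_left hb' hwn'.le
    _ = ‖w - ζ n‖ + ‖w‖ := by field_simp
    _ ≤ _ := add_le_add hw.le hw'

theorem mixtureTransform_eq (h : IsMixture ζ c) {z : ℂ} (hz : ∀ k, z ≠ ζ k) :
    mixtureTransform ζ c z =
      ((1 - ∑' k, c k : ℝ) : ℂ) + ∑' k, (c k : ℂ) * (-ζ k / (z - ζ k)) := by
  obtain ⟨δ, hδ, hsep⟩ := exists_separation_of_tendsto_atBot h.tendsto_root z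
  have hs : Summable fun k => (c k : ℂ) * (z / (z - ζ k)) :=
    h.summable_of_norm_le (B := ‖z‖ / (2 * δ)) fun k => by
      rw [norm_div]
      exact div_le_div_of_nonneg_left (norm_nonneg _) (by positivity) (hsep k (hz k))
  have hs' : Summable fun k => (c k : ℂ) := Complex.summable_ofReal.2 h.summable
  have he : (fun k => (c k : ℂ) * (-ζ k / (z - ζ k))) =
      fun k => (c k : ℂ) - (c k : ℂ) * (z / (z - ζ k)) := by
    funext k
    have := sub_ne_zero.2 (hz k)
    field_simp
    ring
  rw [he, hs'.tsum_sub hs, mixtureTransform]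
  push_cast
  ring

theorem norm_mixtureTransform_le_one (h : IsMixture ζ c) {z : ℂ} (hz : 0 ≤ z.re) :
    ‖mixtureTransform ζ c z‖ ≤ 1 := by
  have hre : ∀ k, (-ζ k) ≤ ‖z - ζ k‖ := fun k => by
    have := Complex.re_le_norm (z - ζ k)
    rw [Complex.sub_re, Complex.ofReal_re] at this
    linarith
  have hne : ∀ k, z ≠ ζ k := fun k => sub_ne_zero.1
    (norm_pos_iff.1 ((neg_pos.2 (h.root_neg k)).trans_le (hre k)))
  rw [h.mixtureTransform_eq hne]
  have hb := h.norm_tsum_le (x := fun k => -ζ k / (z - ζ k)) (B := 1) fun k => by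
    rw [norm_div, norm_neg, Complex.norm_real, Real.norm_of_nonpos (h.root_neg k).le]
    exact div_le_one_of_le₀ (hre k) (norm_nonneg _)
  refine (norm_add_le _ _).trans ?_
  rw [Complex.norm_real, Real.norm_of_nonneg (sub_nonneg.2 h.tsum_le)]
  linarith

theorem norm_mixtureTransform_mul_abs_im_le (h : IsMixture ζ c) (z : ℂ) :
    ‖mixtureTransform ζ c z‖ * |z.im| ≤ ‖z‖ := by
  rcases eq_or_ne z.im 0 with h0 | h0
  · simp [h0]
  have hy : 0 < |z.im| := abs_pos.2 h0
  have hne : ∀ k, z ≠ ζ k := fun k hk => h0 (by rw [hk, Complex.ofReal_im])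
  have hkey : ∀ k, ‖(-ζ k / (z - ζ k) : ℂ)‖ ≤ ‖z‖ / |z.im| := fun k => by
    rw [norm_div, norm_neg, div_le_div_iff₀ (norm_pos_iff.2 (sub_ne_zero.2 (hne k))) hy]
    have h1 := Complex.abs_im_le_norm (z * (starRingEnd ℂ) (z - ζ k))
    rw [norm_mul, RCLike.norm_conj] at h1
    refine le_trans (le_of_eq ?_) h1
    rw [Complex.norm_real, Real.norm_eq_abs, ← abs_mul, ← abs_neg]
    congr 1
    simp [Complex.mul_im]
    ring
  have hz1 : 1 ≤ ‖z‖ / |z.im| := (one_le_div hy).2 (Complex.abs_im_le_norm z)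
  rw [← le_div_iff₀ hy, h.mixtureTransform_eq hne]
  refine (norm_add_le _ _).trans ?_
  rw [Complex.norm_real, Real.norm_of_nonneg (sub_nonneg.2 h.tsum_le)]
  have hb := h.norm_tsum_le hkey
  have h1 := h.tsum_le
  nlinarith

theorem mixtureTransform_im (ζ c : ℕ → ℝ) (x : ℝ) : (mixtureTransform ζ c x).im = 0 := by
  have : mixtureTransform ζ c x = ((1 - ∑' k, c k * (x / (x - ζ k)) : ℝ) : ℂ) := by
    simp [mixtureTransform, Complex.ofReal_tsum]
  rw [this, Complex.ofReal_im]

theorem mixtureTransform_re_nonneg (h : IsMixture ζ c) {x : ℝ} (hx : 0 ≤ x) :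
    0 ≤ (mixtureTransform ζ c x).re := by
  have hne : ∀ k, (x : ℂ) ≠ ζ k := fun k => by
    exact_mod_cast ((h.root_neg k).trans_le hx).ne'
  have : mixtureTransform ζ c x =
      ((1 - ∑' k, c k + ∑' k, c k * (-ζ k / (x - ζ k)) : ℝ) : ℂ) := by
    rw [h.mixtureTransform_eq hne]
    simp [Complex.ofReal_tsum]
  rw [this, Complex.ofReal_re]
  refine add_nonneg (sub_nonneg.2 h.tsum_le) (tsum_nonneg fun k => ?_)
  have := h.root_neg k
  exact mul_nonneg (h.nonneg k) (div_nonneg (by linarith) (by linarith))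

end IsMixture

theorem mixtureTransform_zero (ζ c : ℕ → ℝ) : mixtureTransform ζ c 0 = 1 := by
  simp [mixtureTransform]

namespace IsMixture

variable {ζ c : ℕ → ℝ}

theorem density_nonneg (h : IsMixture ζ c) (k : ℕ) (x : ℝ) :
    0 ≤ -(c k * ζ k * Real.exp (ζ k * x)) := by
  have := mul_nonneg (mul_nonneg (h.nonneg k) (neg_nonneg.2 (h.root_neg k).le))
    (Real.exp_pos (ζ k * x)).le
  linarith

theorem summable_density (h : IsMixture ζ c) {x : ℝ} (hx : 0 < x) :
    Summable fun k => -(c k * ζ k * Real.exp (ζ k * x)) := by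
  refine Summable.of_nonneg_of_le (fun k => h.density_nonneg k x) (fun k => ?_)
    (h.summable.mul_right (1 / x))
  have h1 := Real.add_one_le_exp (-(ζ k * x))
  have h2 : -(ζ k * x) * Real.exp (ζ k * x) ≤ 1 := by
    calc _ ≤ Real.exp (-(ζ k * x)) * Real.exp (ζ k * x) :=
          mul_le_mul_of_nonneg_right (by linarith) (Real.exp_pos _).le
      _ = 1 := by rw [← Real.exp_add]; simp
  have h3 : -(ζ k) * Real.exp (ζ k * x) ≤ 1 / x := by
    rw [le_div_iff₀ hx]
    linarith
  have := mul_le_mul_of_nonneg_left h3 (h.nonneg k)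
  linarith

/-- The density of the absolutely continuous part of the mixture, as a sequence of summands. -/
def densityTerm (ζ c : ℕ → ℝ) (k : ℕ) (x : ℝ) : ENNReal :=
  ENNReal.ofReal (-(c k * ζ k * Real.exp (ζ k * x)))

theorem measurable_densityTerm (ζ c : ℕ → ℝ) (k : ℕ) : Measurable (densityTerm ζ c k) := by
  unfold densityTerm
  fun_prop

theorem tsum_densityTerm (h : IsMixture ζ c) {x : ℝ} (hx : 0 < x) :
    (∑' k, densityTerm ζ c k) x =
      ENNReal.ofReal (-(∑' k, c k * ζ k * Real.exp (ζ k * x))) := by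
  rw [ENNReal.tsum_apply, ← tsum_neg, ENNReal.ofReal_tsum_of_nonneg (fun k => h.density_nonneg k x)
    (h.summable_density hx)]
  rfl

theorem measurable_tsum_densityTerm (ζ c : ℕ → ℝ) : Measurable (∑' k, densityTerm ζ c k) := by
  have : (∑' k, densityTerm ζ c k) = fun x => ∑' k, densityTerm ζ c k x := by
    funext x
    rw [ENNReal.tsum_apply]
  rw [this]
  exact Measurable.tsum fun k => measurable_densityTerm ζ c k

theorem lintegral_densityTerm (h : IsMixture ζ c) (k : ℕ) :
    ∫⁻ x in Ioi 0, densityTerm ζ c k x = ENNReal.ofReal (c k) := by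
  unfold densityTerm
  rw [← ofReal_integral_eq_lintegral_ofReal]
  · congr 1
    rw [integral_neg, integral_const_mul, integral_exp_mul_Ioi (h.root_neg k)]
    have := (h.root_neg k).ne
    simp
    field_simp
  · exact ((integrableOn_exp_mul_Ioi (h.root_neg k) 0).const_mul _).neg
  · exact Filter.Eventually.of_forall fun x => h.density_nonneg k x

theorem lintegral_tsum_densityTerm_ne_top (h : IsMixture ζ c) :
    ∫⁻ x in Ioi 0, (∑' k, densityTerm ζ c k) x ≠ ⊤ := by
  simp_rw [ENNReal.tsum_apply]
  rw [lintegral_tsum fun k => (measurable_densityTerm ζ c k).aemeasurable]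
  simp_rw [h.lintegral_densityTerm]
  rw [← ENNReal.ofReal_tsum_of_nonneg h.nonneg h.summable]
  exact ENNReal.ofReal_ne_top

/-- The mixture of an atom at zero and of exponential laws. -/
def mixtureMeasure (ζ c : ℕ → ℝ) : Measure ℝ :=
  ENNReal.ofReal (1 - ∑' k, c k) • Measure.dirac 0 +
    (volume.restrict (Ioi 0)).withDensity (∑' k, densityTerm ζ c k)

theorem isFiniteMeasure_withDensity (h : IsMixture ζ c) :
    IsFiniteMeasure ((volume.restrict (Ioi 0)).withDensity (∑' k, densityTerm ζ c k)) :=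
  MeasureTheory.isFiniteMeasure_withDensity h.lintegral_tsum_densityTerm_ne_top

theorem isFiniteMeasure_mixtureMeasure (h : IsMixture ζ c) :
    IsFiniteMeasure (mixtureMeasure ζ c) := by
  have := h.isFiniteMeasure_withDensity
  have : IsFiniteMeasure (ENNReal.ofReal (1 - ∑' k, c k) • Measure.dirac (0 : ℝ)) :=
    Measure.smul_finite _ ENNReal.ofReal_ne_top
  unfold mixtureMeasure
  infer_instance

theorem mixtureMeasure_apply (h : IsMixture ζ c) {A : Set ℝ} (hA : MeasurableSet A)
    (hA0 : A ⊆ Ioi 0) : mixtureMeasure ζ c A =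
      ENNReal.ofReal (∫ x in A, -(∑' k, c k * ζ k * Real.exp (ζ k * x))) := by
  have h0 : (0 : ℝ) ∉ A := fun h' => lt_irrefl (0 : ℝ) (hA0 h')
  have h1 : mixtureMeasure ζ c A = ∫⁻ x in A, (∑' k, densityTerm ζ c k) x := by
    rw [mixtureMeasure, Measure.add_apply, Measure.smul_apply, Measure.dirac_apply' _ hA,
      withDensity_apply _ hA, Measure.restrict_restrict hA, inter_eq_self_of_subset_left hA0]
    simp [h0]
  have hfin : ∫⁻ x in A, (∑' k, densityTerm ζ c k) x ≠ ⊤ :=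
    ne_top_of_le_ne_top h.lintegral_tsum_densityTerm_ne_top (lintegral_mono_set hA0)
  have h2 : ∫ x in A, -(∑' k, c k * ζ k * Real.exp (ζ k * x)) =
      ∫ x in A, ((∑' k, densityTerm ζ c k) x).toReal := by
    refine setIntegral_congr_fun hA fun x hx => ?_
    have hx0 : 0 < x := hA0 hx
    rw [h.tsum_densityTerm hx0, ENNReal.toReal_ofReal]
    rw [← tsum_neg]
    exact tsum_nonneg fun k => h.density_nonneg k x
  rw [h1, h2, integral_toReal (measurable_tsum_densityTerm ζ c).aemeasurable
    (ae_lt_top (measurable_tsum_densityTerm ζ c) hfin), ENNReal.ofReal_toReal hfin]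

theorem charFun_mixtureMeasure (h : IsMixture ζ c) (θ : ℝ) :
    charFun (mixtureMeasure ζ c) θ = mixtureTransform ζ c (-(Complex.I * θ)) := by
  have hne : ∀ k, -(Complex.I * θ) ≠ (ζ k : ℂ) := fun k hk => by
    have := congrArg Complex.re hk
    simp at this
    exact (h.root_neg k).ne this.symm
  have := h.isFiniteMeasure_withDensity
  have h_int : ∀ (μ : Measure ℝ) [IsFiniteMeasure μ],
      Integrable (fun x : ℝ => Complex.exp (θ * x * Complex.I)) μ := fun μ _ => by
    refine Integrable.of_bound (by fun_prop) 1 (Filter.Eventually.of_forall fun x => ?_)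
    rw [← Complex.ofReal_mul, Complex.norm_exp_ofReal_mul_I]
  have hdir : IsFiniteMeasure (ENNReal.ofReal (1 - ∑' k, c k) • Measure.dirac (0 : ℝ)) :=
    Measure.smul_finite _ ENNReal.ofReal_ne_top
  rw [h.mixtureTransform_eq hne, charFun_apply_real, mixtureMeasure,
    integral_add_measure (h_int _) (h_int _), integral_smul_measure, integral_dirac]
  congr 1
  · rw [ENNReal.toReal_ofReal (sub_nonneg.2 h.tsum_le)]
    simp
  · have hi := h_int ((volume.restrict (Ioi 0)).withDensity (∑' k, densityTerm ζ c k))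
    rw [withDensity_tsum (measurable_densityTerm ζ c)] at hi ⊢
    rw [← (hasSum_integral_measure hi).tsum_eq]
    refine tsum_congr fun k => ?_
    rw [integral_withDensity_eq_integral_toReal_smul (measurable_densityTerm ζ c k)
      (Filter.Eventually.of_forall fun x => ENNReal.ofReal_lt_top)]
    have hre : ((ζ k : ℂ) + Complex.I * θ).re < 0 := by simpa using h.root_neg k
    have he : ∀ x : ℝ, (densityTerm ζ c k x).toReal • Complex.exp (θ * x * Complex.I) =
        (-(c k * ζ k) : ℂ) * Complex.exp ((ζ k + Complex.I * θ) * x) := fun x => by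
      rw [densityTerm, ENNReal.toReal_ofReal (h.density_nonneg k x), Complex.real_smul, add_mul,
        Complex.exp_add]
      push_cast
      rw [show (θ : ℂ) * x * Complex.I = Complex.I * θ * x by ring]
      ring
    simp_rw [he]
    rw [integral_const_mul, integral_exp_mul_complex_Ioi hre]
    have h1 : (ζ k : ℂ) + Complex.I * θ ≠ 0 := fun h0 => by rw [h0] at hre; simp at hre
    have h2 : -(Complex.I * θ) - (ζ k : ℂ) = -(ζ k + Complex.I * θ) := by ring
    rw [h2, Complex.ofReal_zero, mul_zero, Complex.exp_zero]
    field_simp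

/-- A finite measure is determined on `(0, ∞)` by its transform on the imaginary axis. -/
theorem measure_apply_of_charFun_eq (h : IsMixture ζ c) {μ : Measure ℝ} [IsFiniteMeasure μ]
    (hμ : ∀ θ : ℝ, charFun μ θ = mixtureTransform ζ c (-(Complex.I * θ))) {A : Set ℝ}
    (hA : MeasurableSet A) (hA0 : A ⊆ Ioi 0) :
    μ A = ENNReal.ofReal (∫ x in A, -(∑' k, c k * ζ k * Real.exp (ζ k * x))) := by
  have := h.isFiniteMeasure_mixtureMeasure
  have : μ = mixtureMeasure ζ c := Measure.ext_of_charFun <| by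
    funext θ
    rw [hμ, h.charFun_mixtureMeasure]
  rw [this, h.mixtureMeasure_apply hA hA0]

end IsMixture

theorem eventually_ne_of_tendsto_atBot {x : ℕ → ℝ}
    (hx : Filter.Tendsto x Filter.atTop Filter.atBot) (z : ℂ) :
    ∀ᶠ w : ℂ in nhdsWithin z {z}ᶜ, ∀ k, w ≠ x k := by
  obtain ⟨δ, hδ, hsep⟩ := exists_separation_of_tendsto_atBot hx z
  filter_upwards [nhdsWithin_le_nhds (Metric.ball_mem_nhds z hδ), self_mem_nhdsWithin]
    with w hw hwz k hk
  subst hk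
  have h1 := hsep k (Ne.symm hwz)
  rw [Metric.mem_ball, dist_comm, dist_eq_norm] at hw
  linarith

/-- A dichotomy that bounds the slope of an entire function at the origin. -/
theorem exists_norm_dslope_le {G : ℂ → ℂ} (hG : Differentiable ℂ G) :
    ∃ B : ℝ, 0 ≤ B ∧ ∀ z, ‖dslope G 0 z‖ ≤ B ∨
      (1 ≤ ‖z‖ ∧ ‖dslope G 0 z‖ = ‖G z - G 0‖ / ‖z‖) := by
  have hd : Differentiable ℂ (dslope G 0) := by
    rw [← differentiableOn_univ, Complex.differentiableOn_dslope Filter.univ_mem]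
    exact hG.differentiableOn
  obtain ⟨B, hB⟩ := (isCompact_closedBall (0 : ℂ) 1).exists_bound_of_continuousOn
    hd.continuous.continuousOn
  refine ⟨max B 0, le_max_right _ _, fun z => ?_⟩
  rcases le_total ‖z‖ 1 with hz | hz
  · exact Or.inl ((hB z (by simpa using hz)).trans (le_max_left _ _))
  · refine Or.inr ⟨hz, ?_⟩
    have hz0 : z ≠ 0 := fun h => by simp [h] at hz; linarith
    rw [dslope_of_ne _ hz0, slope_def_field, norm_div, sub_zero]

theorem eq_affine_of_growth {G : ℂ → ℂ} (hG : Differentiable ℂ G) {C D : ℝ} {n : ℕ}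
    (hC : ∀ z, ‖G z‖ ≤ C * (1 + ‖z‖) ^ n)
    (hD : ∀ x : ℝ, 0 < x → ‖G x‖ ≤ D * (1 + x)) : ∃ b, ∀ z, G z = G 0 + z * b := by
  obtain ⟨B, hB0, hB⟩ := exists_norm_dslope_le hG
  have hd : Differentiable ℂ (dslope G 0) := by
    rw [← differentiableOn_univ, Complex.differentiableOn_dslope Filter.univ_mem]
    exact hG.differentiableOn
  have hC0 : 0 ≤ C := by simpa using (norm_nonneg _).trans (hC 0)
  have hD0 : 0 ≤ D := by
    have := (norm_nonneg _).trans (hD 1 one_pos)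
    linarith
  have hG0 : ‖G 0‖ ≤ C := by simpa using hC 0
  have hgrow : ∀ z, ‖dslope G 0 z‖ ≤ (B + 2 * C) * (1 + ‖z‖) ^ n := fun z => by
    have hp : 1 ≤ (1 + ‖z‖) ^ n := one_le_pow₀ (by linarith [norm_nonneg z])
    rcases hB z with h | ⟨h1, h2⟩
    · nlinarith
    · rw [h2]
      calc ‖G z - G 0‖ / ‖z‖ ≤ ‖G z - G 0‖ := div_le_self (norm_nonneg _) h1
        _ ≤ C * (1 + ‖z‖) ^ n + C := (norm_sub_le _ _).trans (add_le_add (hC z) hG0)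
        _ ≤ _ := by nlinarith
  have hpos : ∀ x : ℝ, 0 < x → ‖dslope G 0 x‖ ≤ B + (2 * D + C) := fun x hx => by
    rcases hB x with h | ⟨h1, h2⟩
    · linarith
    · rw [h2]
      rw [Complex.norm_real, Real.norm_of_nonneg hx.le] at h1 ⊢
      rw [div_le_iff₀ hx]
      calc ‖G x - G 0‖ ≤ D * (1 + x) + C := (norm_sub_le _ _).trans (add_le_add (hD x hx) hG0)
        _ ≤ _ := by nlinarith
  refine ⟨dslope G 0 0, fun z => ?_⟩
  rw [← eq_const_of_growth_of_bounded_on_pos n hd _ _ hgrow hpos z]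
  have := sub_smul_dslope G 0 z
  rw [sub_zero, smul_eq_mul] at this
  rw [this]
  ring

section WienerHopf

variable {q a σ c₁ c₂ α₁ α₂ β₁ β₂ lam₁ lam₂ : ℝ} {ζ c : ℕ → ℝ}

theorem exists_extension_mul_mixtureTransform
    (hc₁ : 0 < c₁) (hα₁ : 0 < α₁) (hα₂ : 0 < α₂) (hβ₁ : 0 < β₁) (hβ₂ : 0 < β₂)
    (hlam₁ : lam₁ ∈ Ioo (0 : ℝ) 3 ∧ lam₁ ≠ 1 ∧ lam₁ ≠ 2)
    (hζ : Interlaced (fun m => β₁ * (m + α₁)) ζ) (hmix : IsMixture ζ c)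
    (hzero : ∀ m : ℕ, mixtureTransform ζ c ((-(β₁ * (m + α₁)) : ℝ) : ℂ) = 0)
    (hroot : ∀ n, killedExponent q a σ c₁ c₂ α₁ α₂ β₁ β₂ lam₁ lam₂ (ζ n) = 0) :
    ∃ g : ℂ → ℂ, DifferentiableOn ℂ g {z | z.re < β₂ * α₂} ∧
      ∀ z : ℂ, (∀ k, z ≠ ζ k) → (∀ m : ℕ, z ≠ ((-(β₁ * (m + α₁)) : ℝ) : ℂ)) →
        g z = killedExponent q a σ c₁ c₂ α₁ α₂ β₁ β₂ lam₁ lam₂ z * mixtureTransform ζ c z := by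
  set f := killedExponent q a σ c₁ c₂ α₁ α₂ β₁ β₂ lam₁ lam₂ with hf
  have hne : ∀ n m : ℕ, ζ n ≠ -(β₁ * (m + α₁)) := fun n m => by
    rcases lt_or_ge m n with hk | hk
    · exact (hζ.root_lt_neg_pole hk).ne
    · exact (hζ.neg_pole_lt_root hk).ne'
  have hneg : Filter.Tendsto (fun m : ℕ => -(β₁ * (m + α₁))) Filter.atTop Filter.atBot :=
    Filter.tendsto_neg_atTop_atBot.comp hζ.tendsto
  set S : Set ℂ := {z : ℂ | (∃ k, z = ζ k) ∨ ∃ m : ℕ, z = ((-(β₁ * (m + α₁)) : ℝ) : ℂ)} with hS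
  have hsep : ∀ z ∈ {z : ℂ | z.re < β₂ * α₂}, ∀ᶠ w in nhdsWithin z {z}ᶜ, w ∉ S := by
    intro z _
    filter_upwards [eventually_ne_of_tendsto_atBot hmix.tendsto_root z,
      eventually_ne_of_tendsto_atBot hneg z] with w h1 h2
    rintro (⟨k, hk⟩ | ⟨m, hm⟩)
    · exact h1 k hk
    · exact h2 m hm
  have hdiff : ∀ z ∈ {z : ℂ | z.re < β₂ * α₂}, z ∉ S →
      DifferentiableAt ℂ (fun z => f z * mixtureTransform ζ c z) z := by
    intro z hz hzS
    have h1 : ∀ k, z ≠ ζ k := fun k hk => hzS (Or.inl ⟨k, hk⟩)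
    have h2 : ∀ m : ℕ, z ≠ ((-(β₁ * (m + α₁)) : ℝ) : ℂ) := fun m hm => hzS (Or.inr ⟨m, hm⟩)
    exact (differentiableAt_killedExponent hβ₁ hβ₂ hz h2).mul
      (hmix.differentiableAt_mixtureTransform h1)
  have hbdd : ∀ z ∈ {z : ℂ | z.re < β₂ * α₂}, z ∈ S →
      ∃ C : ℝ, ∀ᶠ w in nhdsWithin z {z}ᶜ, ‖f w * mixtureTransform ζ c w‖ ≤ C := by
    rintro z hz (⟨n, rfl⟩ | ⟨m, rfl⟩)
    · have hd : DifferentiableAt ℂ f (ζ n) := differentiableAt_killedExponent hβ₁ hβ₂ hz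
        fun m => by exact_mod_cast hne n m
      obtain ⟨C, hC⟩ := hd.isBigO_sub.bound
      obtain ⟨C', hC'⟩ := hmix.exists_norm_sub_root_mul_le n
      refine ⟨|C| * C', ?_⟩
      filter_upwards [nhdsWithin_le_nhds hC, hC'] with w h1 h2
      rw [hroot n, sub_zero] at h1
      rw [norm_mul]
      calc _ ≤ (|C| * ‖w - ζ n‖) * ‖mixtureTransform ζ c w‖ := by
            refine mul_le_mul_of_nonneg_right (h1.trans ?_) (norm_nonneg _)
            exact mul_le_mul_of_nonneg_right (le_abs_self C) (norm_nonneg _)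
        _ = |C| * (‖w - ζ n‖ * ‖mixtureTransform ζ c w‖) := by ring
        _ ≤ _ := mul_le_mul_of_nonneg_left h2 (abs_nonneg _)
    · have hd : DifferentiableAt ℂ (mixtureTransform ζ c) ((-(β₁ * (m + α₁)) : ℝ) : ℂ) :=
        hmix.differentiableAt_mixtureTransform fun k => by exact_mod_cast (hne k m).symm
      obtain ⟨C, hC⟩ := hd.isBigO_sub.bound
      obtain ⟨r, _, hr⟩ := exists_tendsto_mul_killedExponent (q := q) (a := a) (σ := σ) (c₂ := c₂)
        (lam₂ := lam₂) hc₁ hα₁ hα₂ hβ₁ hβ₂ hlam₁ m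
      have hr' := hr.norm.eventually (gt_mem_nhds (lt_add_one ‖(r : ℂ)‖))
      refine ⟨|C| * (‖(r : ℂ)‖ + 1), ?_⟩
      filter_upwards [nhdsWithin_le_nhds hC, hr'] with w h1 h2
      rw [hzero m, sub_zero] at h1
      rw [norm_mul] at h2 ⊢
      calc _ ≤ ‖f w‖ * (|C| * ‖w - ((-(β₁ * (m + α₁)) : ℝ) : ℂ)‖) := by
            refine mul_le_mul_of_nonneg_left (h1.trans ?_) (norm_nonneg _)
            exact mul_le_mul_of_nonneg_right (le_abs_self C) (norm_nonneg _)
        _ = |C| * (‖w - ((-(β₁ * (m + α₁)) : ℝ) : ℂ)‖ * ‖f w‖) := by ring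
        _ ≤ _ := mul_le_mul_of_nonneg_left h2.le (abs_nonneg _)
  obtain ⟨g, hg, hg'⟩ := exists_differentiableOn_of_bounded_near
    (isOpen_lt Complex.continuous_re continuous_const) hsep hdiff hbdd
  refine ⟨g, hg, fun z h1 h2 => hg' z ?_⟩
  rintro (⟨k, hk⟩ | ⟨m, hm⟩)
  · exact h1 k hk
  · exact h2 m hm

end WienerHopf

/-- A pair of functions with the analytic properties of the two Wiener–Hopf factors of
`q / f`, the first living on the right and the second on the left half-plane. -/
structure IsWienerHopfPair (q : ℝ) (f φ₁ φ₂ : ℂ → ℂ) : Prop where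
  continuousOn_right : ContinuousOn φ₁ {z | 0 ≤ z.re}
  continuousOn_left : ContinuousOn φ₂ {z | z.re ≤ 0}
  differentiableOn_right : DifferentiableOn ℂ φ₁ {z | 0 < z.re}
  differentiableOn_left : DifferentiableOn ℂ φ₂ {z | z.re < 0}
  norm_left_le : ∀ z : ℂ, z.re ≤ 0 → ‖φ₂ z‖ ≤ 1
  norm_right_ge : ∃ κ > 0, ∀ z : ℂ, 0 ≤ z.re → κ ≤ ‖φ₁ z‖ * (1 + ‖z‖)
  right_nonneg : ∀ x : ℝ, 0 ≤ x → 0 ≤ (φ₁ x).re ∧ (φ₁ x).im = 0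
  left_nonneg : ∀ x : ℝ, x ≤ 0 → 0 ≤ (φ₂ x).re ∧ (φ₂ x).im = 0
  right_zero : φ₁ 0 = 1
  mul_eq : ∀ z : ℂ, z.re = 0 → φ₁ z * φ₂ z * f z = q

section WienerHopf

variable {q a σ c₁ c₂ α₁ α₂ β₁ β₂ lam₁ lam₂ : ℝ} {ζ c : ℕ → ℝ} {φ₁ φ₂ : ℂ → ℂ}

theorem IsWienerHopfPair.eq_mixtureTransform (hq : 0 < q)
    (hc₁ : 0 < c₁) (hα₁ : 0 < α₁) (hα₂ : 0 < α₂) (hβ₁ : 0 < β₁) (hβ₂ : 0 < β₂)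
    (hlam₁ : lam₁ ∈ Ioo (0 : ℝ) 3 ∧ lam₁ ≠ 1 ∧ lam₁ ≠ 2)
    (hlam₂ : lam₂ ∈ Ioo (0 : ℝ) 3 ∧ lam₂ ≠ 1 ∧ lam₂ ≠ 2)
    (hζ : Interlaced (fun m => β₁ * (m + α₁)) ζ)
    (hc : ∀ k, Filter.Tendsto (fun N => partialCoeff (fun m => β₁ * (m + α₁)) ζ N k) Filter.atTop
      (nhds (c k)))
    (hroot : ∀ n, killedExponent q a σ c₁ c₂ α₁ α₂ β₁ β₂ lam₁ lam₂ (ζ n) = 0)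
    (h : IsWienerHopfPair q (killedExponent q a σ c₁ c₂ α₁ α₂ β₁ β₂ lam₁ lam₂) φ₁ φ₂)
    {z : ℂ} (hz : 0 ≤ z.re) : φ₁ z = mixtureTransform ζ c z := by
  classical
  have hmix := hζ.isMixture hc
  obtain ⟨g, hg, hgeq⟩ := exists_extension_mul_mixtureTransform hc₁ hα₁ hα₂ hβ₁ hβ₂ hlam₁ hζ hmix
    (fun m => hζ.mixtureTransform_neg_pole hc m) hroot
  obtain ⟨Cf, hCf0, hCf⟩ := norm_killedExponent_mul_abs_im_le (q := q) (a := a) (σ := σ)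
    (c₁ := c₁) (c₂ := c₂) (α₁ := α₁) hα₂ hβ₁ hβ₂ hlam₁ hlam₂
  obtain ⟨κ, hκ, hκ'⟩ := h.norm_right_ge
  set f := killedExponent q a σ c₁ c₂ α₁ α₂ β₁ β₂ lam₁ lam₂ with hf
  set ψ := mixtureTransform ζ c with hψ
  have hβα : 0 < β₂ * α₂ := mul_pos hβ₂ hα₂
  have hqC : (q : ℂ) ≠ 0 := by exact_mod_cast hq.ne'
  have hne1 : ∀ z : ℂ, 0 ≤ z.re → φ₁ z ≠ 0 := fun z hz h0 => by
    have := hκ' z hz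
    rw [h0, norm_zero, zero_mul] at this
    linarith
  have hroot_ne : ∀ z : ℂ, 0 ≤ z.re → ∀ k, z ≠ ζ k := fun z hz k hk => by
    rw [hk, Complex.ofReal_re] at hz
    linarith [hmix.root_neg k]
  have hpole_ne : ∀ z : ℂ, 0 ≤ z.re → ∀ m : ℕ, z ≠ ((-(β₁ * (m + α₁)) : ℝ) : ℂ) :=
    fun z hz m hm => by
      rw [hm, Complex.ofReal_re] at hz
      have := hζ.pole_pos m
      linarith
  set G : ℂ → ℂ := fun z => if 0 ≤ z.re then ψ z / φ₁ z else φ₂ z * g z / q with hG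
  have hGr : ∀ z : ℂ, 0 ≤ z.re → G z = ψ z / φ₁ z := fun z hz => if_pos hz
  have hGl : ∀ z : ℂ, z.re ≤ 0 → G z = φ₂ z * g z / q := fun z hz => by
    rcases hz.lt_or_eq with hlt | heq
    · exact if_neg (not_le.2 hlt)
    · rw [hGr z heq.ge, hgeq z (hroot_ne z heq.ge) (hpole_ne z heq.ge), div_eq_div_iff
        (hne1 z heq.ge) hqC, ← h.mul_eq z heq]
      ring
  have hψd : ∀ z : ℂ, 0 ≤ z.re → DifferentiableAt ℂ ψ z := fun z hz =>
    hmix.differentiableAt_mixtureTransform (hroot_ne z hz)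
  have hopenr : IsOpen {z : ℂ | 0 < z.re} := isOpen_lt continuous_const Complex.continuous_re
  have hopenl : IsOpen {z : ℂ | z.re < 0} := isOpen_lt Complex.continuous_re continuous_const
  have hGcont : Continuous G := by
    have h1 : ContinuousOn G {z | 0 ≤ z.re} :=
      ContinuousOn.congr (f := fun z => ψ z / φ₁ z)
        (ContinuousOn.div (fun z hz => (hψd z hz).continuousAt.continuousWithinAt)
          h.continuousOn_right fun z hz => hne1 z hz) fun z hz => hGr z hz
    have h2 : ContinuousOn G {z | z.re ≤ 0} :=
      ContinuousOn.congr (f := fun z => φ₂ z * g z / q)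
        ((h.continuousOn_left.mul (hg.continuousOn.mono fun z hz =>
          lt_of_le_of_lt hz hβα)).div_const _) fun z hz => hGl z hz
    have h3 := h1.union_of_isClosed h2 (isClosed_le continuous_const Complex.continuous_re)
      (isClosed_le Complex.continuous_re continuous_const)
    rw [← continuousOn_univ]
    convert h3 using 1
    refine (eq_univ_of_forall fun z : ℂ => ?_).symm
    exact le_total 0 z.re
  have hGd : Differentiable ℂ G := by
    refine differentiable_of_continuous_of_differentiableOn_halfPlanes hGcont ?_ ?_
    · exact DifferentiableOn.congr (f := fun z => φ₂ z * g z / q)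
        ((h.differentiableOn_left.mul (hg.mono fun z hz => lt_trans hz hβα)).div_const _)
        fun z hz => hGl z (le_of_lt hz)
    · exact DifferentiableOn.congr (f := fun z => ψ z / φ₁ z)
        (DifferentiableOn.div (fun z hz => (hψd z (le_of_lt hz)).differentiableWithinAt)
          h.differentiableOn_right fun z hz => hne1 z (le_of_lt hz)) fun z hz => hGr z (le_of_lt hz)
  have hGright : ∀ z : ℂ, 0 ≤ z.re → ‖G z‖ ≤ κ⁻¹ * (1 + ‖z‖) := fun z hz => by
    rw [hGr z hz, norm_div, div_le_iff₀ (norm_pos_iff.2 (hne1 z hz))]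
    have h1 := hmix.norm_mixtureTransform_le_one hz
    have h2 : 1 ≤ κ⁻¹ * (‖φ₁ z‖ * (1 + ‖z‖)) := by
      calc (1 : ℝ) = κ⁻¹ * κ := (inv_mul_cancel₀ hκ.ne').symm
        _ ≤ _ := mul_le_mul_of_nonneg_left (hκ' z hz) (by positivity)
    calc _ ≤ 1 := h1
      _ ≤ _ := h2
      _ = _ := by ring
  have hgrow : ∀ z : ℂ, ‖G z‖ * |z.im| ^ 2 ≤ (κ⁻¹ + Cf / q) * (1 + ‖z‖) ^ 4 := fun z => by
    have hy := Complex.abs_im_le_norm z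
    have hz0 := norm_nonneg z
    rcases le_or_gt 0 z.re with hz | hz
    · have h3 : |z.im| ^ 2 ≤ (1 + ‖z‖) ^ 2 :=
        pow_le_pow_left₀ (abs_nonneg _) (by linarith) 2
      calc _ ≤ (κ⁻¹ * (1 + ‖z‖)) * (1 + ‖z‖) ^ 2 :=
            mul_le_mul (hGright z hz) h3 (by positivity) (by positivity)
        _ = κ⁻¹ * (1 + ‖z‖) ^ 3 := by ring
        _ ≤ κ⁻¹ * (1 + ‖z‖) ^ 4 := by
            refine mul_le_mul_of_nonneg_left ?_ (by positivity)
            exact pow_le_pow_right₀ (by linarith) (by norm_num)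
        _ ≤ _ := mul_le_mul_of_nonneg_right (by linarith [div_nonneg hCf0 hq.le]) (by positivity)
    · rcases eq_or_ne z.im 0 with h0 | h0
      · rw [h0, abs_zero, zero_pow two_ne_zero, mul_zero]
        positivity
      · have hgz := hgeq z (fun k hk => h0 (by rw [hk, Complex.ofReal_im]))
          fun m hm => h0 (by rw [hm, Complex.ofReal_im])
        rw [hGl z hz.le, hgz, norm_div, norm_mul, norm_mul, Complex.norm_real,
          Real.norm_of_nonneg hq.le]
        have e1 := hCf z hz.le
        have e2 := hmix.norm_mixtureTransform_mul_abs_im_le z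
        calc ‖φ₂ z‖ * (‖f z‖ * ‖ψ z‖) / q * |z.im| ^ 2
            = ‖φ₂ z‖ * ((‖f z‖ * |z.im|) * (‖ψ z‖ * |z.im|)) / q := by ring
          _ ≤ 1 * ((Cf * (1 + ‖z‖) ^ 3) * (1 + ‖z‖)) / q := by
              refine div_le_div_of_nonneg_right ?_ hq.le
              refine mul_le_mul (h.norm_left_le z hz.le) ?_ (by positivity) zero_le_one
              exact mul_le_mul e1 (by linarith) (by positivity) (by positivity)
          _ = Cf / q * (1 + ‖z‖) ^ 4 := by ring
          _ ≤ _ := mul_le_mul_of_nonneg_right (by linarith [inv_pos.2 hκ]) (by positivity)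
  obtain ⟨C', hC'⟩ := growth_of_growth_div_im hGd _ 4 2 hgrow
  obtain ⟨b, hb⟩ := eq_affine_of_growth hGd hC' (D := κ⁻¹) fun x hx => by
    have := hGright x (by simpa using hx.le)
    rwa [Complex.norm_real, Real.norm_of_nonneg hx.le] at this
  have hG0 : G 0 = 1 := by
    rw [hGr 0 (by simp), h.right_zero, hψ, mixtureTransform_zero, div_one]
  rw [hG0] at hb
  have hbx : ∀ x : ℝ, 0 ≤ x → 0 ≤ 1 + x * b.re ∧ x * b.im = 0 := fun x hx => by
    have e1 := hb x
    have hx' : 0 ≤ (x : ℂ).re := by simpa using hx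
    have e2 := h.right_nonneg x hx
    have e3 := hmix.mixtureTransform_re_nonneg hx
    have e4 := IsMixture.mixtureTransform_im ζ c x
    have e5 : ψ x = ((ψ x).re : ℂ) := Complex.ext rfl (by simpa using e4)
    have e6 : φ₁ x = ((φ₁ x).re : ℂ) := Complex.ext rfl (by simpa using e2.2)
    rw [hGr x hx', e5, e6, ← Complex.ofReal_div] at e1
    have er := congrArg Complex.re e1
    have ei := congrArg Complex.im e1
    simp at er ei
    exact ⟨by rw [← er]; exact div_nonneg e3 e2.1, mul_eq_zero.2 ei⟩
  have hbim : b.im = 0 := by simpa using (hbx 1 zero_le_one).2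
  have hbre : 0 ≤ b.re := by
    by_contra hneg
    push Not at hneg
    have := (hbx (-2 / b.re) (div_nonneg_of_nonpos (by norm_num) hneg.le)).1
    rw [div_mul_cancel₀ _ hneg.ne] at this
    linarith
  have hb0 : b.re = 0 := by
    by_contra hb0
    have hpos : 0 < b.re := lt_of_le_of_ne hbre (Ne.symm hb0)
    obtain ⟨n, hn⟩ := (hζ.tendsto.eventually (Filter.eventually_gt_atTop (1 / b.re))).exists
    have hev := killedExponent_re_neg_right_of_pole (q := q) (a := a) (σ := σ) (c₂ := c₂)
      (lam₂ := lam₂) hc₁ hα₁ hα₂ hβ₁ hβ₂ hlam₁ n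
    have hev2 : ∀ᶠ x : ℝ in nhdsWithin (-(β₁ * (n + α₁))) (Ioi (-(β₁ * (n + α₁)))),
        x < min (ζ n) (-(1 / b.re)) := by
      refine nhdsWithin_le_nhds (gt_mem_nhds (lt_min (hζ.neg_pole_lt n) ?_))
      exact neg_lt_neg hn
    obtain ⟨x, hx1, hx2, hx3⟩ := (hev.and (hev2.and self_mem_nhdsWithin)).exists
    have hxζ : x < ζ n := hx2.trans_le (min_le_left _ _)
    have hxb : x < -(1 / b.re) := hx2.trans_le (min_le_right _ _)
    have hx0 : x < 0 := hxζ.trans (hmix.root_neg n)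
    have e1 := hb x
    have hr : ∀ k, (x : ℂ) ≠ ζ k := fun k => by
      rcases lt_or_ge n k with hk | hk
      · exact_mod_cast ((hζ.root_lt_neg_pole hk).trans hx3).ne'
      · exact_mod_cast (hxζ.trans_le (hζ.root_strictAnti.antitone hk)).ne
    have hp : ∀ m : ℕ, (x : ℂ) ≠ ((-(β₁ * (m + α₁)) : ℝ) : ℂ) := fun m => by
      rcases lt_or_ge m n with hk | hk
      · exact_mod_cast (hxζ.trans (hζ.root_lt_neg_pole hk)).ne
      · exact_mod_cast ((neg_le_neg (hζ.pole_strictMono.monotone hk)).trans_lt hx3).ne'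
    rw [hGl x (by simpa using hx0.le), hgeq x hr hp] at e1
    have e2 := h.left_nonneg x hx0.le
    have e3 := hζ.mixtureTransform_re_nonpos hc hx3 hxζ
    have e4 := IsMixture.mixtureTransform_im ζ c x
    have e5 : ψ x = ((ψ x).re : ℂ) := Complex.ext rfl (by simpa using e4)
    have e6 : φ₂ x = ((φ₂ x).re : ℂ) := Complex.ext rfl (by simpa using e2.2)
    rw [e5, e6] at e1
    have er := congrArg Complex.re e1
    have el : ((φ₂ x).re * (f x * (ψ x).re) / q : ℂ).re =
        (φ₂ x).re * ((f x).re * (ψ x).re) / q := by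
      rw [Complex.div_ofReal_re, Complex.re_ofReal_mul, Complex.re_mul_ofReal]
    rw [el] at er
    simp at er
    have hl : 0 ≤ (φ₂ x).re * ((f x).re * (ψ x).re) / q :=
      div_nonneg (mul_nonneg e2.1 (mul_nonneg_of_nonpos_of_nonpos hx1.le e3)) hq.le
    rw [er] at hl
    have : x * b.re < -1 := by
      have := mul_lt_mul_of_pos_right hxb hpos
      rwa [neg_mul, one_div, inv_mul_cancel₀ hpos.ne'] at this
    linarith
  have hbz : b = 0 := Complex.ext hb0 hbim
  have hfin := hb z
  rw [hGr z hz, hbz, mul_zero, add_zero, div_eq_one_iff_eq (hne1 z hz)] at hfin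
  exact hfin.symm

end WienerHopf

section Paths

variable {x : ℝ → ℝ} {h : ℕ → ℝ} {t T : ℝ}

theorem bddAbove_image_Icc_of_cadlag
    (hr : ∀ t : ℝ, 0 ≤ t → ContinuousWithinAt x (Ici t) t)
    (hl : ∀ t : ℝ, 0 < t → ∃ l : ℝ, Filter.Tendsto x (nhdsWithin t (Ico 0 t)) (nhds l)) (T : ℝ) :
    BddAbove (x '' Icc 0 T) := by
  refine isCompact_Icc.induction_on (p := fun s => BddAbove (x '' s)) (by simp)
    (fun s t hst ht => ht.mono (image_mono hst))
    (fun s t hs ht => by rw [image_union]; exact hs.union ht) fun t ht => ?_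
  have hl' : ∃ l, ∀ᶠ s in nhdsWithin t (Ico 0 t), x s ≤ l := by
    rcases ht.1.eq_or_lt with rfl | h0
    · exact ⟨0, by simp⟩
    · obtain ⟨l, hl⟩ := hl t h0
      exact ⟨l + 1, (hl.eventually (gt_mem_nhds (lt_add_one l))).mono fun s hs => hs.le⟩
  obtain ⟨l, hl'⟩ := hl'
  have hr' : ∀ᶠ s in nhdsWithin t (Ici t), x s ≤ x t + 1 :=
    ((hr t ht.1).eventually (gt_mem_nhds (lt_add_one (x t)))).mono fun s hs => hs.le
  refine ⟨{s | x s ≤ max l (x t + 1)}, ?_, max l (x t + 1), ?_⟩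
  · have hsub : Icc 0 T ⊆ Ico 0 t ∪ Ici t := fun s hs => by
      rcases lt_or_ge s t with h | h
      · exact Or.inl ⟨hs.1, h⟩
      · exact Or.inr h
    refine nhdsWithin_mono t hsub ?_
    rw [nhdsWithin_union]
    exact ⟨hl'.mono fun s hs => hs.trans (le_max_left _ _),
      hr'.mono fun s hs => hs.trans (le_max_right _ _)⟩
  · rintro _ ⟨s, hs, rfl⟩
    exact hs

theorem lt_floor_add_one_mul {h : ℝ} (hh : 0 < h) (t : ℝ) :
    t < (⌊t / h⌋₊ + 1 : ℕ) * h := by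
  push_cast
  rw [← div_lt_iff₀ hh]
  exact Nat.lt_floor_add_one _

theorem floor_mul_le {h : ℝ} (hh : 0 < h) (ht : 0 ≤ t) : (⌊t / h⌋₊ : ℝ) * h ≤ t := by
  rw [← le_div_iff₀ hh]
  exact Nat.floor_le (div_nonneg ht hh.le)

theorem tendsto_floor_add_one_mul (hpos : ∀ m, 0 < h m)
    (hlim : Filter.Tendsto h Filter.atTop (nhds 0)) (ht : 0 ≤ t) :
    Filter.Tendsto (fun m => ((⌊t / h m⌋₊ + 1 : ℕ) : ℝ) * h m) Filter.atTop
      (nhdsWithin t (Ici t)) := by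
  refine tendsto_nhdsWithin_of_tendsto_nhds_of_eventually_within _ ?_
    (Filter.Eventually.of_forall fun m => (lt_floor_add_one_mul (hpos m) t).le)
  have hlim' : Filter.Tendsto (fun m => t + h m) Filter.atTop (nhds t) := by
    simpa using hlim.const_add t
  refine tendsto_of_tendsto_of_tendsto_of_le_of_le tendsto_const_nhds hlim'
    (fun m => (lt_floor_add_one_mul (hpos m) t).le) fun m => ?_
  have := floor_mul_le (hpos m) ht
  push_cast
  linarith

theorem tendsto_partialSups_grid (hpos : ∀ m, 0 < h m)
    (hlim : Filter.Tendsto h Filter.atTop (nhds 0))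
    (hr : ∀ t : ℝ, 0 ≤ t → ContinuousWithinAt x (Ici t) t)
    (hb : BddAbove (x '' Icc 0 T)) (hT : 0 ≤ T) :
    Filter.Tendsto (fun m => partialSups (fun k : ℕ => x (k * h m)) (⌊T / h m⌋₊ + 1))
      Filter.atTop (nhds (sSup (x '' Icc 0 T))) := by
  have hne : (x '' Icc 0 T).Nonempty := ⟨x 0, 0, ⟨le_rfl, hT⟩, rfl⟩
  have hgrid : ∀ t, 0 ≤ t → Filter.Tendsto (fun m => x ((⌊t / h m⌋₊ + 1 : ℕ) * h m))
      Filter.atTop (nhds (x t)) := fun t ht =>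
    (hr t ht).tendsto.comp (tendsto_floor_add_one_mul hpos hlim ht)
  refine tendsto_order.2 ⟨fun b hb' => ?_, fun b hb' => ?_⟩
  · obtain ⟨_, ⟨t, ht, rfl⟩, htb⟩ := exists_lt_of_lt_csSup hne hb'
    filter_upwards [(hgrid t ht.1).eventually (lt_mem_nhds htb)] with m hm
    refine hm.trans_le (le_partialSups_of_le (fun k : ℕ => x (k * h m)) ?_)
    gcongr
    · exact (hpos m).le
    · exact ht.2
  · have hxT : x T ≤ sSup (x '' Icc 0 T) := le_csSup hb ⟨T, ⟨hT, le_rfl⟩, rfl⟩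
    filter_upwards [(hgrid T hT).eventually (gt_mem_nhds (hxT.trans_lt hb'))] with m hm
    have h1 : partialSups (fun k : ℕ => x (k * h m)) ⌊T / h m⌋₊ ≤ sSup (x '' Icc 0 T) := by
      refine partialSups_le _ _ _ fun k hk => le_csSup hb ⟨_, ⟨?_, ?_⟩, rfl⟩
      · exact mul_nonneg (Nat.cast_nonneg k) (hpos m).le
      · exact (mul_le_mul_of_nonneg_right (Nat.cast_le.2 hk) (hpos m).le).trans
          (floor_mul_le (hpos m) hT)
    rw [partialSups_add_one]
    exact max_lt (h1.trans_lt hb') hm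

theorem measurable_partialSups {Ω : Type*} [MeasurableSpace Ω] {f : ℕ → Ω → ℝ}
    (hf : ∀ k, Measurable (f k)) (n : ℕ) : Measurable fun ω => partialSups (fun k => f k ω) n := by
  induction n with
  | zero => simpa using hf 0
  | succ n ih =>
    simp_rw [partialSups_add_one]
    exact ih.sup (hf _)

end Paths

/-- The joint transform of the running maximum (at `z`) and of the drawdown (at `w`) after `n`
steps of a random walk with step law `ξ` started at `y`, the maximum being started at `0`. -/
def walkTransform (ξ : Measure ℝ) (z w : ℂ) : ℕ → ℝ → ℂ
  | 0, y => Complex.exp (-(z * (max y 0 : ℝ)) - w * (min y 0 : ℝ))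
  | n + 1, y => Complex.exp (-(z * (max y 0 : ℝ))) * ∫ x, walkTransform ξ z w n (min y 0 + x) ∂ξ

/-- The law of the walk at time `n` on the event that it has stayed nonpositive. -/
def descentMeasure (ξ : Measure ℝ) : ℕ → Measure ℝ
  | 0 => Measure.dirac 0
  | n + 1 => ((descentMeasure ξ n).conv ξ).restrict (Iic 0)

/-- The transform of the first strict ascending ladder height on the event that the ladder time
is `j + 1`. -/
def ladderTransform (ξ : Measure ℝ) (z : ℂ) (j : ℕ) : ℂ :=
  ∫ y in Ioi 0, Complex.exp (-(z * y)) ∂((descentMeasure ξ j).conv ξ)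

/-- The transform of the walk killed on entering the positive half-line. -/
def descentTransform (ξ : Measure ℝ) (w : ℂ) (n : ℕ) : ℂ :=
  ∫ y, Complex.exp (-(w * y)) ∂(descentMeasure ξ n)

/-- The probability that the first strict ascending ladder time is `j + 1`. -/
def ladderMass (ξ : Measure ℝ) (j : ℕ) : ℝ := ((descentMeasure ξ j).conv ξ).real (Ioi 0)

section RandomWalk

variable {ξ : Measure ℝ} {z w : ℂ}

theorem norm_exp_neg_mul_le_one {z : ℂ} {x : ℝ} (h : 0 ≤ z.re * x) :
    ‖Complex.exp (-(z * x))‖ ≤ 1 := by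
  rw [Complex.norm_exp, Complex.neg_re, Complex.re_mul_ofReal, Real.exp_le_one_iff]
  linarith

theorem walkTransform_eq_exp_mul (n : ℕ) (y : ℝ) :
    walkTransform ξ z w n y
      = Complex.exp (-(z * (max y 0 : ℝ))) * walkTransform ξ z w n (min y 0) := by
  cases n with
  | zero => simp [walkTransform, ← Complex.exp_add, sub_eq_add_neg]
  | succ n => simp [walkTransform]

theorem walkTransform_zero_of_nonpos {y : ℝ} (hy : y ≤ 0) :
    walkTransform ξ z w 0 y = Complex.exp (-(w * y)) := by
  simp [walkTransform, max_eq_right hy, min_eq_left hy]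

theorem walkTransform_succ_of_nonpos (n : ℕ) {y : ℝ} (hy : y ≤ 0) :
    walkTransform ξ z w (n + 1) y = ∫ x, walkTransform ξ z w n (y + x) ∂ξ := by
  simp [walkTransform, max_eq_right hy, min_eq_left hy]

theorem walkTransform_of_nonneg (n : ℕ) {y : ℝ} (hy : 0 ≤ y) :
    walkTransform ξ z w n y = Complex.exp (-(z * y)) * walkTransform ξ z w n 0 := by
  rw [walkTransform_eq_exp_mul, max_eq_left hy, min_eq_right hy]

theorem ae_descentMeasure_nonpos (n : ℕ) : ∀ᵐ y ∂(descentMeasure ξ n), y ≤ 0 := by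
  cases n with
  | zero => simp [descentMeasure, ae_dirac_eq]
  | succ n => exact ae_restrict_mem measurableSet_Iic

theorem ladderMass_nonneg (j : ℕ) : 0 ≤ ladderMass ξ j := measureReal_nonneg

variable [IsProbabilityMeasure ξ]

theorem walkTransform_zero_zero (n : ℕ) (y : ℝ) : walkTransform ξ 0 0 n y = 1 := by
  induction n generalizing y with
  | zero => simp [walkTransform]
  | succ n ih => simp [walkTransform, ih]

theorem norm_walkTransform_le_one (hz : 0 ≤ z.re) (hw : w.re ≤ 0) (n : ℕ) (y : ℝ) :
    ‖walkTransform ξ z w n y‖ ≤ 1 := by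
  have hmax : ∀ y : ℝ, ‖Complex.exp (-(z * (max y 0 : ℝ)))‖ ≤ 1 := fun y =>
    norm_exp_neg_mul_le_one (mul_nonneg hz (le_max_right _ _))
  induction n generalizing y with
  | zero =>
    rw [walkTransform, sub_eq_add_neg, Complex.exp_add, norm_mul]
    exact mul_le_one₀ (hmax y) (norm_nonneg _)
      (norm_exp_neg_mul_le_one (mul_nonneg_of_nonpos_of_nonpos hw (min_le_right _ _)))
  | succ n ih =>
    rw [walkTransform, norm_mul]
    refine mul_le_one₀ (hmax y) (norm_nonneg _) ?_
    refine (norm_integral_le_of_norm_le_const (C := 1) (Filter.Eventually.of_forall fun x =>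
      ih _)).trans ?_
    simp

theorem measurable_walkTransform (n : ℕ) : Measurable (walkTransform ξ z w n) := by
  induction n with
  | zero =>
    have h : Measurable fun y : ℝ =>
        Complex.exp (-(z * (max y 0 : ℝ)) - w * (min y 0 : ℝ)) := by fun_prop
    exact h
  | succ n ih =>
    have h : Measurable fun y : ℝ => Complex.exp (-(z * (max y 0 : ℝ))) := by fun_prop
    refine h.mul ?_
    refine StronglyMeasurable.measurable ?_
    refine StronglyMeasurable.integral_prod_right'
      (f := fun p : ℝ × ℝ => walkTransform ξ z w n (min p.1 0 + p.2)) ?_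
    exact (ih.comp (by fun_prop)).stronglyMeasurable

theorem integrable_walkTransform (hz : 0 ≤ z.re) (hw : w.re ≤ 0) (n : ℕ) (μ : Measure ℝ)
    [IsFiniteMeasure μ] : Integrable (walkTransform ξ z w n) μ :=
  (integrable_const (1 : ℝ)).mono' (measurable_walkTransform n).aestronglyMeasurable
    (Filter.Eventually.of_forall (norm_walkTransform_le_one hz hw n))

instance isFiniteMeasure_descentMeasure (n : ℕ) : IsFiniteMeasure (descentMeasure ξ n) := by
  induction n with
  | zero => unfold descentMeasure; infer_instance
  | succ n ih => unfold descentMeasure; infer_instance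

theorem integral_walkTransform_succ_descentMeasure (hz : 0 ≤ z.re) (hw : w.re ≤ 0) (k m : ℕ) :
    ∫ y, walkTransform ξ z w (k + 1) y ∂(descentMeasure ξ m)
      = ∫ y, walkTransform ξ z w k y ∂(descentMeasure ξ (m + 1))
        + ladderTransform ξ z m * walkTransform ξ z w k 0 := by
  have h_int : Integrable (walkTransform ξ z w k) ((descentMeasure ξ m).conv ξ) :=
    integrable_walkTransform hz hw k _
  have h1 : ∫ y, walkTransform ξ z w (k + 1) y ∂(descentMeasure ξ m)
      = ∫ y, walkTransform ξ z w k y ∂((descentMeasure ξ m).conv ξ) := by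
    rw [integral_conv h_int]
    refine integral_congr_ae ((ae_descentMeasure_nonpos m).mono fun y hy => ?_)
    exact walkTransform_succ_of_nonpos k hy
  rw [h1, ← integral_add_compl (measurableSet_Iic (a := (0 : ℝ))) h_int, compl_Iic, ladderTransform,
    ← integral_mul_const]
  congr 1
  exact setIntegral_congr_fun measurableSet_Ioi fun y hy => walkTransform_of_nonneg k (le_of_lt hy)

theorem walkTransform_add (hz : 0 ≤ z.re) (hw : w.re ≤ 0) (m k : ℕ) :
    walkTransform ξ z w (m + k) 0 = ∫ y, walkTransform ξ z w k y ∂(descentMeasure ξ m)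
      + ∑ j ∈ Finset.range m, ladderTransform ξ z j * walkTransform ξ z w (m + k - 1 - j) 0 := by
  induction m generalizing k with
  | zero => simp [descentMeasure]
  | succ m ih =>
    rw [show m + 1 + k = m + (k + 1) by ring, ih (k + 1),
      integral_walkTransform_succ_descentMeasure hz hw, Finset.sum_range_succ,
      show m + (k + 1) - 1 - m = k by omega]
    ring

/-- Decomposition of the walk at its first strict ascending ladder epoch. -/
theorem walkTransform_eq_descentTransform_add (hz : 0 ≤ z.re) (hw : w.re ≤ 0) (n : ℕ) :
    walkTransform ξ z w n 0 = descentTransform ξ w n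
      + ∑ j ∈ Finset.range n, ladderTransform ξ z j * walkTransform ξ z w (n - 1 - j) 0 := by
  have h := walkTransform_add (ξ := ξ) hz hw n 0
  rw [add_zero] at h
  rw [h, descentTransform]
  congr 1
  exact integral_congr_ae ((ae_descentMeasure_nonpos n).mono fun y hy =>
    walkTransform_zero_of_nonpos hy)

theorem ladderMass_add (j : ℕ) :
    ladderMass ξ j + (descentMeasure ξ (j + 1)).real univ = (descentMeasure ξ j).real univ := by
  have h1 : (descentMeasure ξ (j + 1)).real univ = ((descentMeasure ξ j).conv ξ).real (Iic 0) := by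
    simp [descentMeasure, measureReal_def]
  have h2 : ((descentMeasure ξ j).conv ξ).real univ = (descentMeasure ξ j).real univ := by
    rw [measureReal_def, measureReal_def, Measure.conv, Measure.map_apply (by fun_prop) .univ,
      preimage_univ, ← univ_prod_univ, Measure.prod_prod]
    simp
  rw [h1, ladderMass, ← h2, ← compl_Iic, add_comm]
  exact measureReal_add_measureReal_compl measurableSet_Iic

theorem sum_ladderMass_le_one (n : ℕ) : ∑ j ∈ Finset.range n, ladderMass ξ j ≤ 1 := by
  have h : ∑ j ∈ Finset.range n, ladderMass ξ j + (descentMeasure ξ n).real univ = 1 := by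
    induction n with
    | zero => simp [descentMeasure]
    | succ n ih => rw [Finset.sum_range_succ, add_assoc, ladderMass_add, ih]
  linarith [measureReal_nonneg (μ := descentMeasure ξ n) (s := univ)]

theorem summable_ladderMass : Summable (ladderMass ξ) :=
  summable_of_sum_range_le ladderMass_nonneg sum_ladderMass_le_one

theorem tsum_ladderMass_le_one : ∑' j, ladderMass ξ j ≤ 1 :=
  Real.tsum_le_of_sum_range_le ladderMass_nonneg sum_ladderMass_le_one

theorem descentMeasure_real_univ_le_one (n : ℕ) : (descentMeasure ξ n).real univ ≤ 1 := by
  induction n with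
  | zero => simp [descentMeasure]
  | succ n ih => linarith [ladderMass_add (ξ := ξ) n, ladderMass_nonneg (ξ := ξ) n]

theorem integrableOn_exp_neg_mul (hz : 0 ≤ z.re) (μ : Measure ℝ) [IsFiniteMeasure μ] :
    IntegrableOn (fun y : ℝ => Complex.exp (-(z * y))) (Ioi 0) μ := by
  refine (integrable_const (1 : ℝ)).mono' (by fun_prop) ?_
  filter_upwards [ae_restrict_mem measurableSet_Ioi] with y hy
  exact norm_exp_neg_mul_le_one (mul_nonneg hz (le_of_lt hy))

theorem norm_ladderTransform_le (hz : 0 ≤ z.re) (j : ℕ) :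
    ‖ladderTransform ξ z j‖ ≤ ladderMass ξ j := by
  have h := norm_setIntegral_le_of_norm_le_const (μ := (descentMeasure ξ j).conv ξ)
    (s := Ioi (0 : ℝ)) (f := fun y : ℝ => Complex.exp (-(z * y))) (C := 1)
    (measure_lt_top _ _) (fun y hy => norm_exp_neg_mul_le_one (mul_nonneg hz (le_of_lt hy)))
  simpa [ladderMass, ladderTransform] using h

theorem norm_descentTransform_le (hw : w.re ≤ 0) (n : ℕ) : ‖descentTransform ξ w n‖ ≤ 1 := by
  refine (norm_integral_le_of_norm_le_const (C := 1) ((ae_descentMeasure_nonpos n).mono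
    fun y hy => norm_exp_neg_mul_le_one (mul_nonneg_of_nonpos_of_nonpos hw hy))).trans ?_
  rw [one_mul]
  exact descentMeasure_real_univ_le_one n

theorem norm_one_sub_exp_neg_mul_le (hz : 0 ≤ z.re) {x : ℝ} (hx : 0 ≤ x) :
    ‖1 - Complex.exp (-(z * x))‖ ≤ 4 * (1 + ‖z‖) * (1 - Real.exp (-x)) := by
  have hz0 := norm_nonneg z
  have hx1 : x / (1 + x) ≤ 1 - Real.exp (-x) := by
    have h := Real.add_one_le_exp x
    have : Real.exp (-x) ≤ 1 / (1 + x) := by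
      rw [Real.exp_neg, ← one_div]
      exact one_div_le_one_div_of_le (by linarith) (by linarith)
    have e : x / (1 + x) = 1 - 1 / (1 + x) := by field_simp; ring
    linarith
  have h2 : ‖1 - Complex.exp (-(z * x))‖ ≤ 2 := by
    refine (norm_sub_le _ _).trans ?_
    have := norm_exp_neg_mul_le_one (mul_nonneg hz hx)
    rw [norm_one]
    linarith
  have hn : ‖-(z * x)‖ = ‖z‖ * x := by
    rw [norm_neg, norm_mul, Complex.norm_real, Real.norm_of_nonneg hx]
  rcases le_total x 1 with h1 | h1
  · have h4 : ‖1 - Complex.exp (-(z * x))‖ ≤ 2 * (‖z‖ * x) := by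
      rcases le_total (‖z‖ * x) 1 with h | h
      · rw [norm_sub_rev, ← hn]
        exact Complex.norm_exp_sub_one_le (hn.trans_le h)
      · linarith
    have h3 : x / 2 ≤ x / (1 + x) := div_le_div_of_nonneg_left hx (by linarith) (by linarith)
    nlinarith
  · have h3 : 1 / 2 ≤ x / (1 + x) := by
      rw [div_le_div_iff₀ (by norm_num) (by linarith)]
      linarith
    nlinarith

theorem norm_ladderMass_sub_ladderTransform_le (hz : 0 ≤ z.re) (j : ℕ) :
    ‖(ladderMass ξ j : ℂ) - ladderTransform ξ z j‖
      ≤ 4 * (1 + ‖z‖) * (ladderMass ξ j - (ladderTransform ξ 1 j).re) := by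
  set μ := ((descentMeasure ξ j).conv ξ).restrict (Ioi 0) with hμ
  have hi : ∀ {z : ℂ}, 0 ≤ z.re → Integrable (fun y : ℝ => 1 - Complex.exp (-(z * y))) μ :=
    fun hz => (integrable_const 1).sub (integrableOn_exp_neg_mul hz _)
  have hm : ∀ {z : ℂ}, 0 ≤ z.re → (ladderMass ξ j : ℂ) - ladderTransform ξ z j
      = ∫ y, (1 - Complex.exp (-(z * y))) ∂μ := fun hz => by
    rw [integral_sub (integrable_const 1) (integrableOn_exp_neg_mul hz _)]
    simp [ladderMass, ladderTransform]
  have h1 : (0 : ℝ) ≤ (1 : ℂ).re := by simp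
  have hr : ladderMass ξ j - (ladderTransform ξ 1 j).re = ∫ y, (1 - Real.exp (-y)) ∂μ := by
    have h := congrArg Complex.re (hm h1)
    rw [Complex.sub_re, Complex.ofReal_re] at h
    rw [h, ← Complex.reCLM_apply, ← ContinuousLinearMap.integral_comp_comm _ (hi h1)]
    refine integral_congr_ae (Filter.Eventually.of_forall fun y => ?_)
    simp [← Complex.ofReal_neg, Complex.exp_ofReal_re]
  rw [hm hz, hr, ← integral_const_mul]
  refine norm_integral_le_of_norm_le (Integrable.const_mul ?_ _) ?_
  · have h := (hi h1).re
    refine h.congr (Filter.Eventually.of_forall fun y => ?_)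
    simp [← Complex.ofReal_neg, Complex.exp_ofReal_re]
  · filter_upwards [ae_restrict_mem measurableSet_Ioi] with y hy
    exact norm_one_sub_exp_neg_mul_le hz (le_of_lt hy)

end RandomWalk

/-- The joint transform of the running maximum and the drawdown of a random walk at an
independent geometric time with success probability `1 - s`. -/
def killedWalkTransform (ξ : Measure ℝ) (s : ℝ) (z w : ℂ) : ℂ :=
  (1 - s) * ∑' n, (s : ℂ) ^ n * walkTransform ξ z w n 0

section KilledWalk

variable {ξ : Measure ℝ} [IsProbabilityMeasure ξ] {s : ℝ} {z w : ℂ}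

theorem summable_norm_pow_mul_of_norm_le_one (hs0 : 0 ≤ s) (hs1 : s < 1) {u : ℕ → ℂ}
    (hu : ∀ n, ‖u n‖ ≤ 1) : Summable fun n => ‖(s : ℂ) ^ n * u n‖ := by
  refine Summable.of_nonneg_of_le (fun _ => norm_nonneg _) (fun n => ?_)
    (summable_geometric_of_lt_one hs0 hs1)
  rw [norm_mul, norm_pow, Complex.norm_real, Real.norm_of_nonneg hs0]
  exact mul_le_of_le_one_right (pow_nonneg hs0 n) (hu n)

theorem summable_norm_pow_mul_ladderTransform (hs0 : 0 ≤ s) (hs1 : s < 1) (hz : 0 ≤ z.re) :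
    Summable fun j => ‖(s : ℂ) ^ (j + 1) * ladderTransform ξ z j‖ := by
  refine Summable.of_nonneg_of_le (fun _ => norm_nonneg _) (fun j => ?_)
    (summable_ladderMass (ξ := ξ))
  rw [norm_mul, norm_pow, Complex.norm_real, Real.norm_of_nonneg hs0]
  exact (mul_le_of_le_one_left (norm_nonneg _) (pow_le_one₀ hs0 hs1.le)).trans
    (norm_ladderTransform_le hz j)

theorem norm_tsum_pow_mul_ladderTransform_le (hs0 : 0 ≤ s) (hs1 : s < 1) (hz : 0 ≤ z.re) :
    ‖∑' j, (s : ℂ) ^ (j + 1) * ladderTransform ξ z j‖ ≤ s := by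
  have h := tsum_of_norm_bounded (f := fun j => (s : ℂ) ^ (j + 1) * ladderTransform ξ z j)
    ((summable_ladderMass (ξ := ξ)).mul_left s).hasSum fun j => by
      rw [norm_mul, norm_pow, Complex.norm_real, Real.norm_of_nonneg hs0, pow_succ', mul_assoc]
      refine mul_le_mul_of_nonneg_left ?_ hs0
      exact (mul_le_of_le_one_left (norm_nonneg _) (pow_le_one₀ hs0 hs1.le)).trans
        (norm_ladderTransform_le hz j)
  refine h.trans ?_
  rw [tsum_mul_left]
  exact mul_le_of_le_one_right hs0 tsum_ladderMass_le_one

theorem one_sub_tsum_ladderTransform_ne_zero (hs0 : 0 ≤ s) (hs1 : s < 1) (hz : 0 ≤ z.re) :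
    1 - ∑' j, (s : ℂ) ^ (j + 1) * ladderTransform ξ z j ≠ 0 := fun h => by
  have h1 := norm_tsum_pow_mul_ladderTransform_le (ξ := ξ) hs0 hs1 hz
  rw [← sub_eq_zero.1 h, norm_one] at h1
  linarith

theorem killedWalkTransform_mul_one_sub (hs0 : 0 ≤ s) (hs1 : s < 1) (hz : 0 ≤ z.re)
    (hw : w.re ≤ 0) :
    killedWalkTransform ξ s z w * (1 - ∑' j, (s : ℂ) ^ (j + 1) * ladderTransform ξ z j)
      = (1 - s) * ∑' n, (s : ℂ) ^ n * descentTransform ξ w n := by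
  have hV := summable_norm_pow_mul_of_norm_le_one hs0 hs1 fun n =>
    norm_walkTransform_le_one (ξ := ξ) hz hw n 0
  have hB := summable_norm_pow_mul_of_norm_le_one hs0 hs1 fun n =>
    norm_descentTransform_le (ξ := ξ) hw n
  have hL := summable_norm_pow_mul_ladderTransform (ξ := ξ) hs0 hs1 hz
  have hprod := tsum_mul_tsum_eq_tsum_sum_range_of_summable_norm hL hV
  set u : ℕ → ℂ := fun n => (s : ℂ) ^ n *
    ∑ j ∈ Finset.range n, ladderTransform ξ z j * walkTransform ξ z w (n - 1 - j) 0 with hu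
  have hdec : ∀ n, (s : ℂ) ^ n * walkTransform ξ z w n 0
      = (s : ℂ) ^ n * descentTransform ξ w n + u n := fun n => by
    rw [hu, walkTransform_eq_descentTransform_add hz hw n, mul_add]
  have husum : Summable u := by
    have := hV.of_norm.sub hB.of_norm
    refine this.congr fun n => ?_
    rw [hdec]
    ring
  have hushift : ∑' n, u n = ∑' n, u (n + 1) := by
    rw [husum.tsum_eq_zero_add]
    simp [hu]
  have huprod : ∀ n, u (n + 1) = ∑ k ∈ Finset.range (n + 1),
      (s : ℂ) ^ (k + 1) * ladderTransform ξ z k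
        * ((s : ℂ) ^ (n - k) * walkTransform ξ z w (n - k) 0) := fun n => by
    simp only [hu, Finset.mul_sum]
    refine Finset.sum_congr rfl fun k hk => ?_
    have hk' : k ≤ n := Nat.lt_succ_iff.1 (Finset.mem_range.1 hk)
    rw [show n + 1 - 1 - k = n - k by omega]
    have : (s : ℂ) ^ (n + 1) = (s : ℂ) ^ (k + 1) * (s : ℂ) ^ (n - k) := by
      rw [← pow_add]
      congr 1
      omega
    rw [this]
    ring
  have hV' : ∑' n, (s : ℂ) ^ n * walkTransform ξ z w n 0
      = ∑' n, (s : ℂ) ^ n * descentTransform ξ w n + ∑' n, u n := by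
    rw [← hB.of_norm.tsum_add husum]
    exact tsum_congr hdec
  rw [killedWalkTransform, mul_assoc, mul_one_sub, mul_comm (∑' n, _ * walkTransform ξ z w n 0),
    hprod, ← tsum_congr huprod, ← hushift, hV']
  ring

theorem killedWalkTransform_zero_zero (hs0 : 0 ≤ s) (hs1 : s < 1) :
    killedWalkTransform ξ s 0 0 = 1 := by
  have hs : ‖(s : ℂ)‖ < 1 := by rwa [Complex.norm_real, Real.norm_of_nonneg hs0]
  have h1 : (1 - s : ℂ) ≠ 0 := fun h => by
    rw [← sub_eq_zero.1 h, norm_one] at hs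
    exact lt_irrefl _ hs
  simp_rw [killedWalkTransform, walkTransform_zero_zero, mul_one]
  rw [tsum_geometric_of_norm_lt_one hs, mul_inv_cancel₀ h1]

/-- The Wiener–Hopf factorization for random walks. -/
theorem killedWalkTransform_eq_mul (hs0 : 0 ≤ s) (hs1 : s < 1) (hz : 0 ≤ z.re) (hw : w.re ≤ 0) :
    killedWalkTransform ξ s z w
      = killedWalkTransform ξ s z 0 * killedWalkTransform ξ s 0 w := by
  have h0 : (0 : ℝ) ≤ (0 : ℂ).re := le_rfl
  have h0' : (0 : ℂ).re ≤ 0 := le_rfl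
  have e1 := killedWalkTransform_mul_one_sub (ξ := ξ) hs0 hs1 hz hw
  have e2 := killedWalkTransform_mul_one_sub (ξ := ξ) hs0 hs1 hz h0'
  have e3 := killedWalkTransform_mul_one_sub (ξ := ξ) hs0 hs1 h0 hw
  have e4 := killedWalkTransform_mul_one_sub (ξ := ξ) hs0 hs1 h0 h0'
  rw [killedWalkTransform_zero_zero hs0 hs1, one_mul] at e4
  refine mul_right_cancel₀ (one_sub_tsum_ladderTransform_ne_zero (ξ := ξ) hs0 hs1 hz)
    (mul_right_cancel₀ (one_sub_tsum_ladderTransform_ne_zero (ξ := ξ) hs0 hs1 h0) ?_)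
  rw [← e4] at e2
  rw [e1, ← e3, mul_right_comm _ _ (1 - ∑' j, (s : ℂ) ^ (j + 1) * ladderTransform ξ z j), e2]
  ring

theorem norm_one_sub_tsum_ladderTransform_le (hs0 : 0 ≤ s) (hs1 : s < 1) (hz : 0 ≤ z.re) :
    ‖1 - ∑' j, (s : ℂ) ^ (j + 1) * ladderTransform ξ z j‖ ≤ 4 * (1 + ‖z‖) *
      ‖1 - ∑' j, (s : ℂ) ^ (j + 1) * ladderTransform ξ 1 j‖ := by
  have h1 : (0 : ℝ) ≤ (1 : ℂ).re := by simp
  have hLz := (summable_norm_pow_mul_ladderTransform (ξ := ξ) hs0 hs1 hz).of_norm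
  have hL1 := (summable_norm_pow_mul_ladderTransform (ξ := ξ) hs0 hs1 h1).of_norm
  have hm : Summable fun j => s ^ (j + 1) * ladderMass ξ j :=
    Summable.of_nonneg_of_le (fun j => mul_nonneg (pow_nonneg hs0 _) (ladderMass_nonneg j))
      (fun j => mul_le_of_le_one_left (ladderMass_nonneg j) (pow_le_one₀ hs0 hs1.le))
      (summable_ladderMass (ξ := ξ))
  have hm1 : ∑' j, s ^ (j + 1) * ladderMass ξ j ≤ 1 :=
    (hm.tsum_le_tsum (fun j => mul_le_of_le_one_left (ladderMass_nonneg j)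
      (pow_le_one₀ hs0 hs1.le)) summable_ladderMass).trans tsum_ladderMass_le_one
  have hL1r : Summable fun j => s ^ (j + 1) * (ladderTransform ξ 1 j).re := by
    refine (Complex.hasSum_re hL1.hasSum).summable.congr fun j => ?_
    rw [← Complex.ofReal_pow, Complex.re_ofReal_mul]
  have hre : (∑' j, (s : ℂ) ^ (j + 1) * ladderTransform ξ 1 j).re
      = ∑' j, s ^ (j + 1) * (ladderTransform ξ 1 j).re := by
    rw [Complex.re_tsum hL1]
    refine tsum_congr fun j => ?_
    rw [← Complex.ofReal_pow, Complex.re_ofReal_mul]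
  set m := ∑' j, s ^ (j + 1) * ladderMass ξ j with hmdef
  have hdiff : ‖(m : ℂ) - ∑' j, (s : ℂ) ^ (j + 1) * ladderTransform ξ z j‖
      ≤ 4 * (1 + ‖z‖) * (m - ∑' j, s ^ (j + 1) * (ladderTransform ξ 1 j).re) := by
    have e1 : (m : ℂ) - ∑' j, (s : ℂ) ^ (j + 1) * ladderTransform ξ z j
        = ∑' j, (s : ℂ) ^ (j + 1) * ((ladderMass ξ j : ℂ) - ladderTransform ξ z j) := by
      have hmC : Summable fun j => (s : ℂ) ^ (j + 1) * (ladderMass ξ j : ℂ) := by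
        exact_mod_cast Complex.summable_ofReal.2 hm
      rw [hmdef, Complex.ofReal_tsum]
      push_cast
      rw [← hmC.tsum_sub hLz]
      exact tsum_congr fun j => by ring
    have e2 := ((hm.sub hL1r).mul_left (4 * (1 + ‖z‖))).hasSum
    rw [tsum_mul_left, hm.tsum_sub hL1r] at e2
    rw [e1]
    refine tsum_of_norm_bounded e2 fun j => ?_
    rw [norm_mul, norm_pow, Complex.norm_real, Real.norm_of_nonneg hs0]
    calc _ ≤ s ^ (j + 1) * (4 * (1 + ‖z‖) * (ladderMass ξ j - (ladderTransform ξ 1 j).re)) :=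
          mul_le_mul_of_nonneg_left (norm_ladderMass_sub_ladderTransform_le hz j)
            (pow_nonneg hs0 _)
      _ = _ := by ring
  have hz0 := norm_nonneg z
  calc ‖1 - ∑' j, (s : ℂ) ^ (j + 1) * ladderTransform ξ z j‖
      = ‖((1 - m : ℝ) : ℂ) + ((m : ℂ) - ∑' j, (s : ℂ) ^ (j + 1) * ladderTransform ξ z j)‖ := by
        push_cast
        congr 1
        ring
    _ ≤ (1 - m) + 4 * (1 + ‖z‖) * (m - ∑' j, s ^ (j + 1) * (ladderTransform ξ 1 j).re) := by
        refine (norm_add_le _ _).trans (add_le_add ?_ hdiff)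
        rw [Complex.norm_real, Real.norm_of_nonneg (by linarith)]
    _ ≤ 4 * (1 + ‖z‖) * (1 - ∑' j, s ^ (j + 1) * (ladderTransform ξ 1 j).re) := by
        nlinarith
    _ ≤ _ := by
        refine mul_le_mul_of_nonneg_left ?_ (by positivity)
        have h := Complex.re_le_norm (1 - ∑' j, (s : ℂ) ^ (j + 1) * ladderTransform ξ 1 j)
        rwa [Complex.sub_re, Complex.one_re, hre] at h

theorem norm_killedWalkTransform_one_le (hs0 : 0 ≤ s) (hs1 : s < 1) (hz : 0 ≤ z.re) :
    ‖killedWalkTransform ξ s 1 0‖ ≤ 4 * (1 + ‖z‖) * ‖killedWalkTransform ξ s z 0‖ := by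
  have h0 : (0 : ℂ).re ≤ 0 := le_rfl
  have h1 : (0 : ℝ) ≤ (1 : ℂ).re := by simp
  have e1 := killedWalkTransform_mul_one_sub (ξ := ξ) hs0 hs1 hz h0
  have e2 := killedWalkTransform_mul_one_sub (ξ := ξ) hs0 hs1 h1 h0
  have e := congrArg norm (e2.trans e1.symm)
  rw [norm_mul, norm_mul] at e
  refine le_of_mul_le_mul_right ?_
    (norm_pos_iff.2 (one_sub_tsum_ladderTransform_ne_zero (ξ := ξ) hs0 hs1 h1))
  rw [e]
  calc _ ≤ ‖killedWalkTransform ξ s z 0‖ * _ := mul_le_mul_of_nonneg_left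
        (norm_one_sub_tsum_ladderTransform_le hs0 hs1 hz) (norm_nonneg _)
    _ = _ := by ring

end KilledWalk

/-- The running maximum of the skeleton of `X` with mesh `h`. -/
def skeletonMax {Ω : Type*} (X : ℝ → Ω → ℝ) (h : ℝ) (n : ℕ) (ω : Ω) : ℝ :=
  partialSups (fun k : ℕ => X (k * h) ω) n

theorem le_skeletonMax {Ω : Type*} {X : ℝ → Ω → ℝ} {h : ℝ} (n : ℕ) (ω : Ω) :
    X (n * h) ω ≤ skeletonMax X h n ω :=
  le_partialSups (fun k : ℕ => X (k * h) ω) n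

section LevyWalk

variable {Ω : Type*} [MeasurableSpace Ω] {P : Measure Ω}
  {X : ℝ → Ω → ℝ} {h : ℝ} {z w : ℂ}

theorem IsLevyProcess.measurable_skeletonMax (hX : IsLevyProcess P X) (n : ℕ) :
    Measurable (skeletonMax X h n) :=
  measurable_partialSups (f := fun k : ℕ => X (k * h)) (fun _ => hX.measurable _) n

theorem IsLevyProcess.ae_skeletonMax_nonneg (hX : IsLevyProcess P X) (h : ℝ) :
    ∀ᵐ ω ∂P, ∀ n, 0 ≤ skeletonMax X h n ω := by
  filter_upwards [hX.init] with ω hω n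
  have h1 := le_partialSups_of_le (fun k : ℕ => X (k * h) ω) (Nat.zero_le n)
  simp only [Nat.cast_zero, zero_mul, hω] at h1
  exact h1

theorem IsLevyProcess.indepFun_skeletonMax (hX : IsLevyProcess P X) (hh : 0 ≤ h) (k : ℕ) :
    IndepFun (fun ω => (skeletonMax X h k ω, X (k * h) ω))
      (fun ω => X ((k + 1 : ℕ) * h) ω - X (k * h) ω) P := by
  have ht : (0 : ℝ) ≤ k * h := by positivity
  have hind := hX.indep_past (k * h) ht
  have hφ : Measurable fun p : Icc (0 : ℝ) (k * h) → ℝ =>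
      (partialSups (fun i : ℕ => p (projIcc 0 (k * h) ht (i * h))) k,
        p ⟨k * h, ht, le_rfl⟩) :=
    (measurable_partialSups (f := fun (i : ℕ) (p : Icc (0 : ℝ) (k * h) → ℝ) =>
      p (projIcc 0 (k * h) ht (i * h))) (fun i => measurable_pi_apply _) k).prodMk
      (measurable_pi_apply _)
  have hψ : Measurable fun p : {s : ℝ // 0 ≤ s} → ℝ => p ⟨h, hh⟩ := measurable_pi_apply _
  have hcomp := hind.comp hφ hψ
  have e1 : (fun ω => (skeletonMax X h k ω, X (k * h) ω))
      = (fun p : Icc (0 : ℝ) (k * h) → ℝ =>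
      (partialSups (fun i : ℕ => p (projIcc 0 (k * h) ht (i * h))) k,
        p ⟨k * h, ht, le_rfl⟩)) ∘ fun ω => (fun u : Icc (0 : ℝ) (k * h) => X u ω) := by
    funext ω
    refine Prod.ext ?_ rfl
    simp only [skeletonMax, Function.comp, partialSups_apply]
    refine Finset.sup'_congr _ rfl fun i hi => ?_
    have hik : (i : ℝ) * h ≤ k * h :=
      mul_le_mul_of_nonneg_right (Nat.cast_le.2 (Finset.mem_Iic.1 hi)) hh
    rw [projIcc_of_mem ht ⟨by positivity, hik⟩]
  have e2 : (fun ω => X ((k + 1 : ℕ) * h) ω - X (k * h) ω)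
      = (fun p : {s : ℝ // 0 ≤ s} → ℝ => p ⟨h, hh⟩) ∘
        fun ω => (fun s : {s : ℝ // 0 ≤ s} => X (k * h + s) ω - X (k * h) ω) := by
    funext ω
    simp [add_mul]
  rw [e1, e2]
  exact hcomp

variable [IsProbabilityMeasure P]

theorem ProbabilityTheory.IndepFun.integral_comp_prodMk {α β : Type*} [MeasurableSpace α]
    [MeasurableSpace β] {Y : Ω → α} {Z : Ω → β} (hYZ : IndepFun Y Z P) (hY : Measurable Y)
    (hZ : Measurable Z) {g : α × β → ℂ} (hg : Measurable g)
    (hi : Integrable (fun ω => g (Y ω, Z ω)) P) :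
    ∫ ω, g (Y ω, Z ω) ∂P = ∫ ω, ∫ y, g (Y ω, y) ∂(P.map Z) ∂P := by
  have := Measure.isProbabilityMeasure_map (μ := P) hY.aemeasurable
  have := Measure.isProbabilityMeasure_map (μ := P) hZ.aemeasurable
  have hmap := (indepFun_iff_map_prod_eq_prod_map_map hY.aemeasurable hZ.aemeasurable).1 hYZ
  have hi' : Integrable g ((P.map Y).prod (P.map Z)) := by
    rw [← hmap, integrable_map_measure hg.aestronglyMeasurable (hY.prodMk hZ).aemeasurable]
    exact hi
  rw [← integral_map (φ := fun ω => (Y ω, Z ω)) (hY.prodMk hZ).aemeasurable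
    hg.aestronglyMeasurable, hmap, integral_prod _ hi',
    integral_map hY.aemeasurable]
  exact (hg.stronglyMeasurable.integral_prod_right').aestronglyMeasurable

theorem IsLevyProcess.integral_exp_mul_walkTransform_succ (hX : IsLevyProcess P X) (hh : 0 ≤ h)
    (hz : 0 ≤ z.re) (hw : w.re ≤ 0) (k j : ℕ) :
    ∫ ω, Complex.exp (-(z * skeletonMax X h k ω)) *
        walkTransform (P.map (X h)) z w (j + 1) (X (k * h) ω - skeletonMax X h k ω) ∂P
      = ∫ ω, Complex.exp (-(z * skeletonMax X h (k + 1) ω)) *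
        walkTransform (P.map (X h)) z w j
          (X ((k + 1 : ℕ) * h) ω - skeletonMax X h (k + 1) ω) ∂P := by
  have := Measure.isProbabilityMeasure_map (μ := P) (hX.measurable h).aemeasurable
  set ξ := P.map (X h) with hξ
  have hY : Measurable fun ω => (skeletonMax X h k ω, X (k * h) ω) :=
    (hX.measurable_skeletonMax k).prodMk (hX.measurable _)
  have hZ : Measurable fun ω => X ((k + 1 : ℕ) * h) ω - X (k * h) ω :=
    (hX.measurable _).sub (hX.measurable _)
  have hZlaw : P.map (fun ω => X ((k + 1 : ℕ) * h) ω - X (k * h) ω) = ξ := by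
    rw [hξ, ← hX.stationary h (k * h) hh (by positivity)]
    simp [add_mul]
  set g : (ℝ × ℝ) × ℝ → ℂ := fun p =>
    Complex.exp (-(z * p.1.1)) * walkTransform ξ z w j (p.1.2 - p.1.1 + p.2) with hg
  have hgm : Measurable g := by
    refine Measurable.mul (by fun_prop) ((measurable_walkTransform j).comp (by fun_prop))
  have hgi : Integrable (fun ω => g ((skeletonMax X h k ω, X (k * h) ω),
      X ((k + 1 : ℕ) * h) ω - X (k * h) ω)) P := by
    refine (integrable_const (1 : ℝ)).mono' (hgm.comp (hY.prodMk hZ)).aestronglyMeasurable ?_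
    filter_upwards [hX.ae_skeletonMax_nonneg h] with ω hω
    rw [hg, norm_mul]
    exact mul_le_one₀ (norm_exp_neg_mul_le_one (mul_nonneg hz (hω k))) (norm_nonneg _)
      (norm_walkTransform_le_one hz hw _ _)
  have hmain := (hX.indepFun_skeletonMax hh k).integral_comp_prodMk hY hZ hgm hgi
  rw [hZlaw] at hmain
  refine Eq.trans ?_ (hmain.symm.trans ?_)
  · refine integral_congr_ae (Filter.Eventually.of_forall fun ω => ?_)
    simp only [hg]
    rw [integral_const_mul, walkTransform_succ_of_nonpos]
    linarith [le_skeletonMax (X := X) (h := h) k ω]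
  · refine integral_congr_ae (Filter.Eventually.of_forall fun ω => ?_)
    simp only [hg]
    set M := skeletonMax X h k ω with hM
    set x := X ((k + 1 : ℕ) * h) ω with hx
    have hM1 : skeletonMax X h (k + 1) ω = max M x := partialSups_add_one _ k
    rw [show X (k * h) ω - M + (x - X (k * h) ω) = x - M by ring, walkTransform_eq_exp_mul j,
      hM1, ← mul_assoc, ← Complex.exp_add]
    have e1 : max M x = M + max (x - M) 0 := by
      rcases le_total M x with h | h
      · rw [max_eq_right h, max_eq_left (by linarith)]; ring
      · rw [max_eq_left h, max_eq_right (by linarith)]; ring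
    have e2 : x - (M + max (x - M) 0) = min (x - M) 0 := by
      rcases le_total M x with h | h
      · rw [min_eq_right (by linarith), max_eq_left (by linarith)]; ring
      · rw [min_eq_left (by linarith), max_eq_right (by linarith)]; ring
    rw [e1, e2]
    push_cast
    congr 2
    ring

theorem IsLevyProcess.integral_exp_skeletonMax (hX : IsLevyProcess P X) (hh : 0 ≤ h)
    (hz : 0 ≤ z.re) (hw : w.re ≤ 0) (n : ℕ) :
    ∫ ω, Complex.exp (-(z * skeletonMax X h n ω)) *
        Complex.exp (-(w * (X (n * h) ω - skeletonMax X h n ω : ℝ))) ∂P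
      = walkTransform (P.map (X h)) z w n 0 := by
  have key : ∀ k j, ∫ ω, Complex.exp (-(z * skeletonMax X h k ω)) *
        walkTransform (P.map (X h)) z w j (X (k * h) ω - skeletonMax X h k ω) ∂P
      = walkTransform (P.map (X h)) z w (k + j) 0 := by
    intro k
    induction k with
    | zero =>
      intro j
      have : ∀ᵐ ω ∂P, Complex.exp (-(z * skeletonMax X h 0 ω)) *
          walkTransform (P.map (X h)) z w j (X ((0 : ℕ) * h) ω - skeletonMax X h 0 ω)
            = walkTransform (P.map (X h)) z w j 0 := by
        filter_upwards [hX.init] with ω hω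
        simp [skeletonMax, hω]
      rw [integral_congr_ae this]
      simp
    | succ k ih =>
      intro j
      rw [← hX.integral_exp_mul_walkTransform_succ hh hz hw, ih]
      congr 1
      ring
  rw [← add_zero n, ← key n 0, add_zero]
  refine integral_congr_ae (Filter.Eventually.of_forall fun ω => ?_)
  simp only
  rw [walkTransform_zero_of_nonpos (by linarith [le_skeletonMax (X := X) (h := h) n ω])]

end LevyWalk

section ExponentialTime

theorem expMeasure_real_Iic {q : ℝ} (hq : 0 < q) {x : ℝ} (hx : 0 ≤ x) :
    (expMeasure q).real (Iic x) = 1 - Real.exp (-(q * x)) := by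
  have := isProbabilityMeasure_expMeasure hq
  rw [← cdf_eq_real, cdf_expMeasure_eq hq, if_pos hx]

theorem expMeasure_real_Iio {q : ℝ} (hq : 0 < q) {x : ℝ} (hx : 0 ≤ x) :
    (expMeasure q).real (Iio x) = 1 - Real.exp (-(q * x)) := by
  have hna : expMeasure q {x} = 0 := by
    unfold expMeasure gammaMeasure
    exact withDensity_absolutelyContinuous _ _ (measure_singleton x)
  rw [← expMeasure_real_Iic hq hx]
  refine measureReal_congr ?_
  exact Iio_ae_eq_Iic' hna

theorem ae_expMeasure_nonneg {q : ℝ} (hq : 0 < q) : ∀ᵐ x ∂(expMeasure q), 0 ≤ x := by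
  have := isProbabilityMeasure_expMeasure hq
  have h := expMeasure_real_Iio hq le_rfl
  simp only [mul_zero, neg_zero, Real.exp_zero, sub_self] at h
  rw [measureReal_eq_zero_iff] at h
  filter_upwards [compl_mem_ae_iff.2 h] with x hx
  exact not_lt.1 hx

theorem expMeasure_real_floor_eq {q h : ℝ} (hq : 0 < q) (hh : 0 < h) (n : ℕ) :
    (expMeasure q).real ((fun x : ℝ => ⌊x / h⌋₊) ⁻¹' {n})
      = (1 - Real.exp (-(q * h))) * Real.exp (-(q * h)) ^ n := by
  have := isProbabilityMeasure_expMeasure hq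
  have hm : Measurable fun x : ℝ => ⌊x / h⌋₊ := by fun_prop
  have hlt : ∀ n : ℕ, (expMeasure q).real ((fun x : ℝ => ⌊x / h⌋₊) ⁻¹' Iio n)
      = 1 - Real.exp (-(q * h)) ^ n := fun n => by
    rcases Nat.eq_zero_or_pos n with rfl | hn
    · simp
    · have e : (fun x : ℝ => ⌊x / h⌋₊) ⁻¹' Iio n = Iio (n * h) := by
        ext x
        simp [Nat.floor_lt' hn.ne', div_lt_iff₀ hh]
      rw [e, expMeasure_real_Iio hq (by positivity), ← Real.exp_nat_mul]
      congr 2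
      ring
  have hsplit : (fun x : ℝ => ⌊x / h⌋₊) ⁻¹' Iio (n + 1)
      = (fun x : ℝ => ⌊x / h⌋₊) ⁻¹' Iio n ∪ (fun x : ℝ => ⌊x / h⌋₊) ⁻¹' {n} := by
    ext x
    simp [le_iff_lt_or_eq]
  have hdisj : Disjoint ((fun x : ℝ => ⌊x / h⌋₊) ⁻¹' Iio n)
      ((fun x : ℝ => ⌊x / h⌋₊) ⁻¹' {n}) :=
    Disjoint.preimage _ (by simp)
  have h1 := measureReal_union (μ := expMeasure q) hdisj (hm (measurableSet_singleton n))
  rw [← hsplit, hlt, hlt, pow_succ] at h1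
  linarith

end ExponentialTime

/-- The transform of the maximum and drawdown of the path `p` along the first `n` steps of the
grid with mesh `h`. -/
def skeletonTransform (h : ℝ) (z w : ℂ) (n : ℕ) (p : ℝ → ℝ) : ℂ :=
  Complex.exp (-(z * (partialSups (fun k : ℕ => p (k * h)) n : ℝ))) *
    Complex.exp (-(w * (p (n * h) - partialSups (fun k : ℕ => p (k * h)) n : ℝ)))

theorem measurable_skeletonTransform (h : ℝ) (z w : ℂ) (n : ℕ) :
    Measurable (skeletonTransform h z w n) := by
  have h1 : Measurable fun p : ℝ → ℝ => partialSups (fun k : ℕ => p (k * h)) n :=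
    measurable_partialSups (f := fun (k : ℕ) (p : ℝ → ℝ) => p (k * h))
      (fun k => measurable_pi_apply _) n
  have h2 : Measurable fun p : ℝ → ℝ => p (n * h) := measurable_pi_apply _
  unfold skeletonTransform
  fun_prop

theorem measurable_comp_floor_add_one {β γ : Type*} [MeasurableSpace β] [MeasurableSpace γ]
    {F : ℕ → β → γ} (hF : ∀ n, Measurable (F n)) (h : ℝ) :
    Measurable fun p : ℝ × β => F (⌊p.1 / h⌋₊ + 1) p.2 := by
  have h1 : Measurable fun p : ℕ × β => F (p.1 + 1) p.2 :=
    measurable_from_prod_countable_right fun n => hF (n + 1)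
  have h2 : Measurable fun p : ℝ × β => (⌊p.1 / h⌋₊, p.2) :=
    (Nat.measurable_floor.comp (measurable_fst.div_const h)).prodMk measurable_snd
  exact h1.comp h2

section ExponentialSkeleton

variable {Ω : Type*} [MeasurableSpace Ω] {P : Measure Ω} [IsProbabilityMeasure P]
  {X : ℝ → Ω → ℝ} {h q : ℝ} {z w : ℂ} {E : Ω → ℝ}

/-- The joint transform of the skeleton maximum and drawdown at the first grid time after an
independent exponential time. -/
theorem IsLevyProcess.integral_skeleton_at_exponential (hX : IsLevyProcess P X) (hh : 0 < h)
    (hq : 0 < q) (hz : 0 ≤ z.re) (hw : w.re ≤ 0) (hE_meas : Measurable E)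
    (hE_law : Measure.map E P = expMeasure q)
    (hE_indep : IndepFun E (fun ω => (fun t : ℝ => X t ω)) P) :
    killedWalkTransform (P.map (X h)) (Real.exp (-(q * h))) z w
      = (1 - Real.exp (-(q * h)) : ℝ) + (Real.exp (-(q * h)) : ℝ) *
        ∫ ω, Complex.exp (-(z * skeletonMax X h (⌊E ω / h⌋₊ + 1) ω)) *
          Complex.exp (-(w * (X ((⌊E ω / h⌋₊ + 1 : ℕ) * h) ω
            - skeletonMax X h (⌊E ω / h⌋₊ + 1) ω : ℝ))) ∂P := by
  have := Measure.isProbabilityMeasure_map (μ := P) (hX.measurable h).aemeasurable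
  set ξ := P.map (X h) with hξ
  set s := Real.exp (-(q * h)) with hs
  have hs0 : 0 ≤ s := (Real.exp_pos _).le
  have hs1 : s < 1 := by
    rw [hs, Real.exp_lt_one_iff]
    have := mul_pos hq hh
    linarith
  have hpath : Measurable fun ω => (fun t : ℝ => X t ω) := measurable_pi_lambda _ hX.measurable
  have hgm := measurable_comp_floor_add_one (measurable_skeletonTransform h z w) h
  have hgi : Integrable (fun ω => skeletonTransform h z w (⌊E ω / h⌋₊ + 1) fun t => X t ω) P := by
    refine (integrable_const (1 : ℝ)).mono'
      (hgm.comp (hE_meas.prodMk hpath)).aestronglyMeasurable ?_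
    filter_upwards [hX.ae_skeletonMax_nonneg h] with ω hω
    rw [skeletonTransform, norm_mul]
    exact mul_le_one₀ (norm_exp_neg_mul_le_one (mul_nonneg hz (hω _))) (norm_nonneg _)
      (norm_exp_neg_mul_le_one (mul_nonneg_of_nonpos_of_nonpos hw
        (sub_nonpos.2 (le_skeletonMax _ ω))))
  have hmain := hE_indep.integral_comp_prodMk hE_meas hpath hgm hgi
  have hinner : ∀ ω, ∫ p, skeletonTransform h z w (⌊E ω / h⌋₊ + 1) p
      ∂(P.map fun ω => (fun t : ℝ => X t ω))
      = walkTransform ξ z w (⌊E ω / h⌋₊ + 1) 0 := fun ω => by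
    rw [← hX.integral_exp_skeletonMax hh.le hz hw,
      integral_map hpath.aemeasurable
        (measurable_skeletonTransform h z w _).aestronglyMeasurable]
    rfl
  have hNm : Measurable fun ω => ⌊E ω / h⌋₊ := by fun_prop
  have hNlaw : ∀ n : ℕ, (P.map fun ω => ⌊E ω / h⌋₊).real {n} = (1 - s) * s ^ n := fun n => by
    rw [map_measureReal_apply hNm (measurableSet_singleton n),
      ← expMeasure_real_floor_eq hq hh n, ← hE_law,
      map_measureReal_apply hE_meas (by
        exact (show Measurable fun x : ℝ => ⌊x / h⌋₊ by fun_prop) (measurableSet_singleton n))]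
    rfl
  have hNprob := Measure.isProbabilityMeasure_map (μ := P) hNm.aemeasurable
  have hV : ∀ n, ‖walkTransform ξ z w n 0‖ ≤ 1 := fun n => norm_walkTransform_le_one hz hw n 0
  have hsum : ∫ ω, walkTransform ξ z w (⌊E ω / h⌋₊ + 1) 0 ∂P
      = ∑' n : ℕ, ((1 - s) * s ^ n : ℝ) * walkTransform ξ z w (n + 1) 0 := by
    rw [← integral_map (φ := fun ω => ⌊E ω / h⌋₊)
      (f := fun n : ℕ => walkTransform ξ z w (n + 1) 0) hNm.aemeasurable
      (by fun_prop), integral_countable]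
    · refine tsum_congr fun n => ?_
      rw [hNlaw, Complex.real_smul]
    · exact (integrable_const (1 : ℝ)).mono' (by fun_prop)
        (Filter.Eventually.of_forall fun n => hV _)
  have hgint : ∫ ω, Complex.exp (-(z * skeletonMax X h (⌊E ω / h⌋₊ + 1) ω)) *
          Complex.exp (-(w * (X ((⌊E ω / h⌋₊ + 1 : ℕ) * h) ω
            - skeletonMax X h (⌊E ω / h⌋₊ + 1) ω : ℝ))) ∂P
      = ∑' n : ℕ, ((1 - s) * s ^ n : ℝ) * walkTransform ξ z w (n + 1) 0 := by
    rw [← hsum]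
    refine Eq.trans ?_ (hmain.trans (integral_congr_ae (Filter.Eventually.of_forall hinner)))
    rfl
  have hsV := (summable_norm_pow_mul_of_norm_le_one hs0 hs1 hV).of_norm
  rw [hgint, killedWalkTransform, hsV.tsum_eq_zero_add, ← tsum_mul_left, mul_add, ← tsum_mul_left]
  congr 1
  · simp [walkTransform]
  · refine tsum_congr fun n => ?_
    push_cast
    ring

end ExponentialSkeleton

section Supremum

variable {Ω : Type*} [MeasurableSpace Ω] {P : Measure Ω}
  {X : ℝ → Ω → ℝ} {q : ℝ} {z w : ℂ} {E : Ω → ℝ} {h : ℕ → ℝ}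

/-- The supremum of `X` over the random interval `[0, E]`. -/
def supUntil {Ω : Type*} (X : ℝ → Ω → ℝ) (E : Ω → ℝ) (ω : Ω) : ℝ :=
  sSup ((fun s => X s ω) '' Icc 0 (E ω))

/-- The distance between the supremum of `X` over `[0, E]` and the value of `X` at `E`. -/
def drawdownAt {Ω : Type*} (X : ℝ → Ω → ℝ) (E : Ω → ℝ) (ω : Ω) : ℝ :=
  supUntil X E ω - X (E ω) ω

theorem IsLevyProcess.ae_bddAbove (hX : IsLevyProcess P X) :
    ∀ᵐ ω ∂P, ∀ T, BddAbove ((fun s => X s ω) '' Icc 0 T) := by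
  filter_upwards [hX.cadlag] with ω hω T
  exact bddAbove_image_Icc_of_cadlag hω.1 hω.2 T

theorem IsLevyProcess.supUntil_nonneg (hX : IsLevyProcess P X) (hE : ∀ᵐ ω ∂P, 0 ≤ E ω) :
    ∀ᵐ ω ∂P, 0 ≤ supUntil X E ω := by
  filter_upwards [hX.ae_bddAbove, hX.init, hE] with ω hb h0 hEω
  have := le_csSup (hb (E ω)) ⟨0, ⟨le_rfl, hEω⟩, rfl⟩
  simp only [h0] at this
  exact this

theorem IsLevyProcess.drawdownAt_nonneg (hX : IsLevyProcess P X) (hE : ∀ᵐ ω ∂P, 0 ≤ E ω) :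
    ∀ᵐ ω ∂P, 0 ≤ drawdownAt X E ω := by
  filter_upwards [hX.ae_bddAbove, hE] with ω hb hEω
  exact sub_nonneg.2 (le_csSup (hb (E ω)) ⟨E ω, ⟨hEω, le_rfl⟩, rfl⟩)

theorem IsLevyProcess.tendsto_skeletonMax (hX : IsLevyProcess P X) (hE : ∀ᵐ ω ∂P, 0 ≤ E ω)
    (hpos : ∀ m, 0 < h m) (hlim : Filter.Tendsto h Filter.atTop (nhds 0)) :
    ∀ᵐ ω ∂P, Filter.Tendsto (fun m => skeletonMax X (h m) (⌊E ω / h m⌋₊ + 1) ω) Filter.atTop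
      (nhds (supUntil X E ω)) := by
  filter_upwards [hX.ae_bddAbove, hX.cadlag, hE] with ω hb hω hEω
  exact tendsto_partialSups_grid (x := fun s => X s ω) hpos hlim hω.1 (hb _) hEω

theorem IsLevyProcess.tendsto_skeleton (hX : IsLevyProcess P X) (hE : ∀ᵐ ω ∂P, 0 ≤ E ω)
    (hpos : ∀ m, 0 < h m) (hlim : Filter.Tendsto h Filter.atTop (nhds 0)) :
    ∀ᵐ ω ∂P, Filter.Tendsto (fun m => X ((⌊E ω / h m⌋₊ + 1 : ℕ) * h m) ω) Filter.atTop
      (nhds (X (E ω) ω)) := by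
  filter_upwards [hX.cadlag, hE] with ω hω hEω
  exact (hω.1 _ hEω).tendsto.comp (tendsto_floor_add_one_mul hpos hlim hEω)

theorem Measurable.comp_floor_add_one {γ : Type*} [MeasurableSpace γ] {F : ℕ → Ω → γ}
    (hE : Measurable E) (hF : ∀ n, Measurable (F n)) (h : ℝ) :
    Measurable fun ω => F (⌊E ω / h⌋₊ + 1) ω := by
  have h1 := measurable_comp_floor_add_one hF h
  have h2 : Measurable fun ω => (E ω, ω) := hE.prodMk measurable_id
  exact h1.comp h2

theorem IsLevyProcess.measurable_skeletonMax_floor (hX : IsLevyProcess P X) (hE : Measurable E)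
    (h : ℝ) : Measurable fun ω => skeletonMax X h (⌊E ω / h⌋₊ + 1) ω := by
  have hF : ∀ n : ℕ, Measurable fun ω => skeletonMax X h n ω :=
    fun n => hX.measurable_skeletonMax n
  exact hE.comp_floor_add_one hF h

theorem IsLevyProcess.measurable_skeleton_floor (hX : IsLevyProcess P X) (hE : Measurable E)
    (h : ℝ) : Measurable fun ω => X ((⌊E ω / h⌋₊ + 1 : ℕ) * h) ω := by
  have hF : ∀ n : ℕ, Measurable fun ω => X (n * h) ω := fun n => hX.measurable _
  exact hE.comp_floor_add_one hF h

theorem tendsto_one_div_add_one : Filter.Tendsto (fun m : ℕ => 1 / ((m : ℝ) + 1)) Filter.atTop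
    (nhds 0) := tendsto_one_div_add_atTop_nhds_zero_nat

theorem IsLevyProcess.aemeasurable_supUntil (hX : IsLevyProcess P X) (hE : ∀ᵐ ω ∂P, 0 ≤ E ω)
    (hE_meas : Measurable E) : AEMeasurable (supUntil X E) P :=
  aemeasurable_of_tendsto_metrizable_ae Filter.atTop
    (fun m : ℕ => (hX.measurable_skeletonMax_floor hE_meas (1 / ((m : ℝ) + 1))).aemeasurable)
    (hX.tendsto_skeletonMax hE (fun m => by positivity) tendsto_one_div_add_one)

theorem IsLevyProcess.aemeasurable_drawdownAt (hX : IsLevyProcess P X) (hE : ∀ᵐ ω ∂P, 0 ≤ E ω)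
    (hE_meas : Measurable E) : AEMeasurable (drawdownAt X E) P :=
  (hX.aemeasurable_supUntil hE hE_meas).sub <| aemeasurable_of_tendsto_metrizable_ae Filter.atTop
    (fun m : ℕ => (hX.measurable_skeleton_floor hE_meas (1 / ((m : ℝ) + 1))).aemeasurable)
    (hX.tendsto_skeleton hE (fun m => by positivity) tendsto_one_div_add_one)

/-- The joint transform of the supremum and of the drawdown at the time `E`. -/
def jointTransform (P : Measure Ω) (X : ℝ → Ω → ℝ) (E : Ω → ℝ) (z w : ℂ) : ℂ :=
  ∫ ω, Complex.exp (-(z * supUntil X E ω)) * Complex.exp (w * drawdownAt X E ω) ∂P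

theorem tendsto_ofReal_exp_neg_mul (hlim : Filter.Tendsto h Filter.atTop (nhds 0)) (q : ℝ) :
    Filter.Tendsto (fun m => ((Real.exp (-(q * h m)) : ℝ) : ℂ)) Filter.atTop (nhds 1) := by
  have h1 := ((Real.continuous_exp.tendsto 0).comp (by simpa using (hlim.const_mul q).neg) :
    Filter.Tendsto (fun m => Real.exp (-(q * h m))) Filter.atTop (nhds (Real.exp 0)))
  rw [Real.exp_zero] at h1
  exact_mod_cast (Complex.continuous_ofReal.tendsto 1).comp h1

theorem jointTransform_zero_right (z : ℂ) :
    jointTransform P X E z 0 = complexMGF (supUntil X E) P (-z) := by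
  simp [jointTransform, complexMGF]

theorem jointTransform_zero_left (w : ℂ) :
    jointTransform P X E 0 w = complexMGF (drawdownAt X E) P w := by
  simp [jointTransform, complexMGF]

variable [IsProbabilityMeasure P]

theorem IsLevyProcess.tendsto_killedWalkTransform (hX : IsLevyProcess P X)
    (hq : 0 < q) (hz : 0 ≤ z.re) (hw : w.re ≤ 0) (hE_meas : Measurable E)
    (hE_law : Measure.map E P = expMeasure q)
    (hE_indep : IndepFun E (fun ω => (fun t : ℝ => X t ω)) P)
    (hE : ∀ᵐ ω ∂P, 0 ≤ E ω)
    (hpos : ∀ m, 0 < h m) (hlim : Filter.Tendsto h Filter.atTop (nhds 0)) :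
    Filter.Tendsto (fun m => killedWalkTransform (P.map (X (h m))) (Real.exp (-(q * h m))) z w)
      Filter.atTop (nhds (jointTransform P X E z w)) := by
  have hs := tendsto_ofReal_exp_neg_mul hlim q
  have h_int : Filter.Tendsto (fun m =>
      ∫ ω, Complex.exp (-(z * skeletonMax X (h m) (⌊E ω / h m⌋₊ + 1) ω)) *
          Complex.exp (-(w * (X ((⌊E ω / h m⌋₊ + 1 : ℕ) * h m) ω
            - skeletonMax X (h m) (⌊E ω / h m⌋₊ + 1) ω : ℝ))) ∂P)
      Filter.atTop (nhds (jointTransform P X E z w)) := by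
    refine tendsto_integral_of_dominated_convergence (fun _ => (1 : ℝ)) (fun m => ?_)
      (integrable_const _) (fun m => ?_) ?_
    · have h1 := hX.measurable_skeletonMax_floor hE_meas (h m)
      have h2 := hX.measurable_skeleton_floor hE_meas (h m)
      refine Measurable.aestronglyMeasurable ?_
      have h3 := h2.sub h1
      exact (Complex.measurable_exp.comp
        ((measurable_const.mul (Complex.measurable_ofReal.comp h1)).neg)).mul
        (Complex.measurable_exp.comp
          ((measurable_const.mul (Complex.measurable_ofReal.comp h3)).neg))
    · filter_upwards [hX.ae_skeletonMax_nonneg (h m)] with ω hω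
      rw [norm_mul]
      exact mul_le_one₀ (norm_exp_neg_mul_le_one (mul_nonneg hz (hω _))) (norm_nonneg _)
        (norm_exp_neg_mul_le_one (mul_nonneg_of_nonpos_of_nonpos hw
          (sub_nonpos.2 (le_skeletonMax _ ω))))
    · filter_upwards [hX.tendsto_skeletonMax hE hpos hlim, hX.tendsto_skeleton hE hpos hlim]
        with ω h1 h2
      have hcont : Continuous fun p : ℝ × ℝ => Complex.exp (-(z * (p.1 : ℝ))) *
          Complex.exp (-(w * (p.2 - p.1 : ℝ))) := by fun_prop
      have h3 := (hcont.tendsto (supUntil X E ω, X (E ω) ω)).comp (h1.prodMk_nhds h2)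
      have heq : Complex.exp (-(z * supUntil X E ω)) * Complex.exp (w * drawdownAt X E ω) =
          Complex.exp (-(z * supUntil X E ω)) *
            Complex.exp (-(w * (X (E ω) ω - supUntil X E ω : ℝ))) := by
        congr 2
        rw [drawdownAt]
        push_cast
        ring
      rw [heq]
      exact h3
  have := ((tendsto_const_nhds (x := (1 : ℂ))).sub hs).add (hs.mul h_int)
  rw [sub_self, zero_add, one_mul] at this
  refine this.congr fun m => ?_
  rw [hX.integral_skeleton_at_exponential (hpos m) hq hz hw hE_meas hE_law hE_indep]
  push_cast
  ring

theorem IsLevyProcess.jointTransform_eq_mul (hX : IsLevyProcess P X)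
    (hq : 0 < q) (hz : 0 ≤ z.re) (hw : w.re ≤ 0) (hE_meas : Measurable E)
    (hE_law : Measure.map E P = expMeasure q)
    (hE_indep : IndepFun E (fun ω => (fun t : ℝ => X t ω)) P) (hE : ∀ᵐ ω ∂P, 0 ≤ E ω) :
    jointTransform P X E z w = jointTransform P X E z 0 * jointTransform P X E 0 w := by
  have hpos : ∀ m : ℕ, 0 < 1 / ((m : ℝ) + 1) := fun m => by positivity
  have hlim := tendsto_one_div_add_one
  have h0 : (0 : ℝ) ≤ (0 : ℂ).re := le_rfl
  have h0' : (0 : ℂ).re ≤ 0 := le_rfl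
  have t1 := hX.tendsto_killedWalkTransform hq hz hw hE_meas hE_law hE_indep hE hpos hlim
  have t2 := hX.tendsto_killedWalkTransform hq hz h0' hE_meas hE_law hE_indep hE hpos hlim
  have t3 := hX.tendsto_killedWalkTransform hq h0 hw hE_meas hE_law hE_indep hE hpos hlim
  refine tendsto_nhds_unique t1 ((t2.mul t3).congr fun m => ?_)
  have := Measure.isProbabilityMeasure_map (μ := P)
    (hX.measurable (1 / ((m : ℝ) + 1))).aemeasurable
  refine (killedWalkTransform_eq_mul (Real.exp_pos _).le ?_ hz hw).symm
  rw [Real.exp_lt_one_iff]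
  have := mul_pos hq (hpos m)
  linarith

theorem IsLevyProcess.norm_jointTransform_one_le (hX : IsLevyProcess P X)
    (hq : 0 < q) (hz : 0 ≤ z.re) (hE_meas : Measurable E)
    (hE_law : Measure.map E P = expMeasure q)
    (hE_indep : IndepFun E (fun ω => (fun t : ℝ => X t ω)) P) (hE : ∀ᵐ ω ∂P, 0 ≤ E ω) :
    ‖jointTransform P X E 1 0‖ ≤ 4 * (1 + ‖z‖) * ‖jointTransform P X E z 0‖ := by
  have hpos : ∀ m : ℕ, 0 < 1 / ((m : ℝ) + 1) := fun m => by positivity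
  have hlim := tendsto_one_div_add_one
  have h0' : (0 : ℂ).re ≤ 0 := le_rfl
  have h1 : (0 : ℝ) ≤ (1 : ℂ).re := by simp
  have t1 := hX.tendsto_killedWalkTransform hq h1 h0' hE_meas hE_law hE_indep hE hpos hlim
  have t2 := hX.tendsto_killedWalkTransform hq hz h0' hE_meas hE_law hE_indep hE hpos hlim
  refine le_of_tendsto_of_tendsto' t1.norm (t2.norm.const_mul _) fun m => ?_
  have := Measure.isProbabilityMeasure_map (μ := P)
    (hX.measurable (1 / ((m : ℝ) + 1))).aemeasurable
  refine norm_killedWalkTransform_one_le (Real.exp_pos _).le ?_ hz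
  rw [Real.exp_lt_one_iff]
  have := mul_pos hq (hpos m)
  linarith

theorem tendsto_one_sub_exp_div (hpos : ∀ m, 0 < h m)
    (hlim : Filter.Tendsto h Filter.atTop (nhds 0)) (c : ℂ) :
    Filter.Tendsto (fun m => (1 - Complex.exp (-(h m * c))) / h m) Filter.atTop (nhds c) := by
  have hd : HasDerivAt (fun u : ℂ => Complex.exp (-(u * c))) (-c) 0 := by
    have := (((hasDerivAt_id (0 : ℂ)).mul_const c).neg).cexp
    simpa using this
  have ht : Filter.Tendsto (fun m => (h m : ℂ)) Filter.atTop (nhdsWithin 0 {0}ᶜ) := by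
    refine tendsto_nhdsWithin_of_tendsto_nhds_of_eventually_within _ ?_
      (Filter.Eventually.of_forall fun m => ?_)
    · exact_mod_cast (Complex.continuous_ofReal.tendsto 0).comp hlim
    · simpa using (hpos m).ne'
  have := ((hasDerivAt_iff_tendsto_slope_zero.1 hd).comp ht).neg
  rw [neg_neg] at this
  refine this.congr fun m => ?_
  simp [div_eq_inv_mul]
  ring

theorem IsLevyProcess.jointTransform_self_mul (hX : IsLevyProcess P X)
    (hq : 0 < q) (hz : z.re = 0) (hE_meas : Measurable E)
    (hE_law : Measure.map E P = expMeasure q)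
    (hE_indep : IndepFun E (fun ω => (fun t : ℝ => X t ω)) P) (hE : ∀ᵐ ω ∂P, 0 ≤ E ω) {ψ : ℂ}
    (hψ : ∀ t : ℝ, 0 ≤ t → ∫ ω, Complex.exp (-(z * X t ω)) ∂P = Complex.exp (-(t * ψ))) :
    jointTransform P X E z z * (q + ψ) = q := by
  set h : ℕ → ℝ := fun m => 1 / ((m : ℝ) + 1) with hh
  have hpos : ∀ m : ℕ, 0 < h m := fun m => by positivity
  have hlim : Filter.Tendsto h Filter.atTop (nhds 0) := tendsto_one_div_add_one
  have t1 := hX.tendsto_killedWalkTransform hq hz.ge hz.le hE_meas hE_law hE_indep hE hpos hlim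
  refine tendsto_nhds_unique (t1.mul (tendsto_one_sub_exp_div hpos hlim (q + ψ)))
    ((tendsto_one_sub_exp_div hpos hlim q).congr fun m => ?_)
  have := Measure.isProbabilityMeasure_map (μ := P) (hX.measurable (h m)).aemeasurable
  set s := Real.exp (-(q * h m)) with hs
  have hs0 : 0 ≤ s := (Real.exp_pos _).le
  have hs1 : s < 1 := by
    rw [hs, Real.exp_lt_one_iff]
    have := mul_pos hq (hpos m)
    linarith
  have hV : ∀ n : ℕ, walkTransform (P.map (X (h m))) z z n 0
      = Complex.exp (-(h m * ψ)) ^ n := fun n => by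
    rw [← hX.integral_exp_skeletonMax (hpos m).le hz.ge hz.le n, ← Complex.exp_nat_mul]
    have := hψ (n * h m) (mul_nonneg (Nat.cast_nonneg n) (hpos m).le)
    rw [show (n : ℂ) * -(h m * ψ) = -((n * h m : ℝ) * ψ) by push_cast; ring, ← this]
    refine integral_congr_ae (Filter.Eventually.of_forall fun ω => ?_)
    simp only
    rw [← Complex.exp_add]
    congr 1
    push_cast
    ring
  have hr : ‖(s : ℂ) * Complex.exp (-(h m * ψ))‖ < 1 := by
    rw [norm_mul, Complex.norm_real, Real.norm_of_nonneg hs0]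
    have h1 := norm_walkTransform_le_one (ξ := P.map (X (h m))) hz.ge hz.le 1 0
    rw [hV, pow_one] at h1
    exact (mul_le_of_le_one_right hs0 h1).trans_lt hs1
  have hprod : (s : ℂ) * Complex.exp (-(h m * ψ)) = Complex.exp (-(h m * (q + ψ))) := by
    rw [hs, Complex.ofReal_exp, ← Complex.exp_add]
    congr 1
    push_cast
    ring
  have hne : 1 - (s : ℂ) * Complex.exp (-(h m * ψ)) ≠ 0 := fun h0 => by
    rw [← sub_eq_zero.1 h0, norm_one] at hr
    exact lt_irrefl _ hr
  simp_rw [killedWalkTransform, hV, ← mul_pow]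
  rw [tsum_geometric_of_norm_lt_one hr, ← hprod, mul_div_assoc', mul_assoc, inv_mul_cancel₀ hne,
    mul_one, hs, Complex.ofReal_exp]
  congr 3
  push_cast
  ring

end Supremum

section NonnegTransform

variable {Ω : Type*} [MeasurableSpace Ω] {P : Measure Ω} {R : Ω → ℝ}

theorem complexMGF_ofReal_nonneg (x : ℝ) :
    0 ≤ (complexMGF R P x).re ∧ (complexMGF R P x).im = 0 := by
  rw [complexMGF_ofReal]
  exact ⟨mgf_nonneg, Complex.ofReal_im _⟩

variable [IsProbabilityMeasure P]

theorem norm_exp_mul_le_one {z : ℂ} (hz : z.re ≤ 0) {x : ℝ} (hx : 0 ≤ x) :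
    ‖Complex.exp (z * x)‖ ≤ 1 := by
  rw [Complex.norm_exp, Real.exp_le_one_iff]
  simpa using mul_nonpos_of_nonpos_of_nonneg hz hx

theorem norm_complexMGF_le_one (hR : ∀ᵐ ω ∂P, 0 ≤ R ω) {z : ℂ} (hz : z.re ≤ 0) :
    ‖complexMGF R P z‖ ≤ 1 := by
  have h1 : ∀ᵐ ω ∂P, ‖Complex.exp (z * R ω)‖ ≤ 1 := by
    filter_upwards [hR] with ω hω using norm_exp_mul_le_one hz hω
  simpa [complexMGF] using norm_integral_le_of_norm_le_const h1

theorem continuousOn_complexMGF_of_nonneg (hRm : AEMeasurable R P) (hR : ∀ᵐ ω ∂P, 0 ≤ R ω) :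
    ContinuousOn (complexMGF R P) {z | z.re ≤ 0} := by
  refine continuousOn_of_dominated (bound := fun _ => (1 : ℝ)) (fun z _ => ?_) (fun z hz => ?_)
    (integrable_const _) (Filter.Eventually.of_forall fun ω => by fun_prop)
  · exact (Complex.measurable_exp.comp_aemeasurable
      ((Complex.measurable_ofReal.comp_aemeasurable hRm).const_mul z)).aestronglyMeasurable
  · filter_upwards [hR] with ω hω using norm_exp_mul_le_one hz hω

theorem integrable_exp_mul_of_nonneg (hRm : AEMeasurable R P) (hR : ∀ᵐ ω ∂P, 0 ≤ R ω) {t : ℝ}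
    (ht : t ≤ 0) : Integrable (fun ω => Real.exp (t * R ω)) P := by
  refine (integrable_const (1 : ℝ)).mono'
    (Real.measurable_exp.comp_aemeasurable (hRm.const_mul t)).aestronglyMeasurable ?_
  filter_upwards [hR] with ω hω
  rw [Real.norm_of_nonneg (Real.exp_pos _).le, Real.exp_le_one_iff]
  exact mul_nonpos_of_nonpos_of_nonneg ht hω

theorem differentiableOn_complexMGF_of_nonneg (hRm : AEMeasurable R P)
    (hR : ∀ᵐ ω ∂P, 0 ≤ R ω) : DifferentiableOn ℂ (complexMGF R P) {z | z.re < 0} := by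
  refine differentiableOn_complexMGF.mono fun z hz => ?_
  exact interior_maximal (fun t ht => integrable_exp_mul_of_nonneg hRm hR (le_of_lt ht))
    isOpen_Iio hz

end NonnegTransform

section LevyWienerHopf

variable {Ω : Type*} [MeasurableSpace Ω] {P : Measure Ω} [IsProbabilityMeasure P]
  {X : ℝ → Ω → ℝ} {q : ℝ} {E : Ω → ℝ}

theorem IsLevyProcess.isWienerHopfPair (hX : IsLevyProcess P X) (hq : 0 < q)
    (hE_meas : Measurable E) (hE_law : Measure.map E P = expMeasure q)
    (hE_indep : IndepFun E (fun ω => (fun t : ℝ => X t ω)) P) (hE : ∀ᵐ ω ∂P, 0 ≤ E ω) {Ψ : ℂ → ℂ}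
    (hchar : ∀ θ : ℝ, ∀ t : ℝ, 0 ≤ t →
      ∫ ω, Complex.exp (Complex.I * θ * X t ω) ∂P = Complex.exp (-(t : ℂ) * Ψ θ)) :
    IsWienerHopfPair q (fun z => q + Ψ (Complex.I * z))
      (fun z => complexMGF (supUntil X E) P (-z)) (complexMGF (drawdownAt X E) P) := by
  have hS := hX.supUntil_nonneg hE
  have hSm := hX.aemeasurable_supUntil hE hE_meas
  have hD := hX.drawdownAt_nonneg hE
  have hDm := hX.aemeasurable_drawdownAt hE hE_meas
  refine ⟨?_, continuousOn_complexMGF_of_nonneg hDm hD, ?_,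
    differentiableOn_complexMGF_of_nonneg hDm hD, fun z hz => norm_complexMGF_le_one hD hz, ?_,
    fun x _ => ?_, fun x _ => complexMGF_ofReal_nonneg x, ?_, fun z hz => ?_⟩
  · refine (continuousOn_complexMGF_of_nonneg hSm hS).comp continuous_neg.continuousOn
      fun z hz => ?_
    simpa using hz
  · refine (differentiableOn_complexMGF_of_nonneg hSm hS).comp differentiable_neg.differentiableOn
      fun z hz => ?_
    simpa using hz
  · have hpos : 0 < ‖jointTransform P X E 1 0‖ := by
      have h_int := integrable_exp_mul_of_nonneg hSm hS (t := -1) (by norm_num)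
      have := complexMGF_ofReal (X := supUntil X E) (μ := P) (-1)
      rw [jointTransform_zero_right]
      push_cast at this
      rw [this, norm_pos_iff, Complex.ofReal_ne_zero]
      exact (mgf_pos h_int).ne'
    refine ⟨‖jointTransform P X E 1 0‖ / 4, by positivity, fun z hz => ?_⟩
    have := hX.norm_jointTransform_one_le hq hz hE_meas hE_law hE_indep hE
    rw [jointTransform_zero_right z] at this
    linarith
  · have := complexMGF_ofReal_nonneg (R := supUntil X E) (P := P) (-x)
    push_cast at this
    exact this
  · simp [complexMGF]
  · have hIz : Complex.I * z = ((-z.im : ℝ) : ℂ) := by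
      apply Complex.ext <;> simp [hz]
    have hself := hX.jointTransform_self_mul hq hz hE_meas hE_law hE_indep hE
      (ψ := Ψ (Complex.I * z)) fun t ht => by
        rw [hIz, ← neg_mul, ← hchar (-z.im) t ht, ← hIz]
        refine integral_congr_ae (Filter.Eventually.of_forall fun ω => ?_)
        simp only
        rw [← mul_assoc, Complex.I_mul_I]
        ring_nf
    rw [hX.jointTransform_eq_mul hq hz.ge hz.le hE_meas hE_law hE_indep hE,
      jointTransform_zero_right, jointTransform_zero_left] at hself
    exact hself

end LevyWienerHopf

/-- **Law of the running supremum at an independent exponential time for the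
β-class (Theorem 2, distributional part).**  With `(ζₙ⁻)` the roots of
`q + Ψ(iζ) = 0` on the negative axis and `c_k⁻` the associated infinite-product
coefficients, `P(sup_{0≤s≤e} X_s ∈ A) = ∫_A (−∑_k c_k⁻ ζ_k⁻ e^{ζ_k⁻ x}) dx`
for Borel `A ⊆ (0,∞)`, where `e ∼ Exp(q)` is independent of `X`. -/
theorem betaClass_law_of_supremum
    {Ω : Type*} [MeasurableSpace Ω] (P : Measure Ω) [IsProbabilityMeasure P]
    (a σ c₁ c₂ α₁ α₂ β₁ β₂ lam₁ lam₂ : ℝ)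
    (hc₁ : 0 < c₁) (hc₂ : 0 < c₂) (hα₁ : 0 < α₁) (hα₂ : 0 < α₂)
    (hβ₁ : 0 < β₁) (hβ₂ : 0 < β₂)
    (hlam₁ : lam₁ ∈ Ioo (0 : ℝ) 3 ∧ lam₁ ≠ 1 ∧ lam₁ ≠ 2)
    (hlam₂ : lam₂ ∈ Ioo (0 : ℝ) 3 ∧ lam₂ ≠ 1 ∧ lam₂ ≠ 2)
    (X : ℝ → Ω → ℝ) (hX : IsLevyProcess P X)
    -- `X` has characteristic exponent `Ψ`
    (hchar : ∀ θ : ℝ, ∀ t : ℝ, 0 ≤ t →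
      ∫ ω, Complex.exp (Complex.I * θ * X t ω) ∂P =
        Complex.exp (-(t : ℂ) * betaClassExponent a σ c₁ c₂ α₁ α₂ β₁ β₂ lam₁ lam₂ θ))
    (q : ℝ) (hq : 0 < q)
    -- the roots `ζₙ⁻` on the negative imaginary axis
    (ζ : ℕ → ℝ)
    (hζ0 : ζ 0 ∈ Ioo (-(β₁ * α₁)) 0)
    (hζ : ∀ n : ℕ, 1 ≤ n → ζ n ∈ Ioo (-(β₁ * (α₁ + n))) (-(β₁ * (α₁ + n - 1))))
    (hroot : ∀ n : ℕ, (q : ℂ)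
      + betaClassExponent a σ c₁ c₂ α₁ α₂ β₁ β₂ lam₁ lam₂ (Complex.I * ζ n) = 0)
    -- the coefficients `c_k⁻`, given by convergent infinite products
    (c : ℕ → ℝ)
    (hc0 : c 0 = ∏' m : ℕ,
      (1 + ζ 0 / (β₁ * ((m : ℝ) + α₁))) / (1 - ζ 0 / ζ (m + 1)))
    (hck : ∀ k : ℕ, 1 ≤ k → c k =
      (1 + ζ k / (β₁ * ((k : ℝ) - 1 + α₁))) / (1 - ζ k / ζ 0) *
        ∏' m : {m : ℕ // 1 ≤ m ∧ m ≠ k},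
          (1 + ζ k / (β₁ * ((m : ℝ) - 1 + α₁))) / (1 - ζ k / ζ m))
    -- an exponential random variable with rate `q`, independent of `X`
    (E : Ω → ℝ) (hE_meas : Measurable E)
    (hE_law : Measure.map E P = expMeasure q)
    (hE_indep : IndepFun E (fun ω => (fun t : ℝ => X t ω)) P) :
    (Multipliable fun m : ℕ =>
        (1 + ζ 0 / (β₁ * ((m : ℝ) + α₁))) / (1 - ζ 0 / ζ (m + 1))) ∧
    (∀ k : ℕ, 1 ≤ k → Multipliable fun m : {m : ℕ // 1 ≤ m ∧ m ≠ k} =>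
        (1 + ζ k / (β₁ * ((m : ℝ) - 1 + α₁))) / (1 - ζ k / ζ m)) ∧
    ∀ A : Set ℝ, MeasurableSet A → A ⊆ Ioi 0 →
      Measure.map (fun ω => sSup ((fun s => X s ω) '' Icc 0 (E ω))) P A
        = ENNReal.ofReal
            (∫ x in A, -(∑' k : ℕ, c k * ζ k * Real.exp (ζ k * x))) := by
  have hp1 : ∀ k : ℕ, 1 ≤ k → ((k - 1 : ℕ) : ℝ) = (k : ℝ) - 1 := fun k hk => by
    rw [Nat.cast_sub hk, Nat.cast_one]
  have h_int : Interlaced (fun m => β₁ * (m + α₁)) ζ :=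
    { zero_left := by simpa using hζ0.1
      zero_right := hζ0.2
      left := fun n => by
        have := (hζ (n + 1) (by omega)).1
        rw [add_comm α₁] at this
        exact this
      right := fun n => by
        have := (hζ (n + 1) (by omega)).2
        push_cast at this
        rw [show α₁ + ((n : ℝ) + 1) - 1 = n + α₁ by ring] at this
        exact this
      tendsto := (Filter.tendsto_atTop_add_const_right _ α₁
        tendsto_natCast_atTop_atTop).const_mul_atTop hβ₁ }
  have hratio : ∀ k : ℕ, (fun m : {m : ℕ // 1 ≤ m ∧ m ≠ k} =>
      (1 + ζ k / (β₁ * (((m - 1 : ℕ) : ℝ) + α₁))) / (1 - ζ k / ζ m)) =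
      fun m : {m : ℕ // 1 ≤ m ∧ m ≠ k} =>
        (1 + ζ k / (β₁ * ((m : ℝ) - 1 + α₁))) / (1 - ζ k / ζ m) :=
    fun k => funext fun m => by rw [hp1 m m.2.1]
  have hlim : ∀ k, Filter.Tendsto (fun N => partialCoeff (fun m => β₁ * (m + α₁)) ζ N k)
      Filter.atTop (nhds (c k)) := by
    intro k
    rcases Nat.eq_zero_or_pos k with rfl | hk
    · rw [hc0]
      exact h_int.tendsto_partialCoeff_zero
    · rw [hck k hk, ← hratio, ← hp1 k hk]
      exact h_int.tendsto_partialCoeff hk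
  refine ⟨h_int.multipliable_ratio 0, fun k _ => ?_, fun A hA hA0 => ?_⟩
  · rw [← hratio]
    exact h_int.multipliable_ratio_subtype k
  have hE : ∀ᵐ ω ∂P, 0 ≤ E ω :=
    ae_of_ae_map hE_meas.aemeasurable (hE_law ▸ ae_expMeasure_nonneg hq)
  have hpair := hX.isWienerHopfPair hq hE_meas hE_law hE_indep hE hchar
  have hSm := hX.aemeasurable_supUntil hE hE_meas
  have := Measure.isProbabilityMeasure_map hSm
  refine (h_int.isMixture hlim).measure_apply_of_charFun_eq (μ := P.map (supUntil X E))
    (fun θ => ?_) hA hA0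
  rw [← complexMGF_mul_I hSm, mul_comm, ← hpair.eq_mixtureTransform hq hc₁ hα₁ hα₂ hβ₁ hβ₂
    hlam₁ hlam₂ h_int hlim hroot (by simp), neg_neg]

end
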